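/- Let n be 5 or 6 and let q be a prime power with gcd(q, n) = 1. Then there exists an element α in F_{q^n}* such that both α and α^{-1} are simultaneously primitive and 1-normal over F_q, except for the sole genuine exception (q, n) = (4, 5), for which no such α exists. -/

import Mathlib

open Polynomial

noncomputable section

/-- The action `h ∘ β = Σ_i a_i β^{q^i}` of a polynomial `h = Σ_i a_i x^i` over `F_q`
on an element `β` of an extension field. -/
def polyAct {Fq F : Type*} [Field Fq] [Field F] [Algebra Fq F]
    (q : ℕ) (h : Fq[X]) (β : F) : F :=
  h.sum fun i a => algebraMap Fq F a * β ^ q ^ i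

/-- `h` is the `F_q`-order of `β`: the monic divisor of `x^n - 1` of least degree
annihilating `β`. -/
def IsFqOrder {Fq F : Type*} [Field Fq] [Field F] [Algebra Fq F]
    (q n : ℕ) (h : Fq[X]) (β : F) : Prop :=
  h.Monic ∧ h ∣ (X ^ n - 1 : Fq[X]) ∧ polyAct q h β = 0 ∧
    ∀ h' : Fq[X], h'.Monic → h' ∣ (X ^ n - 1 : Fq[X]) → polyAct q h' β = 0 →
      h.natDegree ≤ h'.natDegree

/-- `α` is `k`-normal over `F_q`: its `F_q`-order has degree `n - k`. -/
def IsKNormal (Fq : Type*) {F : Type*} [Field Fq] [Field F] [Algebra Fq F]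
    (q n k : ℕ) (α : F) : Prop :=
  ∃ h : Fq[X], IsFqOrder q n h α ∧ h.natDegree = n - k

theorem exists_ne_zero_sum_smul_eq_zero_of_natDegree_lt {K ι : Type*} [Field K] [Fintype ι]
    (R : ι → K[X]) (N : ℕ) (hR : ∀ i, (R i).natDegree < N) (hN : N < Fintype.card ι) :
    ∃ b : ι → K, b ≠ 0 ∧ ∑ i, C (b i) * R i = 0 := by
  have hmem : ∀ i, R i ∈ degreeLT K N := fun i => by
    rw [mem_degreeLT]
    exact lt_of_le_of_lt degree_le_natDegree (by exact_mod_cast hR i)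
  let v : ι → degreeLT K N := fun i => ⟨R i, hmem i⟩
  have hfin : Module.finrank K (degreeLT K N) = N := by
    rw [(degreeLTEquiv K N).finrank_eq, Module.finrank_fin_fun]
  have : FiniteDimensional K (degreeLT K N) :=
    Module.Finite.equiv (degreeLTEquiv K N).symm
  have hli : ¬ LinearIndependent K v := fun h => by
    have := h.fintype_card_le_finrank
    omega
  rw [Fintype.not_linearIndependent_iff] at hli
  obtain ⟨b, hb, i, hi⟩ := hli
  refine ⟨b, fun h => hi (by rw [h]; rfl), ?_⟩
  have := congrArg Subtype.val hb
  simpa [v, smul_eq_C_mul] using this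

theorem sum_C_mul_ne_zero_of_injective_degree {K ι : Type*} [Field K] [Fintype ι]
    (P : ι → K[X]) (hP : ∀ i, P i ≠ 0) (hinj : Function.Injective fun i => (P i).natDegree)
    (a : ι → K) (ha : a ≠ 0) : ∑ i, C (a i) * P i ≠ 0 := by
  classical
  obtain ⟨i, hi⟩ := Function.ne_iff.1 ha
  have hdeg := degree_sum_eq_of_disjoint (fun i => C (a i) * P i) Finset.univ (by
    intro i hi j hj hij h
    simp only [Finset.mem_univ, true_and, Set.mem_ofPred_eq] at hi hj
    have hai : a i ≠ 0 := fun h => hi (by simp [h])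
    have haj : a j ≠ 0 := fun h => hj (by simp [h])
    apply hij
    apply hinj
    simp only [Function.comp, degree_C_mul hai, degree_C_mul haj] at h
    exact natDegree_eq_of_degree_eq h)
  intro h0
  rw [h0, degree_zero] at hdeg
  have := Finset.le_sup (f := fun i => degree (C (a i) * P i)) (Finset.mem_univ i)
  rw [← hdeg, le_bot_iff, degree_eq_bot] at this
  simp at this
  exact this.elim hi (hP i)

/-- The polynomial `X ^ (d p ^ (r - 1)) * ∑ i < r, (A X ^ d + B X ^ (-d)) ^ (p ^ i)`
in characteristic `p`, with `r` replaced by `r + 1`. -/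
def halfTracePoly {K : Type*} [Field K] (p r d : ℕ) (A B : K) : K[X] :=
  ∑ i ∈ Finset.range (r + 1),
    (C (A ^ p ^ i) * X ^ (d * p ^ r + d * p ^ i) + C (B ^ p ^ i) * X ^ (d * p ^ r - d * p ^ i))

theorem natDegree_halfTracePoly {K : Type*} [Field K] {p r d : ℕ} (hp : 1 < p) (hd : 0 < d)
    {A : K} (B : K) (hA : A ≠ 0) :
    (halfTracePoly p r d A B).natDegree = 2 * (d * p ^ r) := by
  apply natDegree_eq_of_le_of_coeff_ne_zero
  · apply natDegree_sum_le_of_forall_le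
    intro i hi
    have : d * p ^ i ≤ d * p ^ r :=
      Nat.mul_le_mul_left _ (Nat.pow_le_pow_right (by omega) (by simp at hi; omega))
    refine (natDegree_add_le _ _).trans (max_le ?_ ?_)
    · exact (natDegree_C_mul_X_pow_le _ _).trans (by omega)
    · exact (natDegree_C_mul_X_pow_le _ _).trans (by omega)
  · rw [halfTracePoly, finsetSum_coeff, Finset.sum_eq_single r]
    · have h0 : 0 < d * p ^ r := by positivity
      rw [coeff_add, coeff_C_mul_X_pow, coeff_C_mul_X_pow, if_pos (by omega), if_neg (by omega)]
      rw [add_zero]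
      exact pow_ne_zero _ hA
    · intro i hi hir
      have h0 : d * p ^ i < d * p ^ r :=
        Nat.mul_lt_mul_of_pos_left (Nat.pow_lt_pow_right hp (by simp at hi; omega)) hd
      rw [coeff_add, coeff_C_mul_X_pow, coeff_C_mul_X_pow, if_neg (by omega), if_neg (by omega),
        add_zero]
    · simp

theorem eval_halfTracePoly {K : Type*} [Field K] {p : ℕ} (r d : ℕ) [Fact p.Prime] [CharP K p]
    (A B : K) {y : K} (hy : y ≠ 0) :
    (halfTracePoly p r d A B).eval y =
      y ^ (d * p ^ r) * ∑ i ∈ Finset.range (r + 1), (A * y ^ d + B * (y ^ d)⁻¹) ^ p ^ i := by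
  rw [halfTracePoly, eval_finsetSum, Finset.mul_sum]
  refine Finset.sum_congr rfl fun i hi => ?_
  have hle : d * p ^ i ≤ d * p ^ r :=
    Nat.mul_le_mul_left _ (Nat.pow_le_pow_right (Fact.out : p.Prime).pos (by simp at hi; omega))
  rw [add_pow_char_pow]
  simp only [eval_add, eval_mul, eval_C, eval_pow, eval_X]
  rw [pow_sub₀ _ hy hle, pow_add, pow_mul y d (p ^ i)]
  ring

/-- **Stepanov's method** for the Artin–Schreier type equation
`Tr (A y ^ d + B y ^ (-d)) = c` over a field with `p ^ (2 (r + 1))` elements. -/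
theorem card_trace_level_le {K : Type*} [Field K] [Fintype K] [DecidableEq K] {p r d : ℕ}
    [Fact p.Prime] [CharP K p] (hK : Fintype.card K = (p ^ (r + 1)) ^ 2) (hd : 0 < d)
    (hpd : ¬ p ∣ d) {A : K} (B c : K) (hA : A ≠ 0) :
    (Finset.univ.filter fun y : K => y ≠ 0 ∧
      ∑ i ∈ Finset.range (2 * (r + 1)), (A * y ^ d + B * (y ^ d)⁻¹) ^ p ^ i = c).card ≤
      p ^ (r + 1) * p ^ r + 4 * d * p ^ (r + 1) := by
  have hp : p.Prime := Fact.out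
  set I := p ^ r with hI
  set s := p ^ (r + 1) with hs
  have hsI : s = p * I := by rw [hs, hI, pow_succ]; ring
  have hIpos : 0 < I := pow_pos hp.pos _
  have hspos : 0 < s := pow_pos hp.pos _
  set D := d * I with hD
  set G := halfTracePoly p r d A B with hG
  have hGdeg : G.natDegree = 2 * D := natDegree_halfTracePoly hp.one_lt hd B hA
  have hG0 : G ≠ 0 := fun h => by
    rw [h, natDegree_zero] at hGdeg
    have : 0 < D := by positivity
    omega
  let P : Fin I × Fin p × Fin (I + 2 * d) → K[X] := fun t =>
    X ^ (t.1.1 + s * t.2.2.1) * G ^ t.2.1.1 * X ^ (D * (p - 1 - t.2.1.1))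
  let R : Fin I × Fin p × Fin (I + 2 * d) → K[X] := fun t =>
    X ^ (t.1.1 * s + t.2.2.1) * (C c * X ^ D - G) ^ t.2.1.1 * X ^ (D * (p - 1 - t.2.1.1))
  have hDp : D * (p - 1) + D = d * s := by
    rw [hsI, hD]
    obtain ⟨k, hk⟩ : ∃ k, p = k + 1 := ⟨p - 1, by have := hp.one_lt; omega⟩
    rw [hk, Nat.add_sub_cancel]; ring
  have hPdeg : ∀ t, (P t).natDegree = t.1.1 + I * (p * t.2.2.1 + d * t.2.1.1) + D * (p - 1) := by
    rintro ⟨i, j, k⟩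
    simp only [P]
    rw [natDegree_mul (mul_ne_zero (pow_ne_zero _ X_ne_zero) (pow_ne_zero _ hG0))
      (pow_ne_zero _ X_ne_zero), natDegree_mul (pow_ne_zero _ X_ne_zero) (pow_ne_zero _ hG0),
      natDegree_X_pow, natDegree_X_pow, natDegree_pow, hGdeg, hsI]
    have : D * (p - 1 - j) + D * j = D * (p - 1) := by
      rw [← mul_add]; congr 1; have := j.2; omega
    rw [← this, hD]; ring
  have hP0 : ∀ t, P t ≠ 0 := fun t =>
    mul_ne_zero (mul_ne_zero (pow_ne_zero _ X_ne_zero) (pow_ne_zero _ hG0))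
      (pow_ne_zero _ X_ne_zero)
  have hPinj : Function.Injective fun t => (P t).natDegree := by
    rintro ⟨i, j, k⟩ ⟨i', j', k'⟩ h
    simp only [hPdeg] at h
    have h1 : (i : ℕ) + I * (p * k + d * j) = i' + I * (p * k' + d * j') := by omega
    have hi : (i : ℕ) = i' := by
      have := congrArg (· % I) h1
      simpa [Nat.add_mul_mod_self_left, Nat.mod_eq_of_lt i.2, Nat.mod_eq_of_lt i'.2] using this
    have h2 : p * k.1 + d * j = p * k' + d * j' := by
      rw [hi] at h1
      exact Nat.eq_of_mul_eq_mul_left hIpos (by omega)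
    have hj : (j : ℕ) = j' := by
      have h3 : d * j.1 ≡ d * j'.1 [MOD p] := by
        have := congrArg (· % p) h2
        simpa [Nat.ModEq] using this
      have h4 := Nat.ModEq.cancel_left_of_coprime
        ((Nat.Prime.coprime_iff_not_dvd hp).2 hpd) h3
      rwa [Nat.ModEq, Nat.mod_eq_of_lt j.2, Nat.mod_eq_of_lt j'.2] at h4
    have hk : (k : ℕ) = k' := by
      rw [hj] at h2
      exact Nat.eq_of_mul_eq_mul_left hp.pos (by omega)
    simp [Prod.ext_iff, Fin.ext_iff, hi, hj, hk]
  have hRdeg : ∀ t, (R t).natDegree < (I - 1) * s + (I + 2 * d) + 2 * (D * (p - 1)) := by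
    rintro ⟨i, j, k⟩
    simp only [R]
    have hsub : (C c * X ^ D - G).natDegree ≤ 2 * D :=
      (natDegree_sub_le _ _).trans (max_le ((natDegree_C_mul_X_pow_le _ _).trans (by omega))
        hGdeg.le)
    have h1 : (X ^ (i.1 * s + k.1) * (C c * X ^ D - G) ^ j.1 *
        X ^ (D * (p - 1 - j.1)) : K[X]).natDegree ≤
        (i.1 * s + k.1) + j.1 * (2 * D) + D * (p - 1 - j.1) := by
      refine natDegree_mul_le.trans (add_le_add (natDegree_mul_le.trans (add_le_add ?_ ?_)) ?_)
      · simp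
      · exact natDegree_pow_le.trans (Nat.mul_le_mul_left _ hsub)
      · simp
    have h2 : i.1 * s ≤ (I - 1) * s := Nat.mul_le_mul_right _ (by have := i.2; omega)
    have h3 : D * (p - 1 - j) + D * j = D * (p - 1) := by
      rw [← mul_add]; congr 1; have := j.2; omega
    have h4 : j.1 * (2 * D) = 2 * (D * j) := by ring
    have := k.2
    have h5 : D * j.1 ≤ D * (p - 1) := by omega
    omega
  obtain ⟨b, hb0, hb⟩ := exists_ne_zero_sum_smul_eq_zero_of_natDegree_lt R _ hRdeg (by
    simp only [Fintype.card_prod, Fintype.card_fin]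
    have h1 : I * (p * (I + 2 * d)) = I * s + 2 * (d * s) := by rw [hsI]; ring
    have h2 : (I - 1) * s + s = I * s := by
      obtain ⟨k, hk⟩ : ∃ k, I = k + 1 := ⟨I - 1, by omega⟩
      rw [hk, Nat.add_sub_cancel]; ring
    have h3 : d ≤ D := Nat.le_mul_of_pos_right _ hIpos
    have h4 : I < s := by rw [hsI]; exact lt_mul_of_one_lt_left hIpos hp.one_lt
    omega)
  have hfrob : ∀ z : K, (z ^ s) ^ s = z := fun z => by
    rw [← pow_mul, ← sq, ← hK, FiniteField.pow_card]
  have ha0 : (fun t => b t ^ s) ≠ 0 := fun h => hb0 (by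
    funext t
    have := congrFun h t
    exact pow_eq_zero_iff hspos.ne' |>.1 this)
  have hne := sum_C_mul_ne_zero_of_injective_degree P hP0 hPinj _ ha0
  set Ξ := ∑ t, C (b t ^ s) * P t with hΞ
  have hdegΞ : Ξ.natDegree ≤ s * I + 4 * d * s := by
    apply natDegree_sum_le_of_forall_le
    rintro ⟨i, j, k⟩ -
    refine natDegree_C_mul_le _ _ |>.trans ?_
    rw [hPdeg]
    have h1 : I * (p * k.1 + d * j.1) = s * k.1 + D * j := by rw [hsI, hD]; ring
    have h2 : D * j.1 ≤ D * (p - 1) := Nat.mul_le_mul_left _ (by have := j.2; omega)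
    have h3 : s * k.1 + s ≤ s * I + 2 * (d * s) := by
      have : s * (k.1 + 1) ≤ s * (I + 2 * d) := Nat.mul_le_mul_left _ k.2
      nlinarith
    have h4 : 4 * d * s = 4 * (d * s) := by ring
    have := i.2
    have h5 : I ≤ s := by rw [hsI]; exact Nat.le_mul_of_pos_left _ hp.pos
    simp only
    omega
  refine le_trans ?_ hdegΞ
  refine le_trans (Finset.card_le_card ?_) ((Multiset.toFinset_card_le _).trans Ξ.card_roots')
  intro y hy
  simp only [Finset.mem_filter, Finset.mem_univ, true_and] at hy
  obtain ⟨hy0, hyc⟩ := hy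
  rw [Multiset.mem_toFinset, mem_roots hne, IsRoot.def]
  set f := A * y ^ d + B * (y ^ d)⁻¹ with hf
  set g := ∑ i ∈ Finset.range (r + 1), f ^ p ^ i with hg
  have hGy : G.eval y = y ^ D * g := eval_halfTracePoly r d A B hy0
  have hgs : g ^ s = c - g := by
    rw [eq_sub_iff_add_eq, ← hyc, two_mul, Finset.sum_range_add, add_comm, ← hg]
    congr 1
    rw [hg, hs, sum_pow_char_pow]
    refine Finset.sum_congr rfl fun i _ => ?_
    rw [← pow_mul, ← pow_add, add_comm]
  have hsum : ∑ t : Fin I × Fin p × Fin (I + 2 * d), b t *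
      (y ^ (t.1.1 * s + t.2.2.1) * (c - g) ^ t.2.1.1) = 0 := by
    have h := congrArg (eval y) hb
    rw [eval_finsetSum, eval_zero] at h
    have hy' : y ^ (D * (p - 1)) ≠ 0 := pow_ne_zero _ hy0
    rw [← mul_left_inj' hy', zero_mul, Finset.sum_mul, ← h]
    refine Finset.sum_congr rfl fun t _ => ?_
    have h3 : D * (p - 1) = D * t.2.1.1 + D * (p - 1 - t.2.1.1) := by
      rw [← mul_add]; congr 1; have := t.2.1.2; omega
    simp only [R, eval_mul, eval_C, eval_pow, eval_X, eval_sub, hGy]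
    rw [h3, pow_add y (D * _), pow_mul y D t.2.1.1,
      show c * y ^ D - y ^ D * g = (c - g) * y ^ D by ring, mul_pow]
    ring
  have hpow : (Ξ.eval y) ^ s = 0 := by
    rw [hΞ, eval_finsetSum, hs, sum_pow_char_pow]
    have : ∀ t : Fin I × Fin p × Fin (I + 2 * d), (C (b t ^ s) * P t).eval y ^ p ^ (r + 1) =
        y ^ (D * s * (p - 1)) * (b t * (y ^ (t.1.1 * s + t.2.2.1) * (c - g) ^ t.2.1.1)) := by
      intro t
      have h3 : D * s * (p - 1) = D * s * t.2.1.1 + D * s * (p - 1 - t.2.1.1) := by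
        rw [← mul_add]; congr 1; have := t.2.1.2; omega
      rw [← hs]
      simp only [P, eval_mul, eval_C, eval_pow, eval_X, hGy, mul_pow, hfrob]
      rw [← hgs, h3]
      have h4 : ((y ^ (t.1.1 + s * t.2.2.1)) ^ s) = y ^ (t.1.1 * s + t.2.2.1) := by
        rw [pow_add, mul_pow, pow_mul y s, ← pow_mul y t.1.1 s, pow_right_comm, hfrob, ← pow_add]
      rw [h4]
      ring
    simp_rw [hs] at this ⊢
    rw [Finset.sum_congr rfl fun t _ => this t, ← Finset.mul_sum]
    simp_rw [hs] at hsum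
    rw [hsum, mul_zero]
  exact pow_eq_zero_iff hspos.ne' |>.1 hpow

/-- The additive character `x ↦ exp (2πi Tr(x) / p)` of a field of characteristic `p`. -/
def traceChar (p : ℕ) [NeZero p] (F : Type*) [Field F] [Algebra (ZMod p) F] : AddChar F ℂ :=
  (ZMod.stdAddChar (N := p)).compAddMonoidHom (Algebra.trace (ZMod p) F).toAddMonoidHom

theorem traceChar_apply (p : ℕ) [NeZero p] {F : Type*} [Field F] [Algebra (ZMod p) F] (x : F) :
    traceChar p F x = ZMod.stdAddChar (Algebra.trace (ZMod p) F x) := rfl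

theorem isPrimitive_traceChar (p : ℕ) [Fact p.Prime] (F : Type*) [Field F] [Finite F]
    [Algebra (ZMod p) F] : (traceChar p F).IsPrimitive := by
  apply AddChar.IsPrimitive.of_ne_one
  intro h
  obtain ⟨x, hx⟩ := Algebra.trace_surjective (ZMod p) F 1
  have h1 := DFunLike.congr_fun h x
  rw [traceChar_apply, hx, AddChar.one_apply] at h1
  have h2 := ZMod.isPrimitive_stdAddChar p
  apply h2 (one_ne_zero)
  rw [AddChar.mulShift_one]
  ext a
  obtain ⟨n, rfl⟩ := ZMod.natCast_zmod_surjective a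
  rw [← nsmul_one, AddChar.map_nsmul_eq_pow, h1, one_pow, AddChar.one_apply]

theorem traceChar_trace (p : ℕ) [Fact p.Prime] {F E : Type*} [Field F] [Field E] [Finite E]
    [Algebra (ZMod p) F] [Algebra (ZMod p) E] [Algebra F E] [IsScalarTower (ZMod p) F E] (x : E) :
    traceChar p F (Algebra.trace F E x) = traceChar p E x := by
  have : Finite F := Finite.of_injective _ (algebraMap F E).injective
  rw [traceChar_apply, traceChar_apply, Algebra.trace_trace]

/-- The twisted Kloosterman sum `∑ x, χ(x) ψ(a x + b x⁻¹)`. -/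
def kloosterman {F : Type*} [Field F] [Fintype F] (χ : MulChar F ℂ) (ψ : AddChar F ℂ) (a b : F) :
    ℂ :=
  ∑ x, χ x * ψ (a * x + b * x⁻¹)

theorem norm_mulChar_le_one {F : Type*} [Field F] [Finite F] (χ : MulChar F ℂ) (x : F) :
    ‖χ x‖ ≤ 1 := by
  by_cases hx : x = 0
  · rw [hx, MulChar.map_zero, norm_zero]; exact zero_le_one
  · obtain ⟨u, rfl⟩ := isUnit_iff_ne_zero.2 hx
    have h : (u : F) ^ orderOf u = 1 := by rw [← Units.val_pow_eq_pow_val, pow_orderOf_eq_one]; rfl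
    have h1 : χ u ^ orderOf u = 1 := by rw [← map_pow, h, map_one]
    exact (Complex.norm_eq_one_of_pow_eq_one h1 (orderOf_pos u).ne').le

theorem norm_sum_le_of_fiber_card_le {Y Z : Type*} [Fintype Y] [Fintype Z] [DecidableEq Z]
    (h : Y → Z) (e : Z → ℂ) (he : ∀ z, ‖e z‖ = 1) (he0 : ∑ z, e z = 0) (U : ℝ)
    (hU : ∀ z, ((Finset.univ.filter fun y => h y = z).card : ℝ) ≤ U) :
    ‖∑ y, e (h y)‖ ≤ Fintype.card Z * U - Fintype.card Y := by
  have h1 : ∑ y, e (h y) = ∑ z, ((Finset.univ.filter fun y => h y = z).card - U : ℂ) * e z := by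
    simp_rw [sub_mul, Finset.sum_sub_distrib, ← Finset.mul_sum, he0, mul_zero, sub_zero]
    rw [← Finset.sum_fiberwise_of_maps_to (t := Finset.univ) (g := h) (fun _ _ => Finset.mem_univ _)]
    refine Finset.sum_congr rfl fun z _ => ?_
    rw [← nsmul_eq_mul, ← Finset.sum_const]
    refine Finset.sum_congr rfl fun y hy => ?_
    rw [(Finset.mem_filter.1 hy).2]
  have hcard : (Fintype.card Y : ℝ) = ∑ z, ((Finset.univ.filter fun y => h y = z).card : ℝ) := by
    rw [← Nat.cast_sum,
      ← Finset.card_eq_sum_card_fiberwise (fun _ _ => Finset.mem_coe.2 (Finset.mem_univ _))]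
    rfl
  rw [h1, hcard]
  refine (norm_sum_le _ _).trans ?_
  have : (Fintype.card Z : ℝ) * U = ∑ z : Z, U := by simp
  rw [this, ← Finset.sum_sub_distrib]
  refine Finset.sum_le_sum fun z _ => ?_
  rw [norm_mul, he, mul_one, ← Complex.ofReal_natCast, ← Complex.ofReal_sub, Complex.norm_real,
    Real.norm_eq_abs, abs_sub_comm, abs_of_nonneg (sub_nonneg.2 (hU z))]

theorem norm_sum_traceChar_le {K : Type*} [Field K] [Fintype K] [DecidableEq K] {p r d : ℕ}
    [Fact p.Prime] [Algebra (ZMod p) K] (hK : Fintype.card K = (p ^ (r + 1)) ^ 2) (hd : 0 < d)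
    (hpd : ¬ p ∣ d) {A : K} (B : K) (hA : A ≠ 0) :
    ‖∑ y : Kˣ, traceChar p K (A * (y : K) ^ d + B * ((y : K) ^ d)⁻¹)‖ ≤
      4 * d * p * p ^ (r + 1) + 1 := by
  have hp : p.Prime := Fact.out
  have : CharP K p := charP_of_injective_algebraMap (algebraMap (ZMod p) K).injective p
  have hfin : Module.finrank (ZMod p) K = 2 * (r + 1) := by
    have h1 := Module.card_eq_pow_finrank (K := ZMod p) (V := K)
    rw [ZMod.card, hK, ← pow_mul] at h1
    have := Nat.pow_right_injective hp.two_le h1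
    omega
  have h := norm_sum_le_of_fiber_card_le (Y := Kˣ) (Z := ZMod p)
    (fun y => Algebra.trace (ZMod p) K (A * (y : K) ^ d + B * ((y : K) ^ d)⁻¹))
    (fun z => ZMod.stdAddChar z) (fun z => AddChar.norm_apply _ _)
    (AddChar.sum_eq_zero_of_ne_one (by
      intro h
      apply ZMod.isPrimitive_stdAddChar p one_ne_zero
      rw [AddChar.mulShift_one, h]))
    (p ^ (r + 1) * p ^ r + 4 * d * p ^ (r + 1)) (by
      intro z
      have h1 := card_trace_level_le hK hd hpd B (algebraMap (ZMod p) K z) hA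
      refine le_trans (Nat.cast_le.2 ?_) (show (_ : ℝ) ≤ _ by exact_mod_cast h1)
      refine Finset.card_le_card_of_injOn (fun y => (y : K)) ?_ (fun _ _ _ _ h => Units.ext h)
      intro y hy
      simp only [Finset.coe_filter, Finset.mem_univ, true_and, Set.mem_ofPred_eq] at hy ⊢
      refine ⟨y.ne_zero, ?_⟩
      rw [← hy, FiniteField.algebraMap_trace_eq_sum_pow, hfin, Nat.card_zmod])
  refine h.trans (le_of_eq ?_)
  rw [ZMod.card, Fintype.card_units, hK, Nat.cast_sub (Nat.one_le_pow _ _ (pow_pos hp.pos _))]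
  push_cast
  ring

theorem norm_kloosterman_le_of_pow_eq_one {K : Type*} [Field K] [Fintype K] [DecidableEq K] {p r d : ℕ}
    [Fact p.Prime] [Algebra (ZMod p) K] (hK : Fintype.card K = (p ^ (r + 1)) ^ 2) (hd : 0 < d)
    (hpd : ¬ p ∣ d) {a : K} (b : K) (ha : a ≠ 0) (χ : MulChar K ℂ) (hχ : χ ^ d = 1) :
    ‖kloosterman χ (traceChar p K) a b‖ ≤ 4 * d * p * p ^ (r + 1) + 1 := by
  set ψ := traceChar p K
  have hunit : ∀ y : Kˣ, kloosterman χ ψ a b =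
      ∑ w, χ w * ψ (a * w * (y : K) ^ d + b * w⁻¹ * ((y : K) ^ d)⁻¹) := by
    intro y
    have hy : χ ((y : K) ^ d) = 1 := by
      rw [map_pow, ← MulChar.pow_apply_coe, hχ, MulChar.one_apply_coe]
    rw [kloosterman, ← Equiv.sum_comp (Equiv.mulRight₀ ((y : K) ^ d) (pow_ne_zero _ y.ne_zero))]
    refine Finset.sum_congr rfl fun w _ => ?_
    rw [Equiv.mulRight₀_apply, map_mul, hy, mul_one, mul_inv, mul_assoc, mul_assoc]
  have hcard : (0 : ℝ) < Fintype.card Kˣ := by exact_mod_cast Fintype.card_pos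
  have hsum : (Fintype.card Kˣ : ℂ) * kloosterman χ ψ a b =
      ∑ w : Kˣ, χ w * ∑ y : Kˣ, ψ (a * w * (y : K) ^ d + b * (w : K)⁻¹ * ((y : K) ^ d)⁻¹) := by
    rw [← nsmul_eq_mul, ← Finset.card_univ, ← Finset.sum_const,
      Finset.sum_congr rfl fun y _ => hunit y,
      Finset.sum_comm]
    simp_rw [← Finset.mul_sum]
    symm
    refine Finset.sum_of_injOn (fun w : Kˣ => (w : K)) (fun _ _ _ _ h => Units.ext h)
      (fun _ _ => by simp) ?_ (fun _ _ => rfl)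
    intro w _ hw
    have : w = 0 := by
      by_contra h0
      exact hw ⟨Units.mk0 w h0, by simp, rfl⟩
    rw [this, MulChar.map_zero, zero_mul]
  have hn := congrArg norm hsum
  rw [norm_mul, Complex.norm_natCast] at hn
  refine le_of_mul_le_mul_left ?_ hcard
  rw [hn]
  refine (norm_sum_le _ _).trans ?_
  rw [← nsmul_eq_mul, ← Finset.card_univ, ← Finset.sum_const]
  refine Finset.sum_le_sum fun w _ => ?_
  rw [norm_mul]
  refine (mul_le_of_le_one_left (norm_nonneg _) (norm_mulChar_le_one χ _)).trans ?_
  exact norm_sum_traceChar_le hK hd hpd _ (mul_ne_zero ha w.ne_zero)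

/-- The lift of a multiplicative character to an extension through the norm. -/
def normLift {F : Type*} (E : Type*) [Field F] [Field E] [Finite E] [Algebra F E]
    (χ : MulChar F ℂ) : MulChar E ℂ where
  toMonoidHom := χ.toMonoidHom.comp (Algebra.norm F)
  map_nonunit' z hz := by
    have hz0 : z = 0 := by simpa [isUnit_iff_ne_zero] using hz
    have : FiniteDimensional F E := Module.Finite.of_finite
    subst hz0
    change χ (Algebra.norm F (0 : E)) = 0
    rw [Algebra.norm_zero, MulChar.map_zero]

theorem normLift_apply {F E : Type*} [Field F] [Field E] [Finite E] [Algebra F E]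
    (χ : MulChar F ℂ) (z : E) : normLift E χ z = χ (Algebra.norm F z) := rfl

theorem normLift_pow_eq_one {F E : Type*} [Field F] [Field E] [Finite E] [Algebra F E]
    {χ : MulChar F ℂ} {d : ℕ} (h : χ ^ d = 1) : normLift E χ ^ d = 1 := by
  ext z
  have : FiniteDimensional F E := Module.Finite.of_finite
  have hz : Algebra.norm F (z : E) ≠ 0 := (Algebra.norm_ne_zero_iff).2 z.ne_zero
  obtain ⟨u, hu⟩ := isUnit_iff_ne_zero.2 hz
  rw [MulChar.pow_apply_coe, normLift_apply, MulChar.one_apply_coe, ← hu, ← MulChar.pow_apply_coe,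
    h, MulChar.one_apply_coe]

section Quadratic

variable {F E : Type*} [Field F] [Field E] [Fintype F] [Fintype E] [Algebra F E]

theorem algebraMap_trace_of_finrank_two (h2 : Module.finrank F E = 2) (z : E) :
    algebraMap F E (Algebra.trace F E z) = z + z ^ Fintype.card F := by
  rw [FiniteField.algebraMap_trace_eq_sum_pow, h2, Finset.sum_range_succ, Finset.sum_range_one,
    Nat.card_eq_fintype_card, pow_zero, pow_one, pow_one]

theorem algebraMap_norm_of_finrank_two (h2 : Module.finrank F E = 2) (z : E) :
    algebraMap F E (Algebra.norm F z) = z * z ^ Fintype.card F := by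
  rw [FiniteField.algebraMap_norm_eq_prod_pow, h2, Finset.prod_range_succ, Finset.prod_range_one,
    Nat.card_eq_fintype_card, pow_zero, pow_one, pow_one]

theorem trace_inv_of_finrank_two (h2 : Module.finrank F E = 2) {z : E} (hz : z ≠ 0) :
    Algebra.trace F E z⁻¹ = Algebra.trace F E z * (Algebra.norm F z)⁻¹ := by
  apply (algebraMap F E).injective
  rw [map_mul, map_inv₀ (algebraMap F E), algebraMap_trace_of_finrank_two h2,
    algebraMap_trace_of_finrank_two h2,
    algebraMap_norm_of_finrank_two h2, inv_pow]
  field_simp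
  ring

theorem card_of_finrank_two (h2 : Module.finrank F E = 2) :
    Fintype.card E = Fintype.card F ^ 2 := by
  rw [Module.card_eq_pow_finrank (K := F), h2]

variable [DecidableEq F] [DecidableEq E]

theorem card_split_add_card_nonsplit_le_two (h2 : Module.finrank F E = 2) (w : F × F) :
    (Finset.univ.filter fun t : F × F => (t.1 + t.2, t.1 * t.2) = w).card +
    (Finset.univ.filter fun z : E => (Algebra.trace F E z, Algebra.norm F z) = w).card ≤ 2 := by
  obtain ⟨u, v⟩ := w
  set f := algebraMap F E
  have hf : Function.Injective f := f.injective
  let P : E[X] := X ^ 2 - C (f u) * X + C (f v)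
  have hP : P.Monic := by simp only [P]; monicity!
  have hPdeg : P.natDegree = 2 := by simp only [P]; compute_degree!
  set S₁ := Finset.univ.filter fun t : F × F => (t.1 + t.2, t.1 * t.2) = (u, v) with hS₁
  set S₂ := Finset.univ.filter fun z : E => (Algebra.trace F E z, Algebra.norm F z) = (u, v)
    with hS₂
  have hm₁ : ∀ t ∈ S₁, f t.1 + f t.2 = f u ∧ f t.1 * f t.2 = f v := by
    intro t ht
    simp only [hS₁, Finset.mem_filter, Finset.mem_univ, true_and, Prod.mk.injEq] at ht
    rw [← map_add, ← map_mul, ht.1, ht.2]; exact ⟨rfl, rfl⟩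
  have hm₂ : ∀ z ∈ S₂, z + z ^ Fintype.card F = f u ∧ z * z ^ Fintype.card F = f v := by
    intro z hz
    simp only [hS₂, Finset.mem_filter, Finset.mem_univ, true_and, Prod.mk.injEq] at hz
    rw [← algebraMap_trace_of_finrank_two h2, ← algebraMap_norm_of_finrank_two h2, hz.1, hz.2]
    exact ⟨rfl, rfl⟩
  have hinj : Set.InjOn (fun t : F × F => f t.1) S₁ := by
    intro t ht t' ht' h
    simp only at h
    have h1 := (hm₁ t ht).1
    have h1' := (hm₁ t' ht').1
    rw [h, ← h1'] at h1
    exact Prod.ext (hf h) (hf (add_left_cancel h1))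
  rw [← Finset.card_image_of_injOn hinj, ← Finset.card_union_add_card_inter]
  by_cases hne : (S₁.image (fun t : F × F => f t.1) ∩ S₂).Nonempty
  · obtain ⟨z, hz⟩ := hne
    rw [Finset.mem_inter, Finset.mem_image] at hz
    obtain ⟨⟨t, ht, rfl⟩, hz⟩ := hz
    have h1 := hm₂ _ hz
    rw [← map_pow, FiniteField.pow_card] at h1
    have hsub : S₁.image (fun t : F × F => f t.1) ∪ S₂ ⊆ {f t.1} := by
      intro y hy
      rw [Finset.mem_singleton, ← sub_eq_zero]
      suffices y ^ 2 - f u * y + f v = 0 by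
        rw [← h1.1, ← h1.2] at this
        exact pow_eq_zero_iff (two_ne_zero) |>.1 (by linear_combination this)
      rw [Finset.mem_union, Finset.mem_image] at hy
      rcases hy with ⟨t', ht', rfl⟩ | hy
      · rw [← (hm₁ t' ht').1, ← (hm₁ t' ht').2]; ring
      · rw [← (hm₂ y hy).1, ← (hm₂ y hy).2]; ring
    have c1 := Finset.card_le_card hsub
    have c2 := Finset.card_le_card ((Finset.inter_subset_left (s₂ := S₂)).trans
      (Finset.subset_union_left.trans hsub))
    rw [Finset.card_singleton] at c1 c2
    omega
  · rw [Finset.not_nonempty_iff_eq_empty.1 hne, Finset.card_empty, add_zero, ← hPdeg]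
    refine le_trans (Finset.card_le_card ?_) ((Multiset.toFinset_card_le _).trans P.card_roots')
    intro y hy
    rw [Multiset.mem_toFinset, mem_roots hP.ne_zero, IsRoot.def]
    simp only [P, eval_add, eval_sub, eval_mul, eval_pow, eval_X, eval_C]
    rw [Finset.mem_union, Finset.mem_image] at hy
    rcases hy with ⟨t', ht', rfl⟩ | hy
    · rw [← (hm₁ t' ht').1, ← (hm₁ t' ht').2]; ring
    · rw [← (hm₂ y hy).1, ← (hm₂ y hy).2]; ring

theorem sum_split_add_sum_nonsplit (h2 : Module.finrank F E = 2) (Φ : F × F → ℂ) :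
    ∑ t : F × F, Φ (t.1 + t.2, t.1 * t.2) +
      ∑ z : E, Φ (Algebra.trace F E z, Algebra.norm F z) = 2 * ∑ w, Φ w := by
  have hle := card_split_add_card_nonsplit_le_two (F := F) (E := E) h2
  have heq := (Finset.sum_eq_sum_iff_of_le (s := Finset.univ) (fun w _ => hle w)).1 (by
    rw [Finset.sum_add_distrib,
      ← Finset.card_eq_sum_card_fiberwise (fun _ _ => Finset.mem_coe.2 (Finset.mem_univ _)),
      ← Finset.card_eq_sum_card_fiberwise (fun _ _ => Finset.mem_coe.2 (Finset.mem_univ _)),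
      Finset.sum_const, Finset.card_univ, Finset.card_univ, card_of_finrank_two h2,
      Fintype.card_prod, smul_eq_mul]
    ring)
  rw [← Finset.sum_fiberwise_of_maps_to (t := Finset.univ) (s := Finset.univ)
      (g := fun t : F × F => (t.1 + t.2, t.1 * t.2)) (fun _ _ => Finset.mem_univ _),
    ← Finset.sum_fiberwise_of_maps_to (t := Finset.univ) (s := Finset.univ)
      (g := fun z : E => (Algebra.trace F E z, Algebra.norm F z)) (fun _ _ => Finset.mem_univ _),
    ← Finset.sum_add_distrib, Finset.mul_sum]
  refine Finset.sum_congr rfl fun w hw => ?_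
  have h1 : ∀ t ∈ Finset.univ.filter fun t : F × F => (t.1 + t.2, t.1 * t.2) = w,
      Φ (t.1 + t.2, t.1 * t.2) = Φ w := fun t ht => by rw [(Finset.mem_filter.1 ht).2]
  have h2 : ∀ z ∈ Finset.univ.filter fun z : E => (Algebra.trace F E z, Algebra.norm F z) = w,
      Φ (Algebra.trace F E z, Algebra.norm F z) = Φ w := fun t ht => by
    rw [(Finset.mem_filter.1 ht).2]
  rw [Finset.sum_congr rfl h1, Finset.sum_congr rfl h2, Finset.sum_const, Finset.sum_const,
    ← add_smul, heq w hw, nsmul_eq_mul, Nat.cast_ofNat]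

theorem norm_kloosterman_sq_le {p : ℕ} [Fact p.Prime] [Algebra (ZMod p) F] [Algebra (ZMod p) E]
    [IsScalarTower (ZMod p) F E] (h2 : Module.finrank F E = 2) (χ : MulChar F ℂ) {a b : F}
    (ha : a ≠ 0) (hb : b ≠ 0) :
    ‖kloosterman χ (traceChar p F) a b‖ ^ 2 ≤ 2 * Fintype.card F +
      ‖kloosterman (normLift E χ) (traceChar p E) (algebraMap F E a) (algebraMap F E b)‖ := by
  set ψ := traceChar p F with hψ
  let Φ : F × F → ℂ := fun w => χ w.2 * ψ (a * w.1 + b * (w.1 * w.2⁻¹))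
  have hΦ : ∑ w, Φ w = Fintype.card F * χ (-(b / a)) := by
    rw [Fintype.sum_prod_type_right]
    rw [Finset.sum_eq_single (-(b / a))]
    · simp only [Φ]
      rw [← Finset.mul_sum, mul_comm]
      congr 1
      rw [← Finset.card_univ, ← nsmul_one, ← Finset.sum_const]
      refine Finset.sum_congr rfl fun x _ => ?_
      rw [← AddChar.map_zero_eq_one ψ]
      congr 1
      field_simp
      ring
    · intro v _ hv
      simp only [Φ]
      by_cases hv0 : v = 0
      · simp [hv0, MulChar.map_zero]
      rw [← Finset.mul_sum]
      have : ∀ x, a * x + b * (x * v⁻¹) = x * (a + b * v⁻¹) := fun x => by ring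
      simp_rw [this]
      rw [AddChar.sum_mulShift _ (isPrimitive_traceChar p F), if_neg, Nat.cast_zero, mul_zero]
      intro h0
      apply hv
      field_simp at h0 ⊢
      linear_combination h0
    · simp
  have h1 : kloosterman χ ψ a b ^ 2 = ∑ t : F × F, Φ (t.1 + t.2, t.1 * t.2) := by
    rw [sq, kloosterman, Finset.sum_mul_sum, Fintype.sum_prod_type]
    refine Finset.sum_congr rfl fun x _ => Finset.sum_congr rfl fun y _ => ?_
    simp only [Φ]
    by_cases hx : x = 0
    · simp [hx, MulChar.map_zero]
    by_cases hy : y = 0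
    · simp [hy, MulChar.map_zero]
    rw [map_mul, mul_mul_mul_comm, ← AddChar.map_add_eq_mul]
    congr 2
    field_simp
    ring
  have h3 : kloosterman (normLift E χ) (traceChar p E) (algebraMap F E a) (algebraMap F E b) =
      ∑ z : E, Φ (Algebra.trace F E z, Algebra.norm F z) := by
    rw [kloosterman]
    refine Finset.sum_congr rfl fun z _ => ?_
    simp only [Φ, normLift_apply]
    by_cases hz : z = 0
    · have : FiniteDimensional F E := Module.Finite.of_finite
      simp [hz, MulChar.map_zero, Algebra.norm_zero]
    rw [← traceChar_trace p (F := F), map_add, ← Algebra.smul_def, ← Algebra.smul_def, map_smul,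
      map_smul, trace_inv_of_finrank_two h2 hz, smul_eq_mul, smul_eq_mul]
  have h4 := sum_split_add_sum_nonsplit (F := F) (E := E) h2 Φ
  rw [← h1, ← h3, hΦ] at h4
  rw [← norm_pow, eq_sub_of_add_eq h4]
  refine (norm_sub_le _ _).trans (add_le_add_left ?_ _)
  rw [norm_mul, norm_mul, Complex.norm_natCast, RCLike.norm_ofNat]
  have := norm_mulChar_le_one χ (-(b / a))
  have h5 : (0 : ℝ) ≤ Fintype.card F := Nat.cast_nonneg _
  nlinarith

end Quadratic

theorem norm_kloosterman_le_approx (p d : ℕ) [Fact p.Prime] (hd : 0 < d) (hpd : ¬ p ∣ d) (m : ℕ) :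
    ∀ (r : ℕ) (K : Type) [Field K] [Fintype K] [Algebra (ZMod p) K],
      Fintype.card K = (p ^ (r + 1)) ^ 2 → ∀ (χ : MulChar K ℂ), χ ^ d = 1 → ∀ a b : K,
      a ≠ 0 → b ≠ 0 →
      ‖kloosterman χ (traceChar p K) a b‖ ≤ (2 + (4 * d * p + 1) / 4 ^ m) * p ^ (r + 1) := by
  have hp : p.Prime := Fact.out
  classical
  induction m with
  | zero =>
    intro r K _ _ _ hK χ hχ a b ha hb
    refine (norm_kloosterman_le_of_pow_eq_one hK hd hpd b ha χ hχ).trans ?_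
    have : (1 : ℝ) ≤ p ^ (r + 1) := one_le_pow₀ (by exact_mod_cast hp.one_lt.le)
    nlinarith
  | succ m ih =>
    intro r K _ _ _ hK χ hχ a b ha hb
    have : CharP K p := charP_of_injective_algebraMap (algebraMap (ZMod p) K).injective p
    let E := FiniteField.Extension K p 2
    have : Fintype E := Fintype.ofFinite E
    have h2 : Module.finrank K E = 2 := FiniteField.finrank_extension K p 2
    have h := norm_kloosterman_sq_le (E := E) (p := p) h2 χ ha hb
    have hE : Fintype.card E = (p ^ (2 * r + 1 + 1)) ^ 2 := by
      rw [card_of_finrank_two h2, hK, ← pow_mul p (r + 1) 2]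
      ring_nf
    have h' := ih (2 * r + 1) E hE (normLift E χ) (normLift_pow_eq_one hχ)
      (algebraMap K E a) (algebraMap K E b) (by simpa using ha) (by simpa using hb)
    rw [hK] at h
    set t := ‖kloosterman χ (traceChar p K) a b‖
    set c : ℝ := (4 * d * p + 1) / 4 ^ m with hc
    have hc' : (4 * d * p + 1 : ℝ) / 4 ^ (m + 1) = c / 4 := by rw [hc, pow_succ]; ring
    rw [hc']
    have hc0 : 0 ≤ c := by positivity
    refine abs_le_of_sq_le_sq' ?_ (by positivity) |>.2
    refine (h.trans (add_le_add_right h' _)).trans ?_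
    push_cast
    rw [show 2 * r + 1 + 1 = (r + 1) * 2 by ring, pow_mul (p : ℝ) (r + 1) 2]
    have : (0 : ℝ) ≤ ((p : ℝ) ^ (r + 1)) ^ 2 := by positivity
    nlinarith [mul_nonneg this (sq_nonneg c)]

/-- The Weil bound for twisted Kloosterman sums with nonzero parameters. -/
theorem norm_kloosterman_le_of_ne_zero {F : Type*} [Field F] [Fintype F] (p : ℕ) [Fact p.Prime]
    [Algebra (ZMod p) F] (χ : MulChar F ℂ) {a b : F} (ha : a ≠ 0) (hb : b ≠ 0) :
    ‖kloosterman χ (traceChar p F) a b‖ ≤ 2 * √(Fintype.card F) := by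
  classical
  have hp : p.Prime := Fact.out
  have : CharP F p := charP_of_injective_algebraMap (algebraMap (ZMod p) F).injective p
  let E := FiniteField.Extension F p 2
  have : Fintype E := Fintype.ofFinite E
  have h2 : Module.finrank F E = 2 := FiniteField.finrank_extension F p 2
  have h := norm_kloosterman_sq_le (E := E) (p := p) h2 χ ha hb
  obtain ⟨n, -, hn⟩ := FiniteField.card F p
  obtain ⟨r, hr⟩ : ∃ r, (n : ℕ) = r + 1 := ⟨n - 1, by have := n.pos; omega⟩
  rw [hr] at hn
  have hE : Fintype.card E = (p ^ (r + 1)) ^ 2 := by rw [card_of_finrank_two h2, hn]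
  have hcard : 1 < Fintype.card F := Fintype.one_lt_card
  have hpd : ¬ p ∣ Fintype.card F - 1 := by
    intro hdvd
    have h1 : p ∣ Fintype.card F := by rw [hn, pow_succ]; exact dvd_mul_left _ _
    have h3 : p ∣ 1 := by
      have := Nat.dvd_sub h1 hdvd
      rwa [Nat.sub_sub_self hcard.le] at this
    exact hp.one_lt.ne' (Nat.dvd_one.1 h3)
  have hχ : χ ^ (Fintype.card F - 1) = 1 :=
    orderOf_dvd_iff_pow_eq_one.1 χ.orderOf_dvd_card_sub_one
  have hm := fun m => norm_kloosterman_le_approx p (Fintype.card F - 1) (by omega) hpd m r E hE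
    (normLift E χ) (normLift_pow_eq_one hχ) (algebraMap F E a) (algebraMap F E b)
    (by simpa using ha) (by simpa using hb)
  have hlim : ‖kloosterman (normLift E χ) (traceChar p E) (algebraMap F E a) (algebraMap F E b)‖ ≤
      2 * p ^ (r + 1) := by
    have ht : Filter.Tendsto (fun m : ℕ => (2 + (4 * (Fintype.card F - 1 : ℕ) * p + 1) / 4 ^ m) *
        (p : ℝ) ^ (r + 1)) Filter.atTop (nhds ((2 + 0) * (p : ℝ) ^ (r + 1))) := by
      refine (Filter.Tendsto.const_add _ ?_).mul_const _
      refine Filter.Tendsto.const_div_atTop (tendsto_pow_atTop_atTop_of_one_lt (by norm_num)) _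
    rw [add_zero] at ht
    exact ge_of_tendsto' ht hm
  refine abs_le_of_sq_le_sq' ?_ (by positivity) |>.2
  rw [mul_pow, Real.sq_sqrt (Nat.cast_nonneg _)]
  refine (h.trans (add_le_add_right hlim _)).trans (le_of_eq ?_)
  rw [hn]
  push_cast
  ring

theorem norm_gaussSum_le {F : Type*} [Field F] [Fintype F] (χ : MulChar F ℂ) {ψ : AddChar F ℂ}
    (hψ : ψ.IsPrimitive) : ‖gaussSum χ ψ‖ ≤ √(Fintype.card F) := by
  classical
  by_cases hχ : χ = 1
  · subst hχ
    rw [gaussSum_one_left]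
    · rw [norm_neg, norm_one]
      exact Real.one_le_sqrt.2 (by exact_mod_cast Fintype.card_pos)
    · rintro rfl
      exact hψ one_ne_zero (AddChar.mulShift_one _)
  · have h := gaussSum_mul_gaussSum_eq_card hχ hψ
    rw [← star_gaussSum_eq] at h
    have h1 := congrArg norm h
    rw [norm_mul, norm_star, Complex.norm_natCast, ← sq] at h1
    rw [← h1, Real.sqrt_sq (norm_nonneg _)]

/-- The Weil bound for twisted Kloosterman sums. -/
theorem norm_kloosterman_le {F : Type*} [Field F] [Fintype F] (p : ℕ) [Fact p.Prime]
    [Algebra (ZMod p) F] (χ : MulChar F ℂ) {a b : F} (hab : a ≠ 0 ∨ b ≠ 0) :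
    ‖kloosterman χ (traceChar p F) a b‖ ≤ 2 * √(Fintype.card F) := by
  have hprim := isPrimitive_traceChar p F
  have hshift : ∀ c : F, c ≠ 0 → (AddChar.mulShift (traceChar p F) c).IsPrimitive := by
    intro c hc
    exact AddChar.IsPrimitive.of_ne_one (hprim hc)
  have hG : ∀ (η : MulChar F ℂ) (c : F), c ≠ 0 →
      ‖∑ x, η x * traceChar p F (c * x)‖ ≤ 2 * √(Fintype.card F) := fun η c hc => by
    have := norm_gaussSum_le η (hshift c hc)
    simp only [gaussSum, AddChar.mulShift_apply] at this
    linarith [Real.sqrt_nonneg (Fintype.card F)]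
  by_cases ha : a = 0
  · have hb : b ≠ 0 := by tauto
    refine le_trans (le_of_eq ?_) (hG χ⁻¹ b hb)
    rw [kloosterman, ← Equiv.sum_comp (Equiv.inv F)]
    simp [ha, MulChar.inv_apply']
  · by_cases hb : b = 0
    · simpa [kloosterman, hb] using hG χ a ha
    · exact norm_kloosterman_le_of_ne_zero p χ ha hb

section TraceZero

variable (Fq F : Type*) [Field Fq] [Field F] [Fintype F] [Algebra Fq F]

open scoped Classical in
/-- The nonzero elements `x` such that both `x` and `x⁻¹` have trace zero. -/
def traceZeroPairs : Finset F :=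
  Finset.univ.filter fun x => x ≠ 0 ∧ Algebra.trace Fq F x = 0 ∧ Algebra.trace Fq F x⁻¹ = 0

variable {Fq F}

theorem mem_traceZeroPairs {x : F} : x ∈ traceZeroPairs Fq F ↔
    x ≠ 0 ∧ Algebra.trace Fq F x = 0 ∧ Algebra.trace Fq F x⁻¹ = 0 := by
  simp [traceZeroPairs]

variable [Fintype Fq]

theorem card_sq_mul_sum_traceZeroPairs (p : ℕ) [Fact p.Prime] [Algebra (ZMod p) Fq]
    [Algebra (ZMod p) F] [IsScalarTower (ZMod p) Fq F] (χ : MulChar F ℂ) :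
    (Fintype.card Fq : ℂ) ^ 2 * ∑ x ∈ traceZeroPairs Fq F, χ x =
      ∑ a : Fq × Fq, kloosterman χ (traceChar p F) (algebraMap Fq F a.1) (algebraMap Fq F a.2) := by
  classical
  have hind : ∀ y : F, ∑ a : Fq, traceChar p F (algebraMap Fq F a * y) =
      if Algebra.trace Fq F y = 0 then (Fintype.card Fq : ℂ) else 0 := by
    intro y
    have := AddChar.sum_mulShift (Algebra.trace Fq F y) (isPrimitive_traceChar p Fq)
    rw [Nat.cast_ite, Nat.cast_zero] at this
    rw [← this]
    refine Finset.sum_congr rfl fun a _ => ?_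
    rw [← traceChar_trace p (F := Fq), ← Algebra.smul_def, map_smul, smul_eq_mul]
  simp only [kloosterman]
  rw [Finset.sum_comm, traceZeroPairs, Finset.sum_filter, Finset.mul_sum]
  refine Finset.sum_congr rfl fun x _ => ?_
  rw [← Finset.mul_sum, Fintype.sum_prod_type]
  simp only [AddChar.map_add_eq_mul, ← Finset.mul_sum, ← Finset.sum_mul, hind]
  by_cases hx : x = 0
  · simp [hx, MulChar.map_zero]
  · by_cases h1 : Algebra.trace Fq F x = 0 <;> by_cases h2 : Algebra.trace Fq F x⁻¹ = 0 <;>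
      simp [hx, h1, h2]
    ring

theorem exists_prime_algebra_tower (Fq F : Type*) [Field Fq] [Field F] [Finite Fq] [Finite F]
    [Algebra Fq F] :
    ∃ (p : ℕ) (_ : Fact p.Prime) (_ : Algebra (ZMod p) Fq) (_ : Algebra (ZMod p) F),
      IsScalarTower (ZMod p) Fq F := by
  obtain ⟨p, hp⟩ := CharP.exists Fq
  have : Fact p.Prime := ⟨CharP.char_is_prime Fq p⟩
  let i1 := ZMod.algebra Fq p
  have : CharP F p := charP_of_injective_algebraMap (algebraMap Fq F).injective p
  let i2 := ZMod.algebra F p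
  exact ⟨p, inferInstance, i1, i2, .of_algebraMap_eq' (Subsingleton.elim _ _)⟩

theorem norm_sum_kloosterman_sub_le (p : ℕ) [Fact p.Prime] [Algebra (ZMod p) F]
    (χ : MulChar F ℂ) :
    ‖∑ a : Fq × Fq, kloosterman χ (traceChar p F) (algebraMap Fq F a.1) (algebraMap Fq F a.2) -
      ∑ x, χ x‖ ≤ ((Fintype.card Fq : ℝ) ^ 2 - 1) * (2 * √(Fintype.card F)) := by
  classical
  have h0 : ∑ x, χ x = kloosterman χ (traceChar p F) (algebraMap Fq F (0 : Fq × Fq).1)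
      (algebraMap Fq F (0 : Fq × Fq).2) := by
    simp [kloosterman]
  rw [← Finset.add_sum_erase _ _ (Finset.mem_univ (0 : Fq × Fq)), ← h0, add_sub_cancel_left]
  have hc : ((Fintype.card Fq : ℝ) ^ 2 - 1) * (2 * √(Fintype.card F)) =
      ∑ a ∈ Finset.univ.erase (0 : Fq × Fq), (2 * √(Fintype.card F)) := by
    rw [Finset.sum_const, Finset.card_erase_of_mem (Finset.mem_univ _), Finset.card_univ,
      Fintype.card_prod, nsmul_eq_mul, Nat.cast_sub (Nat.mul_pos Fintype.card_pos Fintype.card_pos)]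
    push_cast
    ring
  rw [hc]
  refine norm_sum_le_of_le _ fun a ha => norm_kloosterman_le p χ ?_
  by_contra! h
  simp only [map_eq_zero] at h
  exact (Finset.mem_erase.1 ha).1 (Prod.ext h.1 h.2)

theorem norm_sum_traceZeroPairs_le {χ : MulChar F ℂ} (hχ : χ ≠ 1) :
    ‖∑ x ∈ traceZeroPairs Fq F, χ x‖ ≤ 2 * √(Fintype.card F) := by
  obtain ⟨p, _, _, _, _⟩ := exists_prime_algebra_tower Fq F
  have h := norm_sum_kloosterman_sub_le (Fq := Fq) p χ
  rw [MulChar.sum_eq_zero_of_ne_one hχ, sub_zero, ← card_sq_mul_sum_traceZeroPairs p, norm_mul,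
    norm_pow, Complex.norm_natCast] at h
  have hq : (0 : ℝ) < (Fintype.card Fq : ℝ) ^ 2 := by have := Fintype.card_pos (α := Fq); positivity
  refine le_of_mul_le_mul_left (h.trans ?_) hq
  nlinarith [Real.sqrt_nonneg (Fintype.card F)]

theorem card_traceZeroPairs_ge : (Fintype.card F : ℝ) / (Fintype.card Fq : ℝ) ^ 2 -
    2 * √(Fintype.card F) ≤ (traceZeroPairs Fq F).card := by
  classical
  obtain ⟨p, _, _, _, _⟩ := exists_prime_algebra_tower Fq F
  have h := norm_sum_kloosterman_sub_le (Fq := Fq) p (1 : MulChar F ℂ)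
  have h1 : ∑ x ∈ traceZeroPairs Fq F, (1 : MulChar F ℂ) x = (traceZeroPairs Fq F).card := by
    rw [← nsmul_one, ← Finset.sum_const]
    refine Finset.sum_congr rfl fun x hx => ?_
    rw [MulChar.one_apply (isUnit_iff_ne_zero.2 (mem_traceZeroPairs.1 hx).1)]
  have hF : 1 ≤ Fintype.card F := Fintype.card_pos
  rw [← card_sq_mul_sum_traceZeroPairs p, MulChar.sum_one_eq_card_units, Fintype.card_units, h1]
    at h
  have hre := (Complex.abs_re_le_norm _).trans h
  simp only [Complex.sub_re, Nat.cast_sub hF, Nat.cast_one, Complex.one_re, Complex.natCast_re,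
    ← Nat.cast_pow, ← Nat.cast_mul] at hre
  have h2 := (abs_le.1 hre).1
  push_cast at h2
  have hq : (0 : ℝ) < (Fintype.card Fq : ℝ) ^ 2 := by have := Fintype.card_pos (α := Fq); positivity
  have hs : (1 : ℝ) ≤ √(Fintype.card F) := Real.one_le_sqrt.2 (by exact_mod_cast hF)
  rw [sub_le_iff_le_add, div_le_iff₀ hq]
  nlinarith

end TraceZero

section Sieve

variable {F : Type*} [Field F] (A : Finset F) (χ : ℕ → MulChar F ℂ)

open scoped Classical in
/-- The elements of `A` on which none of the characters `χ l`, `l ∈ P`, is trivial. -/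
def sieved (P : Finset ℕ) : Finset F :=
  A.filter fun x => ∀ l ∈ P, χ l x ≠ 1

variable {A χ}

theorem mem_sieved {P : Finset ℕ} {x : F} :
    x ∈ sieved A χ P ↔ x ∈ A ∧ ∀ l ∈ P, χ l x ≠ 1 := by
  simp [sieved]

theorem sum_range_pow_of_pow_eq_one {l : ℕ} {z : ℂ} (hz : z ^ l = 1) :
    ∑ j ∈ Finset.range l, z ^ j = if z = 1 then (l : ℂ) else 0 := by
  split_ifs with h
  · simp [h]
  · rw [geom_sum_eq h, hz, sub_self, zero_div]

theorem sum_sieved_insert (hA : ∀ x ∈ A, x ≠ 0) {l : ℕ} (hl : 0 < l) (hχl : χ l ^ l = 1)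
    (P : Finset ℕ) (φ : MulChar F ℂ) :
    ∑ x ∈ sieved A χ (insert l P), φ x = (1 - (l : ℂ)⁻¹) * ∑ x ∈ sieved A χ P, φ x -
      (l : ℂ)⁻¹ * ∑ j ∈ Finset.Ico 1 l, ∑ x ∈ sieved A χ P, (φ * χ l ^ j) x := by
  classical
  have h1 : sieved A χ (insert l P) = (sieved A χ P).filter fun x => χ l x ≠ 1 := by
    ext x
    simp only [mem_sieved, Finset.mem_filter, Finset.mem_insert, forall_eq_or_imp]
    tauto
  rw [h1, Finset.sum_filter, Finset.sum_comm, Finset.mul_sum, Finset.mul_sum,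
    ← Finset.sum_sub_distrib]
  refine Finset.sum_congr rfl fun x hx => ?_
  obtain ⟨u, rfl⟩ := isUnit_iff_ne_zero.2 (hA x (mem_sieved.1 hx).1)
  have hz : χ l u ^ l = 1 := by rw [← MulChar.pow_apply_coe, hχl, MulChar.one_apply_coe]
  have h2 := sum_range_pow_of_pow_eq_one hz
  rw [Finset.range_eq_Ico, Finset.sum_eq_sum_Ico_succ_bot hl, pow_zero] at h2
  simp only [MulChar.mul_apply, MulChar.pow_apply_coe, ← Finset.mul_sum]
  rw [eq_sub_of_add_eq' h2]
  have hl0 : (l : ℂ) ≠ 0 := by exact_mod_cast hl.ne'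
  by_cases h : χ l u = 1
  · simp only [h]
    field_simp
    simp
  · rw [if_pos h, if_neg h]
    ring

/-- The density factor `∏ l ∈ P, (1 - 1 / l)`. -/
def sieveDensity (P : Finset ℕ) : ℝ := ∏ l ∈ P, (1 - (l : ℝ)⁻¹)

theorem sieveDensity_pos {P : Finset ℕ} (hP : ∀ l ∈ P, l.Prime) : 0 < sieveDensity P :=
  Finset.prod_pos fun l hl => by
    have : (1 : ℝ) < l := by exact_mod_cast (hP l hl).one_lt
    linarith [inv_lt_one_of_one_lt₀ this]

theorem norm_sum_sieved_le (hA : ∀ x ∈ A, x ≠ 0) {B : ℝ}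
    (hB : ∀ φ : MulChar F ℂ, φ ≠ 1 → ‖∑ x ∈ A, φ x‖ ≤ B) {P : Finset ℕ}
    (hP : ∀ l ∈ P, l.Prime ∧ orderOf (χ l) = l) :
    ∀ (φ : MulChar F ℂ) (m : ℕ), φ ≠ 1 → φ ^ m = 1 → (∀ l ∈ P, m.Coprime l) →
    ‖∑ x ∈ sieved A χ P, φ x‖ ≤ sieveDensity P * 2 ^ P.card * B := by
  classical
  induction P using Finset.induction_on with
  | empty =>
    intro φ m hφ _ _
    simpa [sieved, sieveDensity] using hB φ hφ
  | insert l P hlP ih =>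
    intro φ m hφ hφm hm
    obtain ⟨hl, hlχ⟩ := hP l (Finset.mem_insert_self _ _)
    have hP' : ∀ l ∈ P, l.Prime ∧ orderOf (χ l) = l := fun l hl =>
      hP l (Finset.mem_insert_of_mem hl)
    have hχl : χ l ^ l = 1 := by
      have := pow_orderOf_eq_one (χ l)
      rwa [hlχ] at this
    have ih' := ih hP'
    have hl1 : (1 : ℝ) < l := by exact_mod_cast hl.one_lt
    rw [sum_sieved_insert hA hl.pos hχl]
    have hterm : ∀ j ∈ Finset.Ico 1 l, ‖∑ x ∈ sieved A χ P, (φ * χ l ^ j) x‖ ≤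
        sieveDensity P * 2 ^ P.card * B := by
      intro j hj
      rw [Finset.mem_Ico] at hj
      refine ih' _ (m * l) ?_ ?_ ?_
      · intro h
        have h1 : (χ l) ^ (j * m) = 1 := by
          have := congrArg (· ^ m) h
          simpa [mul_pow, hφm, pow_mul] using this
        have h2 := orderOf_dvd_of_pow_eq_one h1
        rw [hlχ] at h2
        rcases hl.dvd_mul.1 h2 with h3 | h3
        · exact absurd (Nat.le_of_dvd (by omega) h3) (by omega)
        · have := hm l (Finset.mem_insert_self _ _)
          exact (hl.coprime_iff_not_dvd.1 this.symm) h3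
      · rw [mul_pow, pow_mul, hφm, one_pow, one_mul, ← pow_mul, show j * (m * l) = l * (j * m) by ring,
          pow_mul, hχl, one_pow]
      · intro l' hl'
        refine Nat.Coprime.mul_left (hm l' (Finset.mem_insert_of_mem hl')) ?_
        rw [Nat.coprime_primes hl (hP' l' hl').1]
        rintro rfl
        exact hlP hl'
    have h0 := ih' φ m hφ hφm fun l' hl' => hm l' (Finset.mem_insert_of_mem hl')
    set D := sieveDensity P * 2 ^ P.card * B with hD
    have hinv : ‖(1 - (l : ℂ)⁻¹)‖ = 1 - (l : ℝ)⁻¹ := by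
      rw [show (1 - (l : ℂ)⁻¹) = ((1 - (l : ℝ)⁻¹ : ℝ) : ℂ) by push_cast; rfl, Complex.norm_real,
        Real.norm_of_nonneg (by linarith [inv_lt_one_of_one_lt₀ hl1])]
    calc _ ≤ (1 - (l : ℝ)⁻¹) * D + (l : ℝ)⁻¹ * ((l - 1) * D) := by
          refine (norm_sub_le _ _).trans (add_le_add ?_ ?_)
          · rw [norm_mul, hinv]
            exact mul_le_mul_of_nonneg_left h0 (by linarith [inv_lt_one_of_one_lt₀ hl1])
          · rw [norm_mul, norm_inv, Complex.norm_natCast]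
            refine mul_le_mul_of_nonneg_left ?_ (by positivity)
            refine (norm_sum_le_of_le _ hterm).trans (le_of_eq ?_)
            rw [Finset.sum_const, Nat.card_Ico, nsmul_eq_mul, Nat.cast_sub hl.one_lt.le,
              Nat.cast_one]
      _ = _ := by
          rw [sieveDensity, Finset.prod_insert hlP, Finset.card_insert_of_notMem hlP, hD,
            sieveDensity]
          field_simp
          ring

theorem card_sieved_insert_ge (hA : ∀ x ∈ A, x ≠ 0) {B : ℝ}
    (hB : ∀ φ : MulChar F ℂ, φ ≠ 1 → ‖∑ x ∈ A, φ x‖ ≤ B) {P : Finset ℕ} {l : ℕ} (hlP : l ∉ P)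
    (hP : ∀ l' ∈ insert l P, l'.Prime ∧ orderOf (χ l') = l') :
    (1 - (l : ℝ)⁻¹) * ((sieved A χ P).card - sieveDensity P * 2 ^ P.card * B) ≤
      (sieved A χ (insert l P)).card := by
  classical
  obtain ⟨hl, hlχ⟩ := hP l (Finset.mem_insert_self _ _)
  have hP' : ∀ l ∈ P, l.Prime ∧ orderOf (χ l) = l := fun l hl =>
    hP l (Finset.mem_insert_of_mem hl)
  have hχl : χ l ^ l = 1 := by
    have := pow_orderOf_eq_one (χ l)
    rwa [hlχ] at this
  have hl1 : (1 : ℝ) < l := by exact_mod_cast hl.one_lt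
  have hone : ∀ S : Finset ℕ, ∑ x ∈ sieved A χ S, (1 : MulChar F ℂ) x = (sieved A χ S).card := by
    intro S
    rw [← nsmul_one, ← Finset.sum_const]
    refine Finset.sum_congr rfl fun x hx => ?_
    rw [MulChar.one_apply (isUnit_iff_ne_zero.2 (hA x (mem_sieved.1 hx).1))]
  have h := sum_sieved_insert hA hl.pos hχl P 1
  rw [hone, hone] at h
  set D := sieveDensity P * 2 ^ P.card * B with hD
  have hterm : ∀ j ∈ Finset.Ico 1 l, ‖∑ x ∈ sieved A χ P, (1 * χ l ^ j) x‖ ≤ D := by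
    intro j hj
    rw [Finset.mem_Ico] at hj
    rw [one_mul]
    refine norm_sum_sieved_le hA hB hP' _ l ?_ ?_ ?_
    · intro h
      have h2 := orderOf_dvd_of_pow_eq_one h
      rw [hlχ] at h2
      exact absurd (Nat.le_of_dvd (by omega) h2) (by omega)
    · rw [← pow_mul, mul_comm, pow_mul, hχl, one_pow]
    · intro l' hl'
      rw [Nat.coprime_primes hl (hP' l' hl').1]
      rintro rfl
      exact hlP hl'
  have hs : ‖∑ j ∈ Finset.Ico 1 l, ∑ x ∈ sieved A χ P, (1 * χ l ^ j) x‖ ≤ (l - 1) * D := by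
    refine (norm_sum_le_of_le _ hterm).trans (le_of_eq ?_)
    rw [Finset.sum_const, Nat.card_Ico, nsmul_eq_mul, Nat.cast_sub hl.one_lt.le, Nat.cast_one]
  have hre := congrArg Complex.re h
  rw [show (1 - (l : ℂ)⁻¹) = ((1 - (l : ℝ)⁻¹ : ℝ) : ℂ) by push_cast; rfl,
    show (l : ℂ)⁻¹ = (((l : ℝ)⁻¹ : ℝ) : ℂ) by push_cast; rfl, Complex.sub_re,
    Complex.re_ofReal_mul, Complex.re_ofReal_mul, Complex.natCast_re, Complex.natCast_re] at hre
  rw [hre, mul_sub]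
  have h5 := (Complex.re_le_norm _).trans hs
  have h6 : (l : ℝ)⁻¹ * (∑ j ∈ Finset.Ico 1 l, ∑ x ∈ sieved A χ P, (1 * χ l ^ j) x).re ≤
      (l : ℝ)⁻¹ * ((l - 1) * D) := mul_le_mul_of_nonneg_left h5 (by positivity)
  have h7 : (l : ℝ)⁻¹ * ((l - 1) * D) = (1 - (l : ℝ)⁻¹) * D := by field_simp
  linarith

theorem card_sieved_ge (hA : ∀ x ∈ A, x ≠ 0) {B : ℝ}
    (hB : ∀ φ : MulChar F ℂ, φ ≠ 1 → ‖∑ x ∈ A, φ x‖ ≤ B) {P : Finset ℕ}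
    (hP : ∀ l ∈ P, l.Prime ∧ orderOf (χ l) = l) :
    sieveDensity P * (A.card - (2 ^ P.card - 1) * B) ≤ (sieved A χ P).card := by
  classical
  induction P using Finset.induction_on with
  | empty => simp [sieved, sieveDensity]
  | insert l P hlP ih =>
    have h := card_sieved_insert_ge hA hB hlP hP
    have ih' := ih fun l hl => hP l (Finset.mem_insert_of_mem hl)
    have hl1 : (1 : ℝ) < l := by exact_mod_cast (hP l (Finset.mem_insert_self _ _)).1.one_lt
    refine le_trans ?_ h
    have : 0 ≤ 1 - (l : ℝ)⁻¹ := by linarith [inv_lt_one_of_one_lt₀ hl1]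
    refine le_trans (le_of_eq ?_) (mul_le_mul_of_nonneg_left (sub_le_sub_right ih' _) this)
    rw [sieveDensity, Finset.prod_insert hlP, Finset.card_insert_of_notMem hlP, sieveDensity,
      pow_succ]
    ring

/-- The sieve with a core `P` and a complementary set of primes `R`. -/
theorem card_sieved_union_ge (hA : ∀ x ∈ A, x ≠ 0) {B : ℝ} (hB0 : 0 ≤ B)
    (hB : ∀ φ : MulChar F ℂ, φ ≠ 1 → ‖∑ x ∈ A, φ x‖ ≤ B) {P R : Finset ℕ} (hPR : Disjoint P R)
    (hP : ∀ l ∈ P ∪ R, l.Prime ∧ orderOf (χ l) = l) (hδ : 0 ≤ 1 - ∑ l ∈ R, (l : ℝ)⁻¹) :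
    sieveDensity P * ((1 - ∑ l ∈ R, (l : ℝ)⁻¹) * (A.card - (2 ^ P.card - 1) * B) -
      R.card * 2 ^ P.card * B) ≤ (sieved A χ (P ∪ R)).card := by
  classical
  have hPP : ∀ l ∈ P, l.Prime ∧ orderOf (χ l) = l := fun l hl => hP l (Finset.mem_union_left _ hl)
  have hbase := card_sieved_ge hA hB hPP
  have hθ : 0 < sieveDensity P := sieveDensity_pos fun l hl => (hPP l hl).1
  set D := sieveDensity P * 2 ^ P.card * B with hD
  have hD0 : 0 ≤ D := by positivity
  have hcount : ((sieved A χ P).card : ℝ) - ∑ l ∈ R, ((l : ℝ)⁻¹ * (sieved A χ P).card + D) ≤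
      (sieved A χ (P ∪ R)).card := by
    have hcover : sieved A χ P ⊆ sieved A χ (P ∪ R) ∪
        R.biUnion fun l => sieved A χ P \ sieved A χ (insert l P) := by
      intro x hx
      by_cases h : ∃ l ∈ R, χ l x = 1
      · obtain ⟨l, hl, hlx⟩ := h
        refine Finset.mem_union_right _ (Finset.mem_biUnion.2 ⟨l, hl, Finset.mem_sdiff.2 ⟨hx, ?_⟩⟩)
        intro hx'
        exact (mem_sieved.1 hx').2 l (Finset.mem_insert_self _ _) hlx
      · push Not at h
        refine Finset.mem_union_left _ (mem_sieved.2 ⟨(mem_sieved.1 hx).1, fun l hl => ?_⟩)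
        rcases Finset.mem_union.1 hl with hl | hl
        · exact (mem_sieved.1 hx).2 l hl
        · exact h l hl
    have h1 : (sieved A χ P).card ≤ (sieved A χ (P ∪ R)).card +
        ∑ l ∈ R, (sieved A χ P \ sieved A χ (insert l P)).card :=
      (Finset.card_le_card hcover).trans ((Finset.card_union_le _ _).trans
        (add_le_add_right Finset.card_biUnion_le _))
    have h2 : ((sieved A χ P).card : ℝ) ≤ (sieved A χ (P ∪ R)).card +
        ∑ l ∈ R, ((sieved A χ P \ sieved A χ (insert l P)).card : ℝ) := by exact_mod_cast h1
    have h3 : ∑ l ∈ R, ((sieved A χ P \ sieved A χ (insert l P)).card : ℝ) ≤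
        ∑ l ∈ R, ((l : ℝ)⁻¹ * (sieved A χ P).card + D) := by
      refine Finset.sum_le_sum fun l hl => ?_
      have hlP : l ∉ P := fun h => Finset.disjoint_left.1 hPR h hl
      have h4 := card_sieved_insert_ge hA hB hlP (fun l' hl' => hP l' (by
        rcases Finset.mem_insert.1 hl' with rfl | h
        · exact Finset.mem_union_right _ hl
        · exact Finset.mem_union_left _ h))
      have hsub : sieved A χ (insert l P) ⊆ sieved A χ P := fun x hx =>
        mem_sieved.2 ⟨(mem_sieved.1 hx).1, fun l' hl' =>
          (mem_sieved.1 hx).2 l' (Finset.mem_insert_of_mem hl')⟩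
      rw [Finset.card_sdiff_of_subset hsub, Nat.cast_sub (Finset.card_le_card hsub)]
      have : 0 ≤ (l : ℝ)⁻¹ * D := by positivity
      linarith
    linarith
  rw [Finset.sum_add_distrib, Finset.sum_const, nsmul_eq_mul, ← Finset.sum_mul] at hcount
  refine le_trans (le_trans (le_of_eq ?_) (sub_le_sub_right
    (mul_le_mul_of_nonneg_left hbase hδ) (R.card * D))) (le_trans (le_of_eq ?_) hcount)
  · rw [hD]; ring
  · ring

end Sieve

section Action

variable {Fq F : Type*} [Field Fq] [Field F] [Fintype Fq] [Algebra Fq F]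

/-- The `F_q[x]`-module structure on `F` in which `x` acts as the Frobenius. -/
def frobAct (Fq F : Type*) [Field Fq] [Field F] [Fintype Fq] [Algebra Fq F] :
    Fq[X] →ₐ[Fq] Module.End Fq F :=
  aeval (FiniteField.frobeniusAlgHom Fq F).toLinearMap

theorem frobenius_pow_apply (i : ℕ) (β : F) :
    ((FiniteField.frobeniusAlgHom Fq F).toLinearMap ^ i) β = β ^ Fintype.card Fq ^ i := by
  induction i generalizing β with
  | zero => simp
  | succ i ih =>
    rw [pow_succ, Module.End.mul_apply, ih]
    simp only [AlgHom.toLinearMap_apply, FiniteField.frobeniusAlgHom_apply]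
    rw [← pow_mul, ← pow_succ']

theorem polyAct_eq_frobAct (h : Fq[X]) (β : F) :
    polyAct (Fintype.card Fq) h β = frobAct Fq F h β := by
  rw [polyAct, frobAct, aeval_eq_sum_range, Polynomial.sum_over_range _ (by simp),
    LinearMap.sum_apply]
  refine Finset.sum_congr rfl fun i _ => ?_
  rw [LinearMap.smul_apply, frobenius_pow_apply, Algebra.smul_def]

theorem frobAct_X_pow (i : ℕ) (β : F) : frobAct Fq F (X ^ i) β = β ^ Fintype.card Fq ^ i := by
  rw [frobAct, map_pow, aeval_X, frobenius_pow_apply]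

theorem frobAct_mul (g h : Fq[X]) (β : F) :
    frobAct Fq F (g * h) β = frobAct Fq F g (frobAct Fq F h β) := by
  rw [map_mul, Module.End.mul_apply]

theorem frobAct_eq_zero_of_dvd {g h : Fq[X]} (hgh : g ∣ h) {β : F} (hg : frobAct Fq F g β = 0) :
    frobAct Fq F h β = 0 := by
  obtain ⟨k, rfl⟩ := hgh
  rw [mul_comm, frobAct_mul, hg, map_zero]

theorem card_ker_frobAct_le [Fintype F] {g : Fq[X]} (hg : g ≠ 0) :
    Nat.card (LinearMap.ker (frobAct Fq F g)) ≤ Fintype.card Fq ^ g.natDegree := by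
  classical
  have hq : 1 < Fintype.card Fq := Fintype.one_lt_card
  let L : F[X] := ∑ i ∈ Finset.range (g.natDegree + 1),
    C (algebraMap Fq F (g.coeff i)) * X ^ Fintype.card Fq ^ i
  have hLc : L.coeff (Fintype.card Fq ^ g.natDegree) ≠ 0 := by
    simp only [L, finsetSum_coeff, coeff_C_mul_X_pow]
    rw [Finset.sum_eq_single g.natDegree]
    · simpa using hg
    · intro i _ hi
      rw [if_neg]
      intro h
      exact hi (Nat.pow_right_injective hq h).symm
    · simp
  have hL0 : L ≠ 0 := fun h => hLc (by rw [h, coeff_zero])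
  have hLd : L.natDegree ≤ Fintype.card Fq ^ g.natDegree := by
    apply natDegree_sum_le_of_forall_le
    intro i hi
    refine (natDegree_C_mul_X_pow_le _ _).trans (Nat.pow_le_pow_right hq.le ?_)
    simpa [Nat.lt_succ_iff] using hi
  rw [Nat.card_eq_fintype_card, Fintype.card_subtype]
  refine le_trans (Finset.card_le_card ?_)
    ((Multiset.toFinset_card_le _).trans (L.card_roots'.trans hLd))
  intro x hx
  rw [Multiset.mem_toFinset, mem_roots hL0, IsRoot.def]
  have hx' : frobAct Fq F g x = 0 := by simpa using hx
  rw [← polyAct_eq_frobAct, polyAct, Polynomial.sum_over_range _ (by simp)] at hx'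
  simpa [L, eval_finsetSum] using hx'

theorem natDegree_geom_sum (R : Type*) [CommRing R] [Nontrivial R] {n : ℕ} (hn : 0 < n) :
    (∑ i ∈ Finset.range n, X ^ i : R[X]).natDegree = n - 1 := by
  obtain ⟨m, rfl⟩ : ∃ m, n = m + 1 := ⟨n - 1, by omega⟩
  rw [Finset.sum_range_succ]
  rcases Nat.eq_zero_or_pos m with rfl | hm
  · simp
  rw [natDegree_add_eq_right_of_natDegree_lt, natDegree_X_pow, Nat.add_sub_cancel]
  rw [natDegree_X_pow]
  refine lt_of_le_of_lt (natDegree_sum_le_of_forall_le (n := m - 1) _ _ fun i hi => ?_) (by omega)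
  rw [natDegree_X_pow]
  have := Finset.mem_range.1 hi
  omega

/-- The trace of `α` vanishes and `α` is annihilated by no proper divisor of
`(x ^ n - 1) / (x - 1)`. -/
def IsTraceZeroNormal (Fq : Type*) {F : Type*} [Field Fq] [Field F] [Fintype Fq] [Algebra Fq F]
    (n : ℕ) (α : F) : Prop :=
  frobAct Fq F (∑ i ∈ Finset.range n, X ^ i) α = 0 ∧
    ∀ p g : Fq[X], Irreducible p → p * g = ∑ i ∈ Finset.range n, X ^ i → frobAct Fq F g α ≠ 0

theorem IsTraceZeroNormal.isKNormal {n : ℕ} (hn : 0 < n) {α : F} (h : IsTraceZeroNormal Fq n α) :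
    IsKNormal Fq (Fintype.card Fq) n 1 α := by
  classical
  set f : Fq[X] := ∑ i ∈ Finset.range n, X ^ i with hf
  have hfm : f.Monic := by
    exact monic_geom_sum_X hn.ne'
  have hfd : f ∣ X ^ n - 1 := ⟨X - 1, by rw [hf, geom_sum_mul]⟩
  refine ⟨f, ⟨hfm, hfd, by rw [polyAct_eq_frobAct]; exact h.1, ?_⟩, natDegree_geom_sum Fq hn⟩
  intro h' hm hd h0
  rw [polyAct_eq_frobAct] at h0
  suffices f ∣ h' from natDegree_le_of_dvd this hm.ne_zero
  have hgcd : frobAct Fq F (EuclideanDomain.gcd f h') α = 0 := by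
    rw [EuclideanDomain.gcd_eq_gcd_ab, map_add, LinearMap.add_apply,
      frobAct_eq_zero_of_dvd (dvd_mul_right _ _) h.1,
      frobAct_eq_zero_of_dvd (dvd_mul_right _ _) h0, add_zero]
  obtain ⟨k, hk⟩ := EuclideanDomain.gcd_dvd_left f h'
  have hk0 : k ≠ 0 := by
    rintro rfl
    exact hfm.ne_zero (by rw [hk, mul_zero])
  by_cases hu : IsUnit k
  · have : f ∣ EuclideanDomain.gcd f h' := by
      conv_lhs => rw [hk]
      exact (hu.mul_right_dvd).2 dvd_rfl
    exact this.trans (EuclideanDomain.gcd_dvd_right f h')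
  · obtain ⟨p, hp, l, hl⟩ := WfDvdMonoid.exists_irreducible_factor hu hk0
    refine absurd (frobAct_eq_zero_of_dvd (dvd_mul_right _ l) hgcd) (h.2 p _ hp ?_)
    rw [← hf]
    conv_rhs => rw [hk, hl]
    ring

theorem frobAct_geom_sum [Finite F] (α : F) :
    frobAct Fq F (∑ i ∈ Finset.range (Module.finrank Fq F), X ^ i) α =
      algebraMap Fq F (Algebra.trace Fq F α) := by
  rw [FiniteField.algebraMap_trace_eq_sum_pow, map_sum, LinearMap.sum_apply,
    Nat.card_eq_fintype_card]
  exact Finset.sum_congr rfl fun i _ => frobAct_X_pow i α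

theorem IsTraceZeroNormal.smul {n : ℕ} {α : F} (h : IsTraceZeroNormal Fq n α) {c : Fq}
    (hc : c ≠ 0) : IsTraceZeroNormal Fq n (c • α) := by
  refine ⟨by rw [map_smul, h.1, smul_zero], fun p g hp hpg => ?_⟩
  rw [map_smul]
  exact smul_ne_zero hc (h.2 p g hp hpg)

end Action

section Line

variable {Fq F : Type*} [Field Fq] [Field F] [Fintype Fq] [Fintype F] [Algebra Fq F]

theorem card_mul_card_trace_inv_le (W : Submodule Fq F) (E n : ℕ)
    (hn : Module.finrank Fq F = n)
    (hE : {z : F | ∃ j, 0 < j ∧ j < n ∧ z ^ Fintype.card Fq ^ j = z}.ncard ≤ E) (S : Finset F)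
    (hS : ∀ x ∈ S, x ∈ W ∧ x ≠ 0 ∧ Algebra.trace Fq F x⁻¹ = 0) :
    Fintype.card Fq * S.card ≤ Fintype.card Fq * E + (n - 1) * Nat.card W := by
  classical
  set q := Fintype.card Fq with hq
  have hn0 : 0 < n := hn ▸ Module.finrank_pos
  rcases S.eq_empty_or_nonempty with rfl | ⟨γ, hγS⟩
  · simp
  obtain ⟨hγW, hγ0, -⟩ := hS γ hγS
  have hfrob : ∀ (t : Fq) (j : ℕ), (algebraMap Fq F t) ^ q ^ j = algebraMap Fq F t := by
    intro t j
    rw [← map_pow, FiniteField.pow_card_pow]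
  have hadd : ∀ (x y : F) (j : ℕ), (x + y) ^ q ^ j = x ^ q ^ j + y ^ q ^ j := by
    intro x y j
    rw [← frobenius_pow_apply (Fq := Fq), map_add, frobenius_pow_apply, frobenius_pow_apply]
  let exc : F → Prop := fun z => ∃ j, 0 < j ∧ j < n ∧ z ^ q ^ j = z
  have hexc : ∀ (z : F) (t : Fq), exc (z + algebraMap Fq F t) ↔ exc z := by
    intro z t
    simp only [exc, hadd, hfrob, add_left_inj]
  let Wf : Finset F := Finset.univ.filter (· ∈ W)
  have hWf : Wf.card = Nat.card W := by
    rw [Nat.card_eq_fintype_card, Fintype.card_subtype]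
  let T : Finset F := Wf.filter fun x => ¬ exc (x / γ)
  let Z : F → Prop := fun x => x ≠ 0 ∧ Algebra.trace Fq F x⁻¹ = 0
  -- on each line in a nonexceptional direction the trace condition is a polynomial equation
  have hline : ∀ x ∈ T, (Finset.univ.filter fun t : Fq => Z (x + t • γ)).card ≤ n - 1 := by
    intro x hx
    have hxexc : ¬ exc (x / γ) := (Finset.mem_filter.1 hx).2
    let ℓ : ℕ → F[X] := fun j => C (x ^ q ^ j) + C (γ ^ q ^ j) * X
    let L : F[X] := ∑ i ∈ Finset.range n, ∏ j ∈ (Finset.range n).erase i, ℓ j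
    have hℓd : ∀ j, (ℓ j).natDegree ≤ 1 := fun j => by
      simp only [ℓ]
      compute_degree
    have hLd : L.natDegree ≤ n - 1 := by
      apply natDegree_sum_le_of_forall_le
      intro i hi
      refine (natDegree_prod_le _ _).trans ?_
      refine (Finset.sum_le_card_nsmul _ _ 1 fun j _ => hℓd j).trans ?_
      rw [Finset.card_erase_of_mem hi, Finset.card_range, smul_eq_mul, mul_one]
    have hL0 : L ≠ 0 := by
      intro h
      have h1 := congrArg (eval (-(x / γ))) h
      rw [eval_zero] at h1
      simp only [L, eval_finsetSum, eval_prod] at h1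
      rw [Finset.sum_eq_single 0] at h1
      · rw [Finset.prod_eq_zero_iff] at h1
        obtain ⟨j, hj, hj0⟩ := h1
        simp only [Finset.mem_erase, Finset.mem_range] at hj
        simp only [ℓ, eval_add, eval_mul, eval_C, eval_X] at hj0
        apply hxexc
        refine ⟨j, by omega, hj.2, ?_⟩
        have hγj : γ ^ q ^ j ≠ 0 := pow_ne_zero _ hγ0
        rw [div_pow, div_eq_iff hγj]
        linear_combination hj0
      · intro i hi hi0
        refine Finset.prod_eq_zero (i := 0) (by simp [hn0, Ne.symm hi0]) ?_
        simp only [ℓ, eval_add, eval_mul, eval_C, eval_X, pow_zero, pow_one]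
        field_simp
        ring
      · simp [hn0.ne']
    refine le_trans (Finset.card_le_card_of_injOn (fun t => algebraMap Fq F t)
      (t := L.roots.toFinset) ?_ (fun _ _ _ _ h => (algebraMap Fq F).injective h))
      ((Multiset.toFinset_card_le _).trans (L.card_roots'.trans hLd))
    intro t ht
    simp only [Finset.coe_filter, Finset.mem_univ, true_and, Set.mem_ofPred_eq] at ht
    obtain ⟨hy0, hytr⟩ := ht
    set y := x + t • γ with hy
    rw [Finset.mem_coe, Multiset.mem_toFinset, mem_roots hL0, IsRoot.def]
    have hℓy : ∀ j, (ℓ j).eval (algebraMap Fq F t) = y ^ q ^ j := by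
      intro j
      rw [hy, hadd, Algebra.smul_def, mul_pow, hfrob]
      simp only [ℓ, eval_add, eval_mul, eval_C, eval_X]
      ring
    simp only [L, eval_finsetSum, eval_prod, hℓy]
    have h2 := FiniteField.algebraMap_trace_eq_sum_pow Fq F y⁻¹
    rw [hytr, map_zero, hn, Nat.card_eq_fintype_card, ← hq] at h2
    have h3 : ∑ i ∈ Finset.range n, ∏ j ∈ (Finset.range n).erase i, y ^ q ^ j =
        (∏ j ∈ Finset.range n, y ^ q ^ j) * ∑ i ∈ Finset.range n, y⁻¹ ^ q ^ i := by
      rw [Finset.mul_sum]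
      refine Finset.sum_congr rfl fun i hi => ?_
      rw [← Finset.mul_prod_erase _ _ hi, inv_pow]
      have : y ^ q ^ i ≠ 0 := pow_ne_zero _ hy0
      field_simp
    rw [h3, ← h2, mul_zero]
  have htrans : ∀ t : Fq, (T.filter Z).card = (T.filter fun x => Z (x + t • γ)).card := by
    intro t
    refine (Finset.card_bij (fun x _ => x + t • γ) ?_ ?_ ?_).symm
    · intro x hx
      simp only [T, Wf, Finset.mem_filter, Finset.mem_univ, true_and] at hx ⊢
      refine ⟨⟨W.add_mem hx.1.1 (W.smul_mem t hγW), ?_⟩, hx.2⟩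
      rw [add_div, Algebra.smul_def, mul_div_assoc, div_self hγ0, mul_one, hexc]
      exact hx.1.2
    · intro x _ y _ h
      exact add_right_cancel h
    · intro y hy
      simp only [T, Wf, Finset.mem_filter, Finset.mem_univ, true_and] at hy ⊢
      refine ⟨y - t • γ, ⟨⟨W.sub_mem hy.1.1 (W.smul_mem t hγW), ?_⟩, ?_⟩, sub_add_cancel _ _⟩
      · rw [← hexc _ t, Algebra.smul_def, sub_div, mul_div_assoc, div_self hγ0, mul_one,
          sub_add_cancel]
        exact hy.1.2
      · rw [sub_add_cancel]; exact hy.2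
  have hT : q * (T.filter Z).card ≤ (n - 1) * Nat.card W := by
    calc q * (T.filter Z).card = ∑ t : Fq, (T.filter fun x => Z (x + t • γ)).card := by
          rw [← Finset.sum_congr rfl fun t _ => htrans t, Finset.sum_const, smul_eq_mul,
            Finset.card_univ]
      _ = ∑ x ∈ T, (Finset.univ.filter fun t : Fq => Z (x + t • γ)).card := by
          simp_rw [Finset.card_filter]
          rw [Finset.sum_comm]
      _ ≤ ∑ x ∈ T, (n - 1) := Finset.sum_le_sum hline
      _ = T.card * (n - 1) := by rw [Finset.sum_const, smul_eq_mul]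
      _ ≤ (n - 1) * Nat.card W := by
          rw [mul_comm, ← hWf]
          exact Nat.mul_le_mul_left _ (Finset.card_filter_le _ _)
  have hsplit : S.card ≤ E + (T.filter Z).card := by
    have hsub : S ⊆ ((Finset.univ.filter fun z : F => exc z).image (· * γ)) ∪ T.filter Z := by
      intro x hx
      obtain ⟨hxW, hx0, hxt⟩ := hS x hx
      by_cases h : exc (x / γ)
      · refine Finset.mem_union_left _ (Finset.mem_image.2 ⟨x / γ, by simpa using h, ?_⟩)
        exact div_mul_cancel₀ _ hγ0
      · refine Finset.mem_union_right _ ?_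
        simp only [T, Wf, Finset.mem_filter, Finset.mem_univ, true_and]
        exact ⟨⟨hxW, h⟩, hx0, hxt⟩
    refine (Finset.card_le_card hsub).trans ((Finset.card_union_le _ _).trans
      (add_le_add_left (Finset.card_image_le.trans ?_) _))
    rw [← Set.ncard_coe_finset, Finset.coe_filter]
    simpa only [Finset.mem_univ, true_and] using hE
  calc q * S.card ≤ q * (E + (T.filter Z).card) := Nat.mul_le_mul_left _ hsplit
    _ ≤ _ := by rw [mul_add]; exact add_le_add_right hT _

end Line

theorem ncard_pow_eq_self_le {F : Type*} [Field F] {m : ℕ} (hm : 1 < m) :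
    {z : F | z ^ m = z}.ncard ≤ m := by
  classical
  have h0 : (X ^ m - X : F[X]) ≠ 0 := FiniteField.X_pow_card_sub_X_ne_zero F hm
  have hd : (X ^ m - X : F[X]).natDegree = m := FiniteField.X_pow_card_sub_X_natDegree_eq F hm
  refine le_trans ?_ ((Multiset.toFinset_card_le _).trans
    ((X ^ m - X : F[X]).card_roots'.trans hd.le))
  rw [← Set.ncard_coe_finset]
  refine Set.ncard_le_ncard (fun z hz => ?_) (Finset.finite_toSet _)
  rw [Finset.mem_coe, Multiset.mem_toFinset, mem_roots h0]
  simpa [sub_eq_zero] using hz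

section Bad

variable {Fq F : Type*} [Field Fq] [Field F] [Fintype Fq] [Fintype F] [Algebra Fq F]

theorem pow_card_pow_gcd_eq_self {z : F} {j : ℕ} (hz : z ^ Fintype.card Fq ^ j = z) :
    z ^ Fintype.card Fq ^ j.gcd (Module.finrank Fq F) = z := by
  have h1 : Function.IsPeriodicPt (fun x : F => x ^ Fintype.card Fq) j z := by
    rw [Function.IsPeriodicPt, Function.IsFixedPt, pow_iterate]
    exact hz
  have h2 : Function.IsPeriodicPt (fun x : F => x ^ Fintype.card Fq) (Module.finrank Fq F) z := by
    rw [Function.IsPeriodicPt, Function.IsFixedPt, pow_iterate]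
    simp only [← Module.card_eq_pow_finrank (K := Fq) (V := F), FiniteField.pow_card]
  have h3 := h1.gcd h2
  rwa [Function.IsPeriodicPt, Function.IsFixedPt, pow_iterate] at h3

theorem ncard_proper_subfields_five (hn : Module.finrank Fq F = 5) :
    {z : F | ∃ j, 0 < j ∧ j < 5 ∧ z ^ Fintype.card Fq ^ j = z}.ncard ≤ Fintype.card Fq := by
  refine le_trans (Set.ncard_le_ncard ?_ (Set.toFinite _))
    (ncard_pow_eq_self_le (F := F) (Fintype.one_lt_card (α := Fq)))
  rintro z ⟨j, hj0, hj5, hj⟩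
  have h := pow_card_pow_gcd_eq_self hj
  have hg : j.gcd 5 = 1 := by interval_cases j <;> rfl
  rwa [hn, hg, pow_one] at h

theorem ncard_proper_subfields_six (hn : Module.finrank Fq F = 6) :
    {z : F | ∃ j, 0 < j ∧ j < 6 ∧ z ^ Fintype.card Fq ^ j = z}.ncard ≤
      Fintype.card Fq ^ 2 + Fintype.card Fq ^ 3 := by
  have hq : 1 < Fintype.card Fq := Fintype.one_lt_card
  refine le_trans (Set.ncard_le_ncard (t := {z : F | z ^ Fintype.card Fq ^ 2 = z} ∪
    {z : F | z ^ Fintype.card Fq ^ 3 = z}) ?_ (Set.toFinite _))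
    ((Set.ncard_union_le _ _).trans (add_le_add
      (ncard_pow_eq_self_le (F := F) (Nat.one_lt_pow two_ne_zero hq))
      (ncard_pow_eq_self_le (F := F) (Nat.one_lt_pow three_ne_zero hq))))
  rintro z ⟨j, hj0, hj6, hj⟩
  have h := pow_card_pow_gcd_eq_self hj
  rw [hn] at h
  have h1 : z ^ Fintype.card Fq ^ 1 = z → z ^ Fintype.card Fq ^ 2 = z := by
    intro h
    rw [pow_one] at h
    rw [pow_two, pow_mul, h, h]
  interval_cases j
  · exact Or.inl (h1 h)
  · exact Or.inl h
  · exact Or.inr h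
  · exact Or.inl h
  · exact Or.inl (h1 h)

open scoped Classical in
theorem card_mul_card_not_isTraceZeroNormal_le {n E : ℕ} (hn : Module.finrank Fq F = n)
    (hE : {z : F | ∃ j, 0 < j ∧ j < n ∧ z ^ Fintype.card Fq ^ j = z}.ncard ≤ E) :
    Fintype.card Fq * ((traceZeroPairs Fq F).filter fun x => ¬ IsTraceZeroNormal Fq n x).card ≤
      (n - 1) * (Fintype.card Fq * E + (n - 1) * Fintype.card Fq ^ (n - 2)) := by
  have hn0 : 0 < n := hn ▸ Module.finrank_pos
  set f : Fq[X] := ∑ i ∈ Finset.range n, X ^ i with hf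
  have hfm : f.Monic := monic_geom_sum_X hn0.ne'
  have hfd : f.natDegree = n - 1 := natDegree_geom_sum Fq hn0
  set K := AlgebraicClosure Fq
  set Z : Finset K := (f.map (algebraMap Fq K)).roots.toFinset with hZ
  have hZc : Z.card ≤ n - 1 := by
    refine (Multiset.toFinset_card_le _).trans ((card_roots' _).trans ?_)
    rw [natDegree_map, hfd]
  have hf0 : f.map (algebraMap Fq K) ≠ 0 := (hfm.map _).ne_zero
  have hdvd : ∀ ζ ∈ Z, minpoly Fq ζ ∣ f := by
    intro ζ hζ
    rw [hZ, Multiset.mem_toFinset, mem_roots hf0, IsRoot.def, eval_map_algebraMap] at hζ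
    exact minpoly.dvd _ _ hζ
  have hker : ∀ ζ ∈ Z, Fintype.card Fq *
      ((traceZeroPairs Fq F).filter fun x => frobAct Fq F (f / minpoly Fq ζ) x = 0).card ≤
      Fintype.card Fq * E + (n - 1) * Fintype.card Fq ^ (n - 2) := by
    intro ζ hζ
    have hmul : minpoly Fq ζ * (f / minpoly Fq ζ) = f :=
      EuclideanDomain.mul_div_cancel' (minpoly.ne_zero (Algebra.IsIntegral.isIntegral ζ)) (hdvd ζ hζ)
    have hg0 : f / minpoly Fq ζ ≠ 0 := by
      intro h
      rw [h, mul_zero] at hmul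
      exact hfm.ne_zero hmul.symm
    have hdeg : (f / minpoly Fq ζ).natDegree ≤ n - 2 := by
      have h1 := congrArg natDegree hmul
      rw [natDegree_mul (minpoly.ne_zero (Algebra.IsIntegral.isIntegral ζ)) hg0, hfd] at h1
      have := minpoly.natDegree_pos (A := Fq) (Algebra.IsIntegral.isIntegral ζ)
      omega
    refine (card_mul_card_trace_inv_le (LinearMap.ker (frobAct Fq F (f / minpoly Fq ζ))) E n hn hE _
      fun x hx => ?_).trans ?_
    · rw [Finset.mem_filter, mem_traceZeroPairs] at hx
      exact ⟨hx.2, hx.1.1, hx.1.2.2⟩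
    · gcongr
      exact (card_ker_frobAct_le hg0).trans (Nat.pow_le_pow_right Fintype.card_pos hdeg)
  have hsub : ((traceZeroPairs Fq F).filter fun x => ¬ IsTraceZeroNormal Fq n x) ⊆
      Z.biUnion fun ζ => (traceZeroPairs Fq F).filter
        fun x => frobAct Fq F (f / minpoly Fq ζ) x = 0 := by
    intro x hx
    rw [Finset.mem_filter] at hx
    obtain ⟨hxA, hxn⟩ := hx
    have htr : frobAct Fq F f x = 0 := by
      rw [hf, ← hn, frobAct_geom_sum, (mem_traceZeroPairs.1 hxA).2.1, map_zero]
    rw [IsTraceZeroNormal, not_and] at hxn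
    have := hxn htr
    push Not at this
    obtain ⟨p, g, hp, hpg, hg⟩ := this
    obtain ⟨ζ, hζ⟩ := IsAlgClosed.exists_aeval_eq_zero K p
      (degree_pos_of_irreducible hp).ne'
    have hmin := minpoly.eq_of_irreducible hp hζ
    have hlc : p.leadingCoeff ≠ 0 := leadingCoeff_ne_zero.2 hp.ne_zero
    have hζf : aeval ζ f = 0 := by rw [hf, ← hpg, map_mul, hζ, zero_mul]
    refine Finset.mem_biUnion.2 ⟨ζ, ?_, Finset.mem_filter.2 ⟨hxA, ?_⟩⟩
    · rw [hZ, Multiset.mem_toFinset, mem_roots hf0, IsRoot.def, eval_map_algebraMap]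
      exact hζf
    · have hdiv : f / minpoly Fq ζ = C p.leadingCoeff * g := by
        have h0 : minpoly Fq ζ ≠ 0 := minpoly.ne_zero (Algebra.IsIntegral.isIntegral ζ)
        have h1 : (C p.leadingCoeff⁻¹ * C p.leadingCoeff : Fq[X]) = 1 := by
          rw [← C_mul, inv_mul_cancel₀ hlc, C_1]
        have h2 : f = minpoly Fq ζ * (C p.leadingCoeff * g) := by
          rw [← hmin, hf, ← hpg]
          linear_combination (-p * g) * h1
        rw [h2, mul_div_cancel_left₀ _ h0]
      rw [hdiv]
      exact frobAct_eq_zero_of_dvd (dvd_mul_left _ _) hg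
  calc _ ≤ Fintype.card Fq * ∑ ζ ∈ Z, ((traceZeroPairs Fq F).filter
          fun x => frobAct Fq F (f / minpoly Fq ζ) x = 0).card :=
        Nat.mul_le_mul_left _ ((Finset.card_le_card hsub).trans Finset.card_biUnion_le)
    _ = ∑ ζ ∈ Z, Fintype.card Fq * ((traceZeroPairs Fq F).filter
          fun x => frobAct Fq F (f / minpoly Fq ζ) x = 0).card := Finset.mul_sum _ _ _
    _ ≤ ∑ _ζ ∈ Z, (Fintype.card Fq * E + (n - 1) * Fintype.card Fq ^ (n - 2)) :=
        Finset.sum_le_sum hker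
    _ ≤ _ := by
        rw [Finset.sum_const, smul_eq_mul]
        exact Nat.mul_le_mul_right _ hZc

open scoped Classical in
theorem card_mul_card_not_isTraceZeroNormal_pair_le {n E : ℕ} (hn : Module.finrank Fq F = n)
    (hE : {z : F | ∃ j, 0 < j ∧ j < n ∧ z ^ Fintype.card Fq ^ j = z}.ncard ≤ E) :
    Fintype.card Fq * ((traceZeroPairs Fq F).filter fun x =>
        ¬ (IsTraceZeroNormal Fq n x ∧ IsTraceZeroNormal Fq n x⁻¹)).card ≤
      2 * ((n - 1) * (Fintype.card Fq * E + (n - 1) * Fintype.card Fq ^ (n - 2))) := by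
  have h := card_mul_card_not_isTraceZeroNormal_le hn hE
  set S := (traceZeroPairs Fq F).filter fun x => ¬ IsTraceZeroNormal Fq n x with hS
  have hsub : ((traceZeroPairs Fq F).filter fun x =>
      ¬ (IsTraceZeroNormal Fq n x ∧ IsTraceZeroNormal Fq n x⁻¹)) ⊆ S ∪ S.image (·⁻¹) := by
    intro x hx
    rw [Finset.mem_filter, not_and_or] at hx
    rcases hx.2 with h | h
    · exact Finset.mem_union_left _ (Finset.mem_filter.2 ⟨hx.1, h⟩)
    · refine Finset.mem_union_right _ (Finset.mem_image.2 ⟨x⁻¹, Finset.mem_filter.2 ⟨?_, h⟩,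
        inv_inv x⟩)
      obtain ⟨h0, h1, h2⟩ := mem_traceZeroPairs.1 hx.1
      exact mem_traceZeroPairs.2 ⟨inv_ne_zero h0, h2, by rwa [inv_inv]⟩
  have hc := (Finset.card_le_card hsub).trans ((Finset.card_union_le _ _).trans
    (add_le_add_right Finset.card_image_le _))
  calc _ ≤ Fintype.card Fq * (S.card + S.card) := Nat.mul_le_mul_left _ hc
    _ = 2 * (Fintype.card Fq * S.card) := by ring
    _ ≤ _ := Nat.mul_le_mul_left _ h

end Bad

section Lift

variable {Fq F : Type*} [Field Fq] [Field F] [Fintype Fq] [Fintype F] [Algebra Fq F]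

theorem exists_orderOf_smul_eq {n : ℕ} (hn : Module.finrank Fq F = n) {χ : ℕ → MulChar F ℂ}
    (hχ : ∀ l ∈ (∑ i ∈ Finset.range n, Fintype.card Fq ^ i).primeFactors, orderOf (χ l) = l)
    {α : F} (hα : α ≠ 0)
    (h : ∀ l ∈ (∑ i ∈ Finset.range n, Fintype.card Fq ^ i).primeFactors, χ l α ≠ 1) :
    ∃ c : Fq, c ≠ 0 ∧ orderOf (c • α) = Fintype.card Fq ^ n - 1 := by
  have hn0 : 0 < n := hn ▸ Module.finrank_pos
  set q := Fintype.card Fq with hq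
  have hq1 : 1 < q := Fintype.one_lt_card
  set M := ∑ i ∈ Finset.range n, q ^ i with hM
  have hM0 : M ≠ 0 := by
    have : q ^ 0 ≤ M := Finset.single_le_sum (f := fun i => q ^ i) (fun _ _ => Nat.zero_le _)
      (Finset.mem_range.2 hn0)
    rw [pow_zero] at this
    omega
  have hQ : Fintype.card F = q ^ n := hn ▸ Module.card_eq_pow_finrank (K := Fq) (V := F)
  have hdvd : M ∣ q ^ n - 1 := by
    have := Nat.geomSum_eq hq1 n
    rw [← hM] at this
    rw [this]
    exact Nat.div_dvd_of_dvd (Nat.sub_one_dvd_pow_sub_one _ _)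
  have hQ1 : 1 < q ^ n := Nat.one_lt_pow hn0.ne' hq1
  obtain ⟨g, hg⟩ := IsCyclic.exists_ofOrder_eq_natCard (α := Fˣ)
  rw [Nat.card_units, Nat.card_eq_fintype_card, hQ] at hg
  have hgen : ∀ u : Fˣ, ∃ i : ℕ, g ^ i = u := by
    intro u
    have hz : u ∈ Subgroup.zpowers g := by
      have : Nat.card (Subgroup.zpowers g) = Nat.card Fˣ := by
        rw [Nat.card_zpowers, hg, Nat.card_units, Nat.card_eq_fintype_card, hQ]
      rw [(Subgroup.card_eq_iff_eq_top _).1 this]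
      trivial
    exact (mem_powers_iff_mem_zpowers.2 hz)
  obtain ⟨i, hi⟩ := hgen (Units.mk0 α hα)
  have hcop : i.Coprime M := by
    refine Nat.Coprime.symm (Nat.coprime_of_dvd fun l hl hlM hli => ?_)
    have hlM' : l ∈ M.primeFactors := Nat.mem_primeFactors.2 ⟨hl, hlM, hM0⟩
    refine h l hlM' ?_
    obtain ⟨k, rfl⟩ := hli
    have : α = ((g ^ (l * k) : Fˣ) : F) := by rw [hi, Units.val_mk0]
    have h1 : χ l ^ l = 1 := orderOf_dvd_iff_pow_eq_one.1 (hχ l hlM').dvd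
    rw [this, pow_mul, pow_right_comm, Units.val_pow_eq_pow_val, map_pow, ← MulChar.pow_apply_coe,
      h1, MulChar.one_apply_coe]
  have : NeZero (q ^ n - 1) := ⟨by omega⟩
  obtain ⟨u, hu⟩ := ZMod.unitsMap_surjective hdvd (ZMod.unitOfCoprime i hcop)
  set j := (u : ZMod (q ^ n - 1)).val with hj
  have hjc : j.Coprime (q ^ n - 1) := ZMod.val_coe_unit_coprime u
  have hij : (M : ℤ) ∣ j - i := by
    have h1 := congrArg (Units.val) hu
    rw [ZMod.unitsMap_val, ZMod.coe_unitOfCoprime] at h1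
    have h2 : ((j : ℤ) : ZMod M) = ((i : ℤ) : ZMod M) := by
      rw [Int.cast_natCast, Int.cast_natCast, ← h1, hj, ZMod.cast_eq_val]
    exact (ZMod.intCast_eq_intCast_iff_dvd_sub _ _ _).1 h2.symm
  obtain ⟨t, ht⟩ := hij
  have hnorm : algebraMap Fq F (Algebra.norm Fq (g : F)) = (g : F) ^ M := by
    rw [FiniteField.algebraMap_norm_eq_prod_pow, hn, Nat.card_eq_fintype_card, ← hq,
      Finset.prod_pow_eq_pow_sum]
  have hnorm0 : Algebra.norm Fq (g : F) ≠ 0 := by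
    intro h0
    rw [h0, map_zero] at hnorm
    exact pow_ne_zero _ g.ne_zero hnorm.symm
  refine ⟨Algebra.norm Fq (g : F) ^ t, zpow_ne_zero _ hnorm0, ?_⟩
  have hval : (Algebra.norm Fq (g : F) ^ t) • α = ((g ^ j : Fˣ) : F) := by
    have hα' : α = ((g ^ i : Fˣ) : F) := by rw [hi, Units.val_mk0]
    have hgj : (g ^ j : Fˣ) = (g ^ M) ^ t * g ^ i := by
      rw [← zpow_natCast g j, show (j : ℤ) = M * t + i by linarith, zpow_add, zpow_mul,
        zpow_natCast, zpow_natCast]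
    rw [Algebra.smul_def, map_zpow₀, hnorm, hgj, hα']
    push_cast
    rfl
  rw [hval, orderOf_units, Nat.Coprime.orderOf_pow (by rw [hg]; exact hjc.symm), hg]

end Lift

/-- The existence of `α` such that `α` and `α⁻¹` are primitive and `1`-normal. -/
def ExistsPrimitiveOneNormalPair (Fq F : Type*) [Field Fq] [Field F] [Fintype Fq] [Algebra Fq F]
    (n : ℕ) : Prop :=
  ∃ α : F, α ≠ 0 ∧ orderOf α = Fintype.card Fq ^ n - 1 ∧ orderOf α⁻¹ = Fintype.card Fq ^ n - 1 ∧
    IsKNormal Fq (Fintype.card Fq) n 1 α ∧ IsKNormal Fq (Fintype.card Fq) n 1 α⁻¹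

section Existence

variable {Fq F : Type*} [Field Fq] [Field F] [Fintype Fq] [Algebra Fq F]

theorem IsTraceZeroNormal.existsPair {n : ℕ} (hn : 0 < n) {α : F} (hα : α ≠ 0)
    (ho : orderOf α = Fintype.card Fq ^ n - 1) (h : IsTraceZeroNormal Fq n α)
    (h' : IsTraceZeroNormal Fq n α⁻¹) : ExistsPrimitiveOneNormalPair Fq F n := by
  refine ⟨α, hα, ho, ?_, h.isKNormal hn, h'.isKNormal hn⟩
  rw [← ho, ← Units.val_mk0 hα, ← Units.val_inv_eq_inv_val, orderOf_units, orderOf_units,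
    orderOf_inv]

variable [Fintype F]

theorem existsPair_of_sieve {n E : ℕ} (hn : Module.finrank Fq F = n) (hn2 : 2 ≤ n)
    (hE : {z : F | ∃ j, 0 < j ∧ j < n ∧ z ^ Fintype.card Fq ^ j = z}.ncard ≤ E)
    {P R : Finset ℕ} (hPR : Disjoint P R)
    (hU : P ∪ R = (∑ i ∈ Finset.range n, Fintype.card Fq ^ i).primeFactors)
    (hδ : 0 ≤ 1 - ∑ l ∈ R, (l : ℝ)⁻¹)
    (h : (2 * ((n - 1 : ℕ) * (Fintype.card Fq * E + (n - 1 : ℕ) * Fintype.card Fq ^ (n - 2))) : ℝ) <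
      Fintype.card Fq * (sieveDensity P * ((1 - ∑ l ∈ R, (l : ℝ)⁻¹) *
        (Fintype.card Fq ^ (n - 2) - 2 * 2 ^ P.card * √(Fintype.card Fq ^ n)) -
          2 * 2 ^ P.card * √(Fintype.card Fq ^ n) * R.card))) :
    ExistsPrimitiveOneNormalPair Fq F n := by
  classical
  set q := Fintype.card Fq with hq
  have hq0 : (0 : ℝ) < q := by exact_mod_cast Fintype.card_pos (α := Fq)
  have hq1 : 1 < q := Fintype.one_lt_card
  set M := ∑ i ∈ Finset.range n, q ^ i with hM
  have hQ : Fintype.card F = q ^ n := hn ▸ Module.card_eq_pow_finrank (K := Fq) (V := F)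
  have hdvd : M ∣ Fintype.card F - 1 := by
    have := Nat.geomSum_eq hq1 n
    rw [← hM] at this
    rw [this, hQ]
    exact Nat.div_dvd_of_dvd (Nat.sub_one_dvd_pow_sub_one _ _)
  have hχ : ∀ l : ℕ, ∃ χ : MulChar F ℂ, l ∈ M.primeFactors → orderOf χ = l := by
    intro l
    by_cases hl : l ∈ M.primeFactors
    · obtain ⟨χ, hχ⟩ := MulChar.exists_mulChar_orderOf F
        ((Nat.dvd_of_mem_primeFactors hl).trans hdvd)
        (Complex.isPrimitiveRoot_exp l (Nat.prime_of_mem_primeFactors hl).ne_zero)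
      exact ⟨χ, fun _ => hχ⟩
    · exact ⟨1, fun h => absurd h hl⟩
  choose χ hχ using hχ
  have hs := card_sieved_union_ge (A := traceZeroPairs Fq F) (χ := χ)
    (B := 2 * √(Fintype.card F)) (fun x hx => (mem_traceZeroPairs.1 hx).1) (by positivity)
    (fun φ hφ => norm_sum_traceZeroPairs_le hφ) hPR
    (fun l hl => by
      rw [hU] at hl
      exact ⟨Nat.prime_of_mem_primeFactors hl, hχ l hl⟩) hδ
  have hbad := card_mul_card_not_isTraceZeroNormal_pair_le hn hE
  set S := sieved (traceZeroPairs Fq F) χ (P ∪ R) with hS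
  set Bd := (traceZeroPairs Fq F).filter fun x =>
        ¬ (IsTraceZeroNormal Fq n x ∧ IsTraceZeroNormal Fq n x⁻¹) with hBd
  have hlt : Bd.card < S.card := by
    have hA := card_traceZeroPairs_ge (Fq := Fq) (F := F)
    have hQ' : (Fintype.card F : ℝ) = (q : ℝ) ^ n := by rw [hQ]; push_cast; rfl
    rw [hQ'] at hA hs
    have hdiv : (q : ℝ) ^ n / (q : ℝ) ^ 2 = (q : ℝ) ^ (n - 2) := by
      rw [pow_sub₀ _ hq0.ne' hn2, div_eq_mul_inv]
    rw [← hq, hdiv] at hA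
    have hθ : 0 < sieveDensity P := sieveDensity_pos fun l hl =>
      Nat.prime_of_mem_primeFactors (hU ▸ Finset.mem_union_left _ hl)
    have hbad' : (q * Bd.card : ℝ) ≤
        2 * ((n - 1 : ℕ) * (q * E + (n - 1 : ℕ) * q ^ (n - 2))) := by exact_mod_cast hbad
    have hle : (sieveDensity P * ((1 - ∑ l ∈ R, (l : ℝ)⁻¹) *
        ((q : ℝ) ^ (n - 2) - 2 * 2 ^ P.card * √((q : ℝ) ^ n)) -
          2 * 2 ^ P.card * √((q : ℝ) ^ n) * R.card)) ≤ S.card := by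
      refine le_trans (mul_le_mul_of_nonneg_left ?_ hθ.le) hs
      have := mul_le_mul_of_nonneg_left hA hδ
      nlinarith
    have h2 : (q * Bd.card : ℝ) < q * S.card :=
      hbad'.trans_lt (h.trans_le (mul_le_mul_of_nonneg_left hle hq0.le))
    exact_mod_cast lt_of_mul_lt_mul_left h2 hq0.le
  obtain ⟨α, hαS, hαB⟩ := Finset.exists_mem_notMem_of_card_lt_card hlt
  obtain ⟨hαA, hαχ⟩ := mem_sieved.1 hαS
  have hα0 := (mem_traceZeroPairs.1 hαA).1
  have hαN : IsTraceZeroNormal Fq n α ∧ IsTraceZeroNormal Fq n α⁻¹ := by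
    by_contra hc
    exact hαB (Finset.mem_filter.2 ⟨hαA, hc⟩)
  rw [hU] at hαχ
  obtain ⟨c, hc0, hc⟩ := exists_orderOf_smul_eq hn hχ hα0 hαχ
  refine (hαN.1.smul hc0).existsPair (by omega) (smul_ne_zero hc0 hα0) hc ?_
  have : (c • α)⁻¹ = c⁻¹ • α⁻¹ := by
    rw [Algebra.smul_def, Algebra.smul_def, mul_inv, map_inv₀]
  rw [this]
  exact hαN.2.smul (inv_ne_zero hc0)

theorem existsPair_five_of_sieve (hn : Module.finrank Fq F = 5) {P R : Finset ℕ}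
    (hPR : Disjoint P R)
    (hU : P ∪ R = (∑ i ∈ Finset.range 5, Fintype.card Fq ^ i).primeFactors)
    (hδ : 0 ≤ 1 - ∑ l ∈ R, (l : ℝ)⁻¹)
    (h : (32 + 8 / Fintype.card Fq : ℝ) <
      sieveDensity P * ((1 - ∑ l ∈ R, (l : ℝ)⁻¹) *
        (Fintype.card Fq - 2 * 2 ^ P.card * √(Fintype.card Fq)) -
          2 * 2 ^ P.card * √(Fintype.card Fq) * R.card)) :
    ExistsPrimitiveOneNormalPair Fq F 5 := by
  have hq0 : (0 : ℝ) < Fintype.card Fq := by exact_mod_cast Fintype.card_pos (α := Fq)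
  refine existsPair_of_sieve hn (by norm_num) (ncard_proper_subfields_five hn) hPR hU hδ ?_
  generalize (Fintype.card Fq : ℝ) = q at *
  have hs : √(q ^ 5) = q ^ 2 * √q := by
    rw [show q ^ 5 = (q ^ 2) ^ 2 * q by ring, Real.sqrt_mul (by positivity),
      Real.sqrt_sq (by positivity)]
  rw [hs]
  have h2 := mul_lt_mul_of_pos_right h (pow_pos hq0 3)
  have h3 : (32 + 8 / q) * q ^ 3 = 32 * q ^ 3 + 8 * q ^ 2 := by field_simp
  rw [h3] at h2
  norm_num
  linarith

theorem existsPair_six_of_sieve (hn : Module.finrank Fq F = 6) {P R : Finset ℕ}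
    (hPR : Disjoint P R)
    (hU : P ∪ R = (∑ i ∈ Finset.range 6, Fintype.card Fq ^ i).primeFactors)
    (hδ : 0 ≤ 1 - ∑ l ∈ R, (l : ℝ)⁻¹)
    (h : (60 + 10 / Fintype.card Fq : ℝ) <
      sieveDensity P * ((1 - ∑ l ∈ R, (l : ℝ)⁻¹) *
        (Fintype.card Fq - 2 * 2 ^ P.card * 1) - 2 * 2 ^ P.card * 1 * R.card)) :
    ExistsPrimitiveOneNormalPair Fq F 6 := by
  have hq0 : (0 : ℝ) < Fintype.card Fq := by exact_mod_cast Fintype.card_pos (α := Fq)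
  refine existsPair_of_sieve hn (by norm_num) (ncard_proper_subfields_six hn) hPR hU hδ ?_
  push_cast
  generalize (Fintype.card Fq : ℝ) = q at *
  have hs : √(q ^ 6) = q ^ 3 := by
    rw [show q ^ 6 = (q ^ 3) ^ 2 by ring, Real.sqrt_sq (by positivity)]
  rw [hs]
  have h2 := mul_lt_mul_of_pos_right h (pow_pos hq0 4)
  have h3 : (60 + 10 / q) * q ^ 4 = 60 * q ^ 4 + 10 * q ^ 3 := by field_simp
  rw [h3] at h2
  linarith

end Existence

section Candidates

theorem sieveDensity_anti {P C : Finset ℕ} (hPC : P ⊆ C) (hC : ∀ l ∈ C, l.Prime) :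
    sieveDensity C ≤ sieveDensity P := by
  classical
  rw [sieveDensity, sieveDensity, ← Finset.prod_sdiff hPC]
  have hpos := sieveDensity_pos fun l hl => hC l (hPC hl)
  rw [sieveDensity] at hpos
  refine mul_le_of_le_one_left hpos.le (Finset.prod_le_one (fun l hl => ?_) fun l hl => ?_)
  · have : (1 : ℝ) < l := by exact_mod_cast (hC l (Finset.mem_sdiff.1 hl).1).one_lt
    linarith [inv_lt_one_of_one_lt₀ this]
  · have : (0 : ℝ) ≤ (l : ℝ)⁻¹ := by positivity
    linarith

/-- A sieve inequality for candidate sets of prime divisors gives one for the actual prime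
divisors of `M`. -/
theorem exists_partition_of_candidates {M : ℕ} {C D : Finset ℕ} {L K : ℕ}
    (hC : ∀ l ∈ C, l.Prime) (hL : 0 < L)
    (hcov : ∀ l ∈ M.primeFactors, l ∈ C ∨ l ∈ D ∨ L ≤ l)
    (hK : (M.primeFactors.filter fun l => l ∉ C ∧ l ∉ D).card ≤ K) {q r T : ℝ} (hr : 0 ≤ r)
    (hT : 0 ≤ T) (hδ : 0 < 1 - ∑ l ∈ D, (l : ℝ)⁻¹ - K / L)
    (h : T < sieveDensity C * ((1 - ∑ l ∈ D, (l : ℝ)⁻¹ - K / L) *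
      (q - 2 * 2 ^ C.card * r) - 2 * 2 ^ C.card * r * (D.card + K))) :
    ∃ P R : Finset ℕ, Disjoint P R ∧ P ∪ R = M.primeFactors ∧ 0 ≤ 1 - ∑ l ∈ R, (l : ℝ)⁻¹ ∧
      T < sieveDensity P * ((1 - ∑ l ∈ R, (l : ℝ)⁻¹) *
        (q - 2 * 2 ^ P.card * r) - 2 * 2 ^ P.card * r * R.card) := by
  classical
  set P := M.primeFactors.filter (· ∈ C) with hP
  set R := M.primeFactors.filter (· ∉ C) with hR
  set B := M.primeFactors.filter fun l => l ∉ C ∧ l ∉ D with hB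
  have hPC : P ⊆ C := fun l hl => (Finset.mem_filter.1 hl).2
  have hRsub : R ⊆ D ∪ B := by
    intro l hl
    obtain ⟨hlM, hlC⟩ := Finset.mem_filter.1 hl
    by_cases hlD : l ∈ D
    · exact Finset.mem_union_left _ hlD
    · exact Finset.mem_union_right _ (Finset.mem_filter.2 ⟨hlM, hlC, hlD⟩)
  have hDB : Disjoint D B := Finset.disjoint_left.2 fun l hl hl' => (Finset.mem_filter.1 hl').2.2 hl
  have hL' : (0 : ℝ) < L := by exact_mod_cast hL
  have hsumB : ∑ l ∈ B, (l : ℝ)⁻¹ ≤ K / L := by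
    calc ∑ l ∈ B, (l : ℝ)⁻¹ ≤ ∑ _l ∈ B, (L : ℝ)⁻¹ := by
          refine Finset.sum_le_sum fun l hl => ?_
          obtain ⟨hlM, hlC, hlD⟩ := Finset.mem_filter.1 hl
          have : L ≤ l := by
            rcases hcov l hlM with h | h | h
            · exact absurd h hlC
            · exact absurd h hlD
            · exact h
          gcongr
      _ = B.card / L := by rw [Finset.sum_const, nsmul_eq_mul, div_eq_mul_inv]
      _ ≤ K / L := by gcongr
  have hsum : ∑ l ∈ R, (l : ℝ)⁻¹ ≤ ∑ l ∈ D, (l : ℝ)⁻¹ + K / L := by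
    calc _ ≤ ∑ l ∈ D ∪ B, (l : ℝ)⁻¹ :=
          Finset.sum_le_sum_of_subset_of_nonneg hRsub fun _ _ _ => by positivity
      _ = ∑ l ∈ D, (l : ℝ)⁻¹ + ∑ l ∈ B, (l : ℝ)⁻¹ := Finset.sum_union hDB
      _ ≤ _ := by gcongr
  have hRc : (R.card : ℝ) ≤ D.card + K := by
    have := (Finset.card_le_card hRsub).trans (Finset.card_union_le _ _)
    exact_mod_cast this.trans (Nat.add_le_add_left hK _)
  have hθ : 0 < sieveDensity C := sieveDensity_pos hC
  have hθle := sieveDensity_anti hPC hC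
  have hW : (2 : ℝ) ^ P.card ≤ 2 ^ C.card :=
    pow_le_pow_right₀ one_le_two (Finset.card_le_card hPC)
  refine ⟨P, R, Finset.disjoint_filter_filter_not _ _ _, Finset.filter_union_filter_not_eq _ _,
    by linarith, ?_⟩
  have hδle : 1 - ∑ l ∈ D, (l : ℝ)⁻¹ - K / L ≤ 1 - ∑ l ∈ R, (l : ℝ)⁻¹ := by linarith
  generalize 1 - ∑ l ∈ D, (l : ℝ)⁻¹ - K / L = δ₀ at *
  generalize 1 - ∑ l ∈ R, (l : ℝ)⁻¹ = δ at *
  set w₀ := 2 * (2 : ℝ) ^ C.card * r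
  set w := 2 * (2 : ℝ) ^ P.card * r
  have hw : w ≤ w₀ := by simp only [w, w₀]; gcongr
  have hw0 : 0 ≤ w := by positivity
  have hinner : 0 < δ₀ * (q - w₀) - w₀ * (D.card + K) := by
    by_contra hc
    have := mul_nonpos_of_nonneg_of_nonpos hθ.le (not_lt.1 hc)
    linarith
  have hk0 : (0 : ℝ) ≤ D.card + K := by positivity
  have hqw : 0 < q - w₀ := by
    by_contra hc
    have := mul_nonpos_of_nonneg_of_nonpos hδ.le (not_lt.1 hc)
    have := mul_nonneg (hw0.trans hw) hk0
    linarith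
  have hmono : δ₀ * (q - w₀) - w₀ * (D.card + K) ≤ δ * (q - w) - w * R.card := by
    have h1 : δ₀ * (q - w₀) ≤ δ * (q - w) := by
      apply mul_le_mul hδle (by linarith) hqw.le (hδ.le.trans hδle)
    have h2 : w * R.card ≤ w₀ * (D.card + K) := by gcongr
    linarith
  exact h.trans_le (mul_le_mul hθle hmono hinner.le (hθ.le.trans hθle))

theorem pow_card_le_of_forall_le {M L : ℕ} (hM : M ≠ 0) {B : Finset ℕ}
    (hB : B ⊆ M.primeFactors) (hL : ∀ l ∈ B, L ≤ l) {N : ℕ} (hN : N ∣ M)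
    (hcop : ∀ l ∈ B, l.Coprime N) : L ^ B.card * N ≤ M := by
  have h1 : (∏ l ∈ B, l) ∣ M :=
    (Finset.prod_dvd_prod_of_subset _ _ _ hB).trans (Nat.prod_primeFactors_dvd M)
  have h2 : (∏ l ∈ B, l) * N ∣ M :=
    (Nat.Coprime.prod_left hcop).mul_dvd_of_dvd_of_dvd h1 hN
  calc L ^ B.card * N ≤ (∏ l ∈ B, l) * N :=
        Nat.mul_le_mul_right _ (Finset.pow_card_le_prod _ _ _ hL)
    _ ≤ M := Nat.le_of_dvd (Nat.pos_of_ne_zero hM) h2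

end Candidates

section SieveTest

/-- The numerator of `∑ l ∈ D, 1 / l` over the denominator `∏ l ∈ D, l`. -/
def invSumNum : List ℕ → ℕ
  | [] => 0
  | l :: D => invSumNum D * l + D.prod

theorem invSumNum_div_prod {D : List ℕ} (hD : ∀ l ∈ D, 0 < l) :
    (invSumNum D : ℝ) / D.prod = (D.map fun l : ℕ => (l : ℝ)⁻¹).sum := by
  induction D with
  | nil => simp [invSumNum]
  | cons l D ih =>
    rw [List.forall_mem_cons] at hD
    have h1 : (0 : ℝ) < l := by exact_mod_cast hD.1
    have h2 : (0 : ℝ) < D.prod := by exact_mod_cast List.prod_pos hD.2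
    rw [List.map_cons, List.sum_cons, ← ih hD.2, invSumNum, List.prod_cons, Nat.cast_add,
      Nat.cast_mul, Nat.cast_mul]
    field_simp
    ring

theorem prod_pred_div_prod {C : List ℕ} (hC : ∀ l ∈ C, 0 < l) :
    (((C.map Nat.pred).prod : ℕ) : ℝ) / C.prod = (C.map fun l : ℕ => 1 - (l : ℝ)⁻¹).prod := by
  induction C with
  | nil => simp
  | cons l C ih =>
    rw [List.forall_mem_cons] at hC
    have h1 : (0 : ℝ) < l := by exact_mod_cast hC.1
    have h2 : (0 : ℝ) < C.prod := by exact_mod_cast List.prod_pos hC.2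
    rw [List.map_cons, List.map_cons, List.prod_cons, List.prod_cons, List.prod_cons, ← ih hC.2,
      Nat.pred_eq_sub_one, Nat.cast_mul, Nat.cast_mul, Nat.cast_sub (show 1 ≤ l from hC.1)]
    push_cast
    field_simp

/-- The sieve inequality with threshold `a + b / q`, sieving primes `D` and at most `K` further
primes that are at least `L`, core primes `C`, and `s / ρ` as the bound for `√(q ^ n) / q ^ 3` or
`√(q ^ n) / q ^ 2`. -/
def sieveTest (a b s ρ q : ℕ) (C D : List ℕ) (L K : ℕ) : Bool :=
  (fun d c φ w => (fun dn => decide (0 < dn) && decide ((a * q + b) * (c * (d * L) * ρ) +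
      q * φ * w * s * (dn + (D.length + K) * (d * L)) < q * φ * dn * q * ρ))
    (d * L - (invSumNum D * L + K * d))) D.prod C.prod (C.map Nat.pred).prod (2 * 2 ^ C.length)

theorem sieveTest_sound {a b s ρ q : ℕ} {C D : List ℕ} {L K : ℕ} (hC : ∀ l ∈ C, l.Prime)
    (hCn : C.Nodup) (hD : ∀ l ∈ D, 0 < l) (hDn : D.Nodup) (hL : 0 < L) (hρ : 0 < ρ) (hq : 0 < q)
    (h : sieveTest a b s ρ q C D L K = true) :
    0 < 1 - ∑ l ∈ D.toFinset, (l : ℝ)⁻¹ - K / L ∧ ∀ r : ℝ, r ≤ s / ρ →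
      (a + b / q : ℝ) < sieveDensity C.toFinset * ((1 - ∑ l ∈ D.toFinset, (l : ℝ)⁻¹ - K / L) *
        (q - 2 * 2 ^ C.toFinset.card * r) -
          2 * 2 ^ C.toFinset.card * r * (D.toFinset.card + K)) := by
  simp only [sieveTest, Bool.and_eq_true, decide_eq_true_eq] at h
  obtain ⟨hdn, h⟩ := h
  have hθ := sieveDensity_pos (P := C.toFinset) fun l hl => hC l (List.mem_toFinset.1 hl)
  have hφ : sieveDensity C.toFinset = (((C.map Nat.pred).prod : ℕ) : ℝ) / C.prod := by
    rw [sieveDensity, List.prod_toFinset _ hCn, prod_pred_div_prod fun l hl => (hC l hl).pos]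
  have hs : ∑ l ∈ D.toFinset, (l : ℝ)⁻¹ = (invSumNum D : ℝ) / D.prod := by
    rw [List.sum_toFinset _ hDn, invSumNum_div_prod hD]
  rw [List.toFinset_card_of_nodup hCn, List.toFinset_card_of_nodup hDn]
  have hc0 : (0 : ℝ) < C.prod := by exact_mod_cast List.prod_pos fun l hl => (hC l hl).pos
  have hd0 : (0 : ℝ) < D.prod := by exact_mod_cast List.prod_pos hD
  have hL0 : (0 : ℝ) < L := by exact_mod_cast hL
  have hρ0 : (0 : ℝ) < ρ := by exact_mod_cast hρ
  have hq0 : (0 : ℝ) < q := by exact_mod_cast hq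
  set dn := D.prod * L - (invSumNum D * L + K * D.prod) with hdn'
  have hdnr : (dn : ℝ) = D.prod * L - (invSumNum D * L + K * D.prod) := by
    rw [hdn', Nat.cast_sub (by omega)]
    push_cast
    rfl
  have hdn0 : (0 : ℝ) < dn := by exact_mod_cast hdn
  have hδ : 1 - ∑ l ∈ D.toFinset, (l : ℝ)⁻¹ - K / L = dn / (D.prod * L) := by
    rw [hs, hdnr]
    field_simp
    ring
  have hδ0 : 0 < 1 - ∑ l ∈ D.toFinset, (l : ℝ)⁻¹ - K / L := by rw [hδ]; positivity
  refine ⟨hδ0, fun r hr => ?_⟩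
  have hk : (0 : ℝ) ≤ D.length + K := by positivity
  have hw : (0 : ℝ) < 2 * 2 ^ C.length := by positivity
  generalize hδg : 1 - ∑ l ∈ D.toFinset, (l : ℝ)⁻¹ - K / L = δ at *
  have hmono : δ * (q - 2 * 2 ^ C.length * (s / ρ : ℝ)) -
        2 * 2 ^ C.length * (s / ρ : ℝ) * (D.length + K) ≤
      δ * (q - 2 * 2 ^ C.length * r) - 2 * 2 ^ C.length * r * (D.length + K) := by gcongr
  refine lt_of_lt_of_le ?_ (mul_le_mul_of_nonneg_left hmono hθ.le)
  have h' : ((a * q + b) * (C.prod * (D.prod * L) * ρ) +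
      q * ((C.map Nat.pred).prod : ℕ) * (2 * 2 ^ C.length) * s *
        (dn + (D.length + K) * (D.prod * L)) : ℝ) < q * ((C.map Nat.pred).prod : ℕ) * dn * q * ρ := by
    exact_mod_cast h
  rw [hφ, hδ]
  generalize (C.map Nat.pred).prod = φ at *
  rw [← sub_pos] at h' ⊢
  have := div_pos h' (show (0 : ℝ) < q * (C.prod * (D.prod * L) * ρ) by positivity)
  convert this using 1
  field_simp
  ring

end SieveTest

section Ranges

theorem sieve_mono_linear {θ δ w k q₀ q a b : ℝ} (hθ : 0 < θ) (hδ : 0 < δ) (hq₀ : 0 < q₀)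
    (hq : q₀ ≤ q) (hb : 0 ≤ b)
    (h : a + b / q₀ < θ * (δ * (q₀ - w * 1) - w * 1 * k)) :
    a + b / q < θ * (δ * (q - w * 1) - w * 1 * k) := by
  have h1 : b / q ≤ b / q₀ := by gcongr
  have h2 : θ * (δ * (q₀ - w * 1) - w * 1 * k) ≤ θ * (δ * (q - w * 1) - w * 1 * k) := by gcongr
  linarith

theorem sieve_mono_sqrt {θ δ w k q₀ q a b : ℝ} (hθ : 0 < θ) (hδ : 0 < δ) (hq₀ : 0 < q₀)
    (hq : q₀ ≤ q) (ha : 0 ≤ a) (hb : 0 ≤ b)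
    (h : a + b / q₀ < θ * (δ * (q₀ - w * √q₀) - w * √q₀ * k)) :
    a + b / q < θ * (δ * (q - w * √q) - w * √q * k) := by
  have h1 : b / q ≤ b / q₀ := by gcongr
  have hs : √q₀ ≤ √q := Real.sqrt_le_sqrt hq
  have hs0 : 0 < √q₀ := Real.sqrt_pos.2 hq₀
  have e : ∀ x : ℝ, 0 ≤ x → θ * (δ * (x - w * √x) - w * √x * k) =
      √x * (θ * (δ * (√x - w) - w * k)) := by
    intro x hx
    have := Real.mul_self_sqrt hx
    linear_combination (-θ * δ) * this
  rw [e _ hq₀.le] at h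
  rw [e _ (hq₀.le.trans hq)]
  have hpos : 0 < θ * (δ * (√q₀ - w) - w * k) := by
    have : 0 < √q₀ * (θ * (δ * (√q₀ - w) - w * k)) :=
      lt_of_le_of_lt (by positivity) h
    exact pos_of_mul_pos_right this hs0.le
  have h2 : θ * (δ * (√q₀ - w) - w * k) ≤ θ * (δ * (√q - w) - w * k) := by gcongr
  have h3 := mul_le_mul hs h2 hpos.le (hs0.le.trans hs)
  linarith

end Ranges

section SmallPrimes

/-- The primes below `L`, for `L ≤ 37 ^ 2`. -/
def smallPrimes (L : ℕ) : List ℕ :=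
  (List.range L).filter fun l => decide (2 ≤ l) &&
    [2, 3, 5, 7, 11, 13, 17, 19, 23, 29, 31].all fun d => l % d != 0 || l == d

theorem mem_smallPrimes_of_prime {l L : ℕ} (hl : l.Prime) (hL : l < L) : l ∈ smallPrimes L := by
  rw [smallPrimes, List.mem_filter, Bool.and_eq_true, decide_eq_true_eq, List.all_eq_true]
  refine ⟨List.mem_range.2 hL, hl.two_le, fun d hd => ?_⟩
  have hd1 : d ≠ 1 := by
    rintro rfl
    simp at hd
  rw [Bool.or_eq_true, bne_iff_ne, beq_iff_eq, or_iff_not_imp_left, not_not]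
  intro h
  exact (((Nat.dvd_prime hl).1 (Nat.dvd_of_mod_eq_zero h)).resolve_left hd1).symm

theorem prime_of_mem_smallPrimes {l L : ℕ} (hL : L ≤ 1369) (h : l ∈ smallPrimes L) : l.Prime := by
  rw [smallPrimes, List.mem_filter, Bool.and_eq_true, decide_eq_true_eq, List.all_eq_true] at h
  obtain ⟨hl, h2, h⟩ := h
  rw [List.mem_range] at hl
  by_contra hnp
  have hm := Nat.minFac_sq_le_self (by omega) hnp
  have hmp := Nat.minFac_prime (n := l) (by omega)
  have hm37 : l.minFac < 37 := by nlinarith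
  have hmem : l.minFac ∈ [2, 3, 5, 7, 11, 13, 17, 19, 23, 29, 31] := by
    generalize l.minFac = m at hmp hm37
    interval_cases m <;> first | decide | exact absurd hmp (by norm_num)
  have h3 := h _ hmem
  rw [Bool.or_eq_true, bne_iff_ne, beq_iff_eq] at h3
  rcases h3 with h3 | h3
  · exact h3 (Nat.mod_eq_zero_of_dvd l.minFac_dvd)
  · exact hnp (h3 ▸ hmp)

theorem smallPrimes_nodup (L : ℕ) : (smallPrimes L).Nodup := List.nodup_range.filter _

theorem eq_five_or_mod_ten_of_dvd {q l : ℕ} (hl : l.Prime)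
    (h : l ∣ ∑ i ∈ Finset.range 5, q ^ i) : l = 5 ∨ l % 10 = 1 := by
  have : Fact l.Prime := ⟨hl⟩
  have h0 : ∑ i ∈ Finset.range 5, (q : ZMod l) ^ i = 0 := by
    have := (ZMod.natCast_eq_zero_iff _ _).2 h
    push_cast at this
    exact this
  have h5 : (q : ZMod l) ^ 5 = 1 := by
    have := geom_sum_mul (q : ZMod l) 5
    rw [h0, zero_mul] at this
    exact (sub_eq_zero.1 this.symm)
  by_cases h1 : (q : ZMod l) = 1
  · left
    rw [h1] at h0
    have h6 : ((5 : ℕ) : ZMod l) = 0 := by simpa using h0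
    exact (Nat.prime_dvd_prime_iff_eq hl Nat.prime_five).1 ((ZMod.natCast_eq_zero_iff _ _).1 h6)
  · right
    have : Fact (Nat.Prime 5) := ⟨Nat.prime_five⟩
    have ho : orderOf (q : ZMod l) = 5 := orderOf_eq_prime h5 h1
    have hq0 : (q : ZMod l) ≠ 0 := by
      intro h
      rw [h] at h5
      simp at h5
    have hd : 5 ∣ l - 1 := ho ▸ ZMod.orderOf_dvd_card_sub_one hq0
    have h2 := hl.two_le
    rcases hl.eq_two_or_odd with h | h <;> omega

theorem geom_sum_range_succ_lt {q : ℕ} (hq : 2 ≤ q) (m : ℕ) :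
    ∑ i ∈ Finset.range (m + 1), q ^ i < 2 * q ^ m := by
  rw [Finset.sum_range_succ]
  have := Nat.geomSum_lt (n := m) (s := Finset.range m) hq fun k hk => Finset.mem_range.1 hk
  omega

theorem card_filter_le_of_lt {M L K N : ℕ} {C D : Finset ℕ} (hM : M ≠ 0)
    (hcov : ∀ l ∈ M.primeFactors, l ∈ C ∨ l ∈ D ∨ L ≤ l) (hN : N ∣ M)
    (hNp : ∀ l, l.Prime → l ∣ N → l ∈ C ∨ l ∈ D) (hL : 1 < L) (h : M < L ^ (K + 1) * N) :
    (M.primeFactors.filter fun l => l ∉ C ∧ l ∉ D).card ≤ K := by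
  have h1 := pow_card_le_of_forall_le (M := M) (L := L) hM (Finset.filter_subset
    (fun l => l ∉ C ∧ l ∉ D) M.primeFactors) (fun l hl => ?_) hN (fun l hl => ?_)
  · have hN0 : 0 < N := Nat.pos_of_dvd_of_pos hN (Nat.pos_of_ne_zero hM)
    exact Nat.lt_succ_iff.1 ((Nat.pow_lt_pow_iff_right hL).1
      (lt_of_mul_lt_mul_right (h1.trans_lt h) hN0.le))
  · obtain ⟨hlM, hlC, hlD⟩ := Finset.mem_filter.1 hl
    rcases hcov l hlM with h | h | h
    · exact absurd h hlC
    · exact absurd h hlD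
    · exact h
  · obtain ⟨hlM, hlC, hlD⟩ := Finset.mem_filter.1 hl
    have hp := Nat.prime_of_mem_primeFactors hlM
    refine (Nat.Prime.coprime_iff_not_dvd hp).2 fun hd => ?_
    rcases hNp l hp hd with h | h
    · exact hlC h
    · exact hlD h

end SmallPrimes

section Criteria

variable {Fq F : Type*} [Field Fq] [Field F] [Fintype Fq] [Fintype F] [Algebra Fq F]

theorem existsPair_six_of_sieveTest (hn : Module.finrank Fq F = 6) {q₀ L K N : ℕ} {C D : List ℕ}
    (hC : ∀ l ∈ C, l.Prime) (hCn : C.Nodup) (hD : ∀ l ∈ D, 0 < l) (hDn : D.Nodup) (hL : 1 < L)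
    (hcov : ∀ l ∈ (∑ i ∈ Finset.range 6, Fintype.card Fq ^ i).primeFactors,
      l ∈ C ∨ l ∈ D ∨ L ≤ l)
    (hN : N ∣ ∑ i ∈ Finset.range 6, Fintype.card Fq ^ i)
    (hNp : ∀ l, l.Prime → l ∣ N → l ∈ C ∨ l ∈ D)
    (hK : ∑ i ∈ Finset.range 6, Fintype.card Fq ^ i < L ^ (K + 1) * N)
    (hq₀ : 0 < q₀) (hq : q₀ ≤ Fintype.card Fq) (h : sieveTest 60 10 1 1 q₀ C D L K = true) :
    ExistsPrimitiveOneNormalPair Fq F 6 := by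
  have hM : ∑ i ∈ Finset.range 6, Fintype.card Fq ^ i ≠ 0 := by
    rw [Finset.sum_range_succ']
    simp
  obtain ⟨hδ, h1⟩ := sieveTest_sound hC hCn hD hDn (by omega) one_pos hq₀ h
  have h2 := h1 1 (by norm_num)
  have hθ := sieveDensity_pos (P := C.toFinset) fun l hl => hC l (List.mem_toFinset.1 hl)
  have h3 := sieve_mono_linear hθ hδ (by exact_mod_cast hq₀)
    (show (q₀ : ℝ) ≤ (Fintype.card Fq : ℝ) by exact_mod_cast hq) (by norm_num) h2
  simp_rw [← List.mem_toFinset (l := C), ← List.mem_toFinset (l := D)] at hcov hNp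
  obtain ⟨P, R, hPR, hU, hδ', h4⟩ := exists_partition_of_candidates
    (fun l hl => hC l (List.mem_toFinset.1 hl)) (by omega) hcov
    (card_filter_le_of_lt hM hcov hN hNp hL hK) zero_le_one (by positivity) hδ h3
  exact existsPair_six_of_sieve hn hPR hU hδ' (by exact_mod_cast h4)

theorem existsPair_five_of_sieveTest (hn : Module.finrank Fq F = 5) {q₀ s L K N : ℕ} {D : List ℕ}
    (hD : ∀ l ∈ D, 0 < l) (hDn : D.Nodup) (hL : 1 < L)
    (hcov : ∀ l ∈ (∑ i ∈ Finset.range 5, Fintype.card Fq ^ i).primeFactors, l ∈ D ∨ L ≤ l)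
    (hN : N ∣ ∑ i ∈ Finset.range 5, Fintype.card Fq ^ i)
    (hNp : ∀ l, l.Prime → l ∣ N → l ∈ D)
    (hK : ∑ i ∈ Finset.range 5, Fintype.card Fq ^ i < L ^ (K + 1) * N)
    (hq₀ : 0 < q₀) (hq : q₀ ≤ Fintype.card Fq) (hs : q₀ * 10000 ≤ s * s)
    (h : sieveTest 32 8 s 100 q₀ [] D L K = true) :
    ExistsPrimitiveOneNormalPair Fq F 5 := by
  have hM : ∑ i ∈ Finset.range 5, Fintype.card Fq ^ i ≠ 0 := by
    rw [Finset.sum_range_succ']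
    simp
  obtain ⟨hδ, h1⟩ := sieveTest_sound (C := []) (by simp) List.nodup_nil hD hDn (by omega)
    (by norm_num) hq₀ h
  have hs' : √(q₀ : ℝ) ≤ (s : ℝ) / (100 : ℕ) := by
    have : (q₀ * 10000 : ℝ) ≤ s * s := by exact_mod_cast hs
    rw [Real.sqrt_le_left (by positivity)]
    push_cast
    rw [div_pow, le_div_iff₀ (by norm_num)]
    linarith
  have h2 := h1 _ hs'
  have hθ : 0 < sieveDensity ([] : List ℕ).toFinset := sieveDensity_pos (by simp)
  have h3 := sieve_mono_sqrt hθ hδ (by exact_mod_cast hq₀)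
    (show (q₀ : ℝ) ≤ (Fintype.card Fq : ℝ) by exact_mod_cast hq) (by norm_num) (by norm_num) h2
  have hcov' : ∀ l ∈ (∑ i ∈ Finset.range 5, Fintype.card Fq ^ i).primeFactors,
      l ∈ ([] : List ℕ).toFinset ∨ l ∈ D.toFinset ∨ L ≤ l := fun l hl =>
    Or.inr ((hcov l hl).imp_left List.mem_toFinset.2)
  obtain ⟨P, R, hPR, hU, hδ', h4⟩ := exists_partition_of_candidates (by simp) (by omega) hcov'
    (card_filter_le_of_lt hM hcov' hN
      (fun l hl hd => Or.inr (List.mem_toFinset.2 (hNp l hl hd))) hL hK)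
    (Real.sqrt_nonneg _) (by positivity) hδ h3
  exact existsPair_five_of_sieve hn hPR hU hδ' (by exact_mod_cast h4)

theorem pow_card_primeFactors_mul_prod_le {M L : ℕ} (hM : M ≠ 0) {S : Finset ℕ}
    (hS : ∀ l ∈ S, l ≤ L) (hMS : ∀ l ∈ M.primeFactors, l < L → l ∈ S) :
    L ^ M.primeFactors.card * ∏ l ∈ S, l ≤ M * L ^ S.card := by
  classical
  set P₁ := M.primeFactors.filter (· < L) with hP₁
  set P₂ := M.primeFactors.filter (¬ · < L) with hP₂
  have hsub : P₁ ⊆ S := fun l hl => hMS l (Finset.mem_filter.1 hl).1 (Finset.mem_filter.1 hl).2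
  have hcard : M.primeFactors.card = P₁.card + P₂.card :=
    (Finset.card_filter_add_card_filter_not _).symm
  have h1 : (∏ l ∈ P₁, l) * L ^ P₂.card ≤ M := by
    calc (∏ l ∈ P₁, l) * L ^ P₂.card ≤ (∏ l ∈ P₁, l) * ∏ l ∈ P₂, l :=
          Nat.mul_le_mul_left _ (Finset.pow_card_le_prod _ _ _ fun l hl =>
            not_lt.1 (Finset.mem_filter.1 hl).2)
      _ = ∏ l ∈ M.primeFactors, l := Finset.prod_filter_mul_prod_filter_not _ _ _
      _ ≤ M := Nat.le_of_dvd (Nat.pos_of_ne_zero hM) (Nat.prod_primeFactors_dvd M)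
  have h2 : L ^ P₁.card * ∏ l ∈ S, l ≤ (∏ l ∈ P₁, l) * L ^ S.card := by
    rw [← Finset.prod_sdiff hsub, ← Finset.card_sdiff_add_card_eq_card hsub, pow_add]
    have : ∏ l ∈ S \ P₁, l ≤ L ^ (S \ P₁).card :=
      Finset.prod_le_pow_card _ _ _ fun l hl => hS l (Finset.mem_sdiff.1 hl).1
    calc _ = (L ^ P₁.card * ∏ l ∈ P₁, l) * ∏ l ∈ S \ P₁, l := by ring
      _ ≤ (L ^ P₁.card * ∏ l ∈ P₁, l) * L ^ (S \ P₁).card := Nat.mul_le_mul_left _ this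
      _ = _ := by ring
  calc _ = L ^ P₂.card * (L ^ P₁.card * ∏ l ∈ S, l) := by rw [hcard, pow_add]; ring
    _ ≤ L ^ P₂.card * ((∏ l ∈ P₁, l) * L ^ S.card) := Nat.mul_le_mul_left _ h2
    _ = ((∏ l ∈ P₁, l) * L ^ P₂.card) * L ^ S.card := by ring
    _ ≤ _ := Nat.mul_le_mul_right _ h1

theorem inv_two_pow_le_sieveDensity {P : Finset ℕ} (hP : ∀ l ∈ P, l.Prime) :
    ((2 : ℝ) ^ P.card)⁻¹ ≤ sieveDensity P := by
  rw [sieveDensity, ← inv_pow, ← Finset.prod_const]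
  refine Finset.prod_le_prod (fun _ _ => by positivity) fun l hl => ?_
  have h2 : (2 : ℝ) ≤ l := by exact_mod_cast (hP l hl).two_le
  have : (l : ℝ)⁻¹ ≤ 2⁻¹ := by gcongr
  linarith

theorem existsPair_six_of_large (hn : Module.finrank Fq F = 6)
    (hq : 4 * 10 ^ 20 ≤ Fintype.card Fq) : ExistsPrimitiveOneNormalPair Fq F 6 := by
  set q := Fintype.card Fq with hqdef
  set M := ∑ i ∈ Finset.range 6, q ^ i with hMdef
  have hM : M ≠ 0 := by
    rw [hMdef, Finset.sum_range_succ']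
    simp
  have hMlt : M < 2 * q ^ 5 := geom_sum_range_succ_lt (by omega) 5
  set P := M.primeFactors with hP
  have hω := pow_card_primeFactors_mul_prod_le (L := 64) hM (S := (smallPrimes 64).toFinset)
    (fun l hl => by
      rw [List.mem_toFinset, smallPrimes, List.mem_filter, List.mem_range] at hl
      omega)
    (fun l hl hl64 => List.mem_toFinset.2
      (mem_smallPrimes_of_prime (Nat.prime_of_mem_primeFactors hl) hl64))
  have hprod : ∏ l ∈ (smallPrimes 64).toFinset, l = 117288381359406970983270 := by decide +kernel
  have hcard : (smallPrimes 64).toFinset.card = 18 := by decide +kernel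
  rw [hprod, hcard, ← hP] at hω
  have hmain : 64 * 2 ^ P.card ≤ q := by
    by_contra hc
    have h1 : q ^ 6 < (64 * 2 ^ P.card) ^ 6 := Nat.pow_lt_pow_left (not_le.1 hc) (by norm_num)
    have h2 : (64 * 2 ^ P.card) ^ 6 = 2 ^ 36 * 64 ^ P.card := by
      rw [mul_pow, ← pow_mul, mul_comm P.card 6, pow_mul]
      norm_num
    rw [h2] at h1
    have h3 : q ^ 6 * 117288381359406970983270 < 2 ^ 36 * (2 * q ^ 5 * 64 ^ 18) := by
      calc q ^ 6 * 117288381359406970983270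
          < 2 ^ 36 * 64 ^ P.card * 117288381359406970983270 :=
            Nat.mul_lt_mul_of_pos_right h1 (by norm_num)
        _ = 2 ^ 36 * (64 ^ P.card * 117288381359406970983270) := by ring
        _ ≤ 2 ^ 36 * (M * 64 ^ 18) := Nat.mul_le_mul_left _ hω
        _ ≤ _ := Nat.mul_le_mul_left _ (Nat.mul_le_mul_right _ hMlt.le)
    have h4 : q ^ 5 * (q * 117288381359406970983270) < q ^ 5 * (2 ^ 37 * 64 ^ 18) := by
      calc _ = q ^ 6 * 117288381359406970983270 := by ring
        _ < _ := h3
        _ = _ := by ring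
    have h5 := lt_of_mul_lt_mul_left h4 (Nat.zero_le _)
    norm_num at h5
    omega
  have hθ := inv_two_pow_le_sieveDensity (P := P) fun l hl => Nat.prime_of_mem_primeFactors hl
  refine existsPair_six_of_sieve hn (P := P) (R := ∅) (Finset.disjoint_empty_right _)
    (Finset.union_empty _) (by simp) ?_
  rw [Finset.sum_empty, Finset.card_empty, ← hqdef]
  have hq' : (64 * 2 ^ P.card : ℝ) ≤ q := by exact_mod_cast hmain
  have hq'' : (20 : ℝ) ≤ q := by exact_mod_cast (show 20 ≤ q by omega)
  have hw : (0 : ℝ) < 2 ^ P.card := by positivity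
  have h10 : (10 / q : ℝ) ≤ 1 := by rw [div_le_one (by linarith)]; linarith
  have : (62 : ℝ) ≤ (2 ^ P.card : ℝ)⁻¹ * (q - 2 * 2 ^ P.card) := by
    rw [inv_mul_eq_div, le_div_iff₀ hw]
    linarith
  have h6 : (2 ^ P.card : ℝ)⁻¹ * (q - 2 * 2 ^ P.card) ≤ sieveDensity P * (q - 2 * 2 ^ P.card) :=
    mul_le_mul_of_nonneg_right hθ (by linarith)
  simp only [sub_zero, one_mul, mul_one, Nat.cast_zero, mul_zero]
  linarith

theorem existsPair_five_of_large (hn : Module.finrank Fq F = 5)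
    (hq : 10 ^ 37 ≤ Fintype.card Fq) : ExistsPrimitiveOneNormalPair Fq F 5 := by
  set q := Fintype.card Fq with hqdef
  set M := ∑ i ∈ Finset.range 5, q ^ i with hMdef
  have hM : M ≠ 0 := by
    rw [hMdef, Finset.sum_range_succ']
    simp
  have hMlt : M < 2 * q ^ 4 := geom_sum_range_succ_lt (by omega) 4
  set P := M.primeFactors with hP
  set S := ((smallPrimes 512).filter fun l => l == 5 || l % 10 == 1).toFinset with hS
  have hω := pow_card_primeFactors_mul_prod_le (L := 512) hM (S := S)
    (fun l hl => by
      rw [hS, List.mem_toFinset, List.mem_filter, smallPrimes, List.mem_filter,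
        List.mem_range] at hl
      omega)
    (fun l hl hl512 => by
      have hp := Nat.prime_of_mem_primeFactors hl
      rw [hS, List.mem_toFinset, List.mem_filter]
      refine ⟨mem_smallPrimes_of_prime hp hl512, ?_⟩
      rw [Bool.or_eq_true, beq_iff_eq, beq_iff_eq]
      exact eq_five_or_mod_ten_of_dvd hp (Nat.dvd_of_mem_primeFactors hl))
  have hprod : ∏ l ∈ S, l = 34458895393599190435904254394708827522879771945255 := by
    decide +kernel
  have hcard : S.card = 23 := by decide +kernel
  rw [hprod, hcard, ← hP] at hω
  have hmain : 16 * 4 ^ P.card ≤ q := by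
    by_contra hc
    have h1 : q ^ 9 < (16 * 4 ^ P.card) ^ 9 := Nat.pow_lt_pow_left (not_le.1 hc) (by norm_num)
    have h2 : (16 * 4 ^ P.card) ^ 9 = 2 ^ 36 * (512 ^ P.card) ^ 2 := by
      rw [mul_pow, ← pow_mul, ← pow_mul, mul_comm P.card 9, mul_comm P.card 2, pow_mul, pow_mul]
      norm_num
    rw [h2] at h1
    set c := 34458895393599190435904254394708827522879771945255 with hc'
    have h3 : q ^ 9 * c ^ 2 < 2 ^ 36 * (2 * q ^ 4 * 512 ^ 23) ^ 2 := by
      calc q ^ 9 * c ^ 2 < 2 ^ 36 * (512 ^ P.card) ^ 2 * c ^ 2 :=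
            Nat.mul_lt_mul_of_pos_right h1 (by norm_num [hc'])
        _ = 2 ^ 36 * (512 ^ P.card * c) ^ 2 := by ring
        _ ≤ 2 ^ 36 * (M * 512 ^ 23) ^ 2 :=
            Nat.mul_le_mul_left _ (Nat.pow_le_pow_left hω 2)
        _ ≤ _ := Nat.mul_le_mul_left _ (Nat.pow_le_pow_left (Nat.mul_le_mul_right _ hMlt.le) 2)
    have h4 : q ^ 8 * (q * c ^ 2) < q ^ 8 * (2 ^ 38 * (512 ^ 23) ^ 2) := by
      calc _ = q ^ 9 * c ^ 2 := by ring
        _ < _ := h3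
        _ = _ := by ring
    have h5 := lt_of_mul_lt_mul_left h4 (Nat.zero_le _)
    norm_num [hc'] at h5
    omega
  have hq400 : 400 ≤ q := le_trans (by norm_num) hq
  clear hω hprod hcard hq
  have hθ := inv_two_pow_le_sieveDensity (P := P) fun l hl => Nat.prime_of_mem_primeFactors hl
  refine existsPair_five_of_sieve hn (P := P) (R := ∅) (Finset.disjoint_empty_right _)
    (Finset.union_empty _) (by simp) ?_
  rw [Finset.sum_empty, Finset.card_empty, ← hqdef]
  have hw : (0 : ℝ) < 2 ^ P.card := by positivity
  have hr : (4 * 2 ^ P.card : ℝ) ≤ √q := by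
    refine Real.le_sqrt_of_sq_le ?_
    rw [mul_pow, ← pow_mul, mul_comm P.card, pow_mul]
    norm_num
    exact_mod_cast hmain
  have hr' : (20 : ℝ) ≤ √q := by
    refine Real.le_sqrt_of_sq_le ?_
    have : (400 : ℝ) ≤ q := by exact_mod_cast hq400
    linarith
  have hrr : √(q : ℝ) * √q = q := Real.mul_self_sqrt (by positivity)
  have h8 : (8 / q : ℝ) ≤ 1 := by rw [div_le_one (by nlinarith)]; nlinarith
  have : 40 ≤ (2 ^ P.card : ℝ)⁻¹ * (q - 2 * 2 ^ P.card * √q) := by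
    rw [inv_mul_eq_div, le_div_iff₀ hw]
    nlinarith
  have h6 : (2 ^ P.card : ℝ)⁻¹ * (q - 2 * 2 ^ P.card * √q) ≤
      sieveDensity P * (q - 2 * 2 ^ P.card * √q) :=
    mul_le_mul_of_nonneg_right hθ (by nlinarith)
  simp only [sub_zero, one_mul, Nat.cast_zero, mul_zero]
  linarith

end Criteria

section Ranges

variable {Fq F : Type*} [Field Fq] [Field F] [Fintype Fq] [Fintype F] [Algebra Fq F]

theorem existsPair_six_of_mem_range (hn : Module.finrank Fq F = 6) {q₀ q₁ L K c : ℕ}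
    (hL : 1 < L) (hL' : L ≤ 1369) (hq₀ : 2 ≤ q₀) (h₀ : q₀ ≤ Fintype.card Fq)
    (h₁ : Fintype.card Fq ≤ q₁) (hK : 2 * q₁ ^ 5 ≤ L ^ (K + 1))
    (h : sieveTest 60 10 1 1 q₀ ((smallPrimes L).filter (· < c))
      ((smallPrimes L).filter (c ≤ ·)) L K = true) :
    ExistsPrimitiveOneNormalPair Fq F 6 := by
  refine existsPair_six_of_sieveTest hn (N := 1)
    (fun l hl => prime_of_mem_smallPrimes hL' (List.mem_of_mem_filter hl))
    ((smallPrimes_nodup L).filter _)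
    (fun l hl => (prime_of_mem_smallPrimes hL' (List.mem_of_mem_filter hl)).pos)
    ((smallPrimes_nodup L).filter _) hL (fun l hl => ?_) (one_dvd _)
    (fun l hl h1 => absurd h1 hl.not_dvd_one) ?_ (by omega) h₀ h
  · rcases lt_or_ge l L with hlL | hlL
    · have hm := mem_smallPrimes_of_prime (Nat.prime_of_mem_primeFactors hl) hlL
      rcases lt_or_ge l c with hc | hc
      · exact Or.inl (List.mem_filter.2 ⟨hm, decide_eq_true hc⟩)
      · exact Or.inr (Or.inl (List.mem_filter.2 ⟨hm, decide_eq_true hc⟩))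
    · exact Or.inr (Or.inr hlL)
  · rw [mul_one]
    calc _ < 2 * Fintype.card Fq ^ 5 := geom_sum_range_succ_lt (by omega) 5
      _ ≤ 2 * q₁ ^ 5 := by gcongr
      _ ≤ _ := hK

/-- The primes below `L` that can divide `1 + q + q ^ 2 + q ^ 3 + q ^ 4`. -/
def smallPrimesFive (L : ℕ) : List ℕ := (smallPrimes L).filter fun l => l == 5 || l % 10 == 1

theorem mem_smallPrimesFive {l L q : ℕ} (hl : l.Prime) (hlL : l < L)
    (h : l ∣ ∑ i ∈ Finset.range 5, q ^ i) : l ∈ smallPrimesFive L := by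
  rw [smallPrimesFive, List.mem_filter, Bool.or_eq_true, beq_iff_eq, beq_iff_eq]
  exact ⟨mem_smallPrimes_of_prime hl hlL, eq_five_or_mod_ten_of_dvd hl h⟩

theorem existsPair_five_of_mem_range (hn : Module.finrank Fq F = 5) {q₀ q₁ L K s : ℕ}
    (hL : 1 < L) (hL' : L ≤ 1369) (hq₀ : 2 ≤ q₀) (h₀ : q₀ ≤ Fintype.card Fq)
    (h₁ : Fintype.card Fq ≤ q₁) (hK : 2 * q₁ ^ 4 ≤ L ^ (K + 1)) (hs : q₀ * 10000 ≤ s * s)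
    (h : sieveTest 32 8 s 100 q₀ [] (smallPrimesFive L) L K = true) :
    ExistsPrimitiveOneNormalPair Fq F 5 := by
  refine existsPair_five_of_sieveTest hn (N := 1)
    (fun l hl => (prime_of_mem_smallPrimes hL' (List.mem_of_mem_filter hl)).pos)
    ((smallPrimes_nodup L).filter _) hL (fun l hl => ?_) (one_dvd _)
    (fun l hl h1 => absurd h1 hl.not_dvd_one) ?_ (by omega) h₀ hs h
  · rcases lt_or_ge l L with hlL | hlL
    · exact Or.inl (mem_smallPrimesFive (Nat.prime_of_mem_primeFactors hl) hlL
        (Nat.dvd_of_mem_primeFactors hl))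
    · exact Or.inr hlL
  · rw [mul_one]
    calc _ < 2 * Fintype.card Fq ^ 4 := geom_sum_range_succ_lt (by omega) 4
      _ ≤ 2 * q₁ ^ 4 := by gcongr
      _ ≤ _ := hK

theorem existsPair_six_of_ge (hn : Module.finrank Fq F = 6) (hq : 3860 ≤ Fintype.card Fq) :
    ExistsPrimitiveOneNormalPair Fq F 6 := by
  rcases le_total (4 * 10 ^ 20) (Fintype.card Fq) with h | h
  · exact existsPair_six_of_large hn h
  rcases le_total 47606 (Fintype.card Fq) with h' | h'
  · exact existsPair_six_of_mem_range hn (L := 223) (K := 43) (c := 12) (by norm_num) (by norm_num)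
      (by norm_num) h' h (by norm_num) (by decide +kernel)
  · exact existsPair_six_of_mem_range hn (L := 53) (K := 13) (c := 8) (by norm_num) (by norm_num)
      (by norm_num) hq h' (by norm_num) (by decide +kernel)

theorem existsPair_five_of_ge (hn : Module.finrank Fq F = 5) (hq : 4000 ≤ Fintype.card Fq) :
    ExistsPrimitiveOneNormalPair Fq F 5 := by
  rcases le_total (10 ^ 37) (Fintype.card Fq) with h | h
  · exact existsPair_five_of_large hn h
  rcases le_total 162580 (Fintype.card Fq) with h' | h'
  · exact existsPair_five_of_mem_range hn (L := 631) (K := 52) (s := 40322) (by norm_num)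
      (by norm_num) (by norm_num) h' h (by norm_num) (by norm_num) (by decide +kernel)
  · exact existsPair_five_of_mem_range hn (L := 131) (K := 9) (s := 6325) (by norm_num)
      (by norm_num) (by norm_num) hq h' (by norm_num) (by norm_num) (by decide +kernel)

end Ranges

section SmallFields

/-- The test for `n = 6` and a single `q`, with core primes `2` and `3`, sieving the other primes
below `L` that divide `M = 1 + q + ⋯ + q ^ 5`. -/
def sieveCheckSix (L q : ℕ) : Bool :=
  (fun M => (fun D => (List.range 20).any fun K => decide (M < L ^ (K + 1) * D.prod) &&
      sieveTest 60 10 1 1 q [2, 3] D L K)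
    ((smallPrimes L).filter fun l => decide (3 < l) && M % l == 0))
  (1 + q + q ^ 2 + q ^ 3 + q ^ 4 + q ^ 5)

/-- The test for `n = 5` and a single `q`, sieving the primes below `L` that divide
`M = 1 + q + ⋯ + q ^ 4`. -/
def sieveCheckFive (L q : ℕ) : Bool :=
  (fun M => (fun D => (List.range 20).any fun K => decide (M < L ^ (K + 1) * D.prod) &&
      sieveTest 32 8 (Nat.sqrt (q * 10000) + 1) 100 q [] D L K)
    ((smallPrimesFive L).filter fun l => M % l == 0))
  (1 + q + q ^ 2 + q ^ 3 + q ^ 4)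

theorem list_prod_dvd_of_prime {D : List ℕ} (hD : ∀ l ∈ D, l.Prime) (hDn : D.Nodup) {M : ℕ}
    (h : ∀ l ∈ D, l ∣ M) : D.prod ∣ M := by
  have := Finset.prod_primes_dvd (s := D.toFinset) M
    (fun l hl => (hD l (List.mem_toFinset.1 hl)).prime) fun l hl => h l (List.mem_toFinset.1 hl)
  rwa [List.prod_toFinset (fun l => l) hDn, List.map_id'] at this

theorem mem_of_prime_dvd_list_prod {D : List ℕ} (hD : ∀ l ∈ D, l.Prime) {l : ℕ} (hl : l.Prime)
    (h : l ∣ D.prod) : l ∈ D := by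
  obtain ⟨r, hr, hlr⟩ := (Prime.dvd_prod_iff hl.prime).1 h
  rwa [(Nat.prime_dvd_prime_iff_eq hl (hD r hr)).1 hlr]

variable {Fq F : Type*} [Field Fq] [Field F] [Fintype Fq] [Fintype F] [Algebra Fq F]

theorem existsPair_six_of_sieveCheck (hn : Module.finrank Fq F = 6) {L : ℕ} (hL : 1 < L)
    (hL' : L ≤ 1369) (h : sieveCheckSix L (Fintype.card Fq) = true) :
    ExistsPrimitiveOneNormalPair Fq F 6 := by
  rw [sieveCheckSix, List.any_eq_true] at h
  obtain ⟨K, -, h⟩ := h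
  rw [Bool.and_eq_true, decide_eq_true_eq] at h
  obtain ⟨hK, h⟩ := h
  have hM : 1 + Fintype.card Fq + Fintype.card Fq ^ 2 + Fintype.card Fq ^ 3 +
      Fintype.card Fq ^ 4 + Fintype.card Fq ^ 5 = ∑ i ∈ Finset.range 6, Fintype.card Fq ^ i := by
    simp [Finset.sum_range_succ]
  rw [hM] at hK h
  have hDp : ∀ l ∈ (smallPrimes L).filter fun l => decide (3 < l) &&
      (∑ i ∈ Finset.range 6, Fintype.card Fq ^ i) % l == 0, l.Prime := fun l hl =>
    prime_of_mem_smallPrimes hL' (List.mem_of_mem_filter hl)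
  have hDn : ((smallPrimes L).filter fun l => decide (3 < l) &&
      (∑ i ∈ Finset.range 6, Fintype.card Fq ^ i) % l == 0).Nodup := (smallPrimes_nodup L).filter _
  refine existsPair_six_of_sieveTest hn
    (by simp [Nat.prime_two, Nat.prime_three]) (by simp)
    (fun l hl => (hDp l hl).pos) hDn hL (fun l hl => ?_)
    (list_prod_dvd_of_prime hDp hDn fun l hl => ?_)
    (fun l hl hd => Or.inr (mem_of_prime_dvd_list_prod hDp hl hd)) hK Fintype.card_pos le_rfl h
  · have hp := Nat.prime_of_mem_primeFactors hl
    rcases lt_or_ge l L with hlL | hlL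
    · by_cases h3 : 3 < l
      · refine Or.inr (Or.inl (List.mem_filter.2 ⟨mem_smallPrimes_of_prime hp hlL, ?_⟩))
        rw [Bool.and_eq_true, decide_eq_true_eq, beq_iff_eq]
        exact ⟨h3, Nat.mod_eq_zero_of_dvd (Nat.dvd_of_mem_primeFactors hl)⟩
      · left
        have := hp.two_le
        rw [List.mem_cons, List.mem_singleton]
        omega
    · exact Or.inr (Or.inr hlL)
  · have := (List.mem_filter.1 hl).2
    rw [Bool.and_eq_true, beq_iff_eq] at this
    exact Nat.dvd_of_mod_eq_zero this.2

theorem existsPair_five_of_sieveCheck (hn : Module.finrank Fq F = 5) {L : ℕ} (hL : 1 < L)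
    (hL' : L ≤ 1369) (h : sieveCheckFive L (Fintype.card Fq) = true) :
    ExistsPrimitiveOneNormalPair Fq F 5 := by
  rw [sieveCheckFive, List.any_eq_true] at h
  obtain ⟨K, -, h⟩ := h
  rw [Bool.and_eq_true, decide_eq_true_eq] at h
  obtain ⟨hK, h⟩ := h
  have hM : 1 + Fintype.card Fq + Fintype.card Fq ^ 2 + Fintype.card Fq ^ 3 +
      Fintype.card Fq ^ 4 = ∑ i ∈ Finset.range 5, Fintype.card Fq ^ i := by
    simp [Finset.sum_range_succ]
  rw [hM] at hK h
  have hDp : ∀ l ∈ (smallPrimesFive L).filter fun l =>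
      (∑ i ∈ Finset.range 5, Fintype.card Fq ^ i) % l == 0, l.Prime := fun l hl =>
    prime_of_mem_smallPrimes hL' (List.mem_of_mem_filter (List.mem_of_mem_filter hl))
  have hDn : ((smallPrimesFive L).filter fun l =>
      (∑ i ∈ Finset.range 5, Fintype.card Fq ^ i) % l == 0).Nodup :=
    ((smallPrimes_nodup L).filter _).filter _
  refine existsPair_five_of_sieveTest hn (fun l hl => (hDp l hl).pos) hDn hL (fun l hl => ?_)
    (list_prod_dvd_of_prime hDp hDn fun l hl => ?_)
    (fun l hl hd => mem_of_prime_dvd_list_prod hDp hl hd) hK Fintype.card_pos le_rfl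
    (Nat.lt_succ_sqrt _).le h
  · rcases lt_or_ge l L with hlL | hlL
    · have hd := Nat.dvd_of_mem_primeFactors hl
      refine Or.inl (List.mem_filter.2
        ⟨mem_smallPrimesFive (Nat.prime_of_mem_primeFactors hl) hlL hd, ?_⟩)
      rw [beq_iff_eq]
      exact Nat.mod_eq_zero_of_dvd hd
    · exact Or.inr hlL
  · exact Nat.dvd_of_mod_eq_zero (beq_iff_eq.1 (List.mem_filter.1 hl).2)

/-- `f` holds on `[a, a + 2 ^ k)`; bisection keeps the recursion depth small. -/
def allOnDyadic (f : ℕ → Bool) : ℕ → ℕ → Bool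
  | 0, a => f a
  | k + 1, a => allOnDyadic f k a && allOnDyadic f k (a + 2 ^ k)

theorem allOnDyadic_sound {f : ℕ → Bool} {k a : ℕ} (h : allOnDyadic f k a = true) {x : ℕ}
    (ha : a ≤ x) (hx : x < a + 2 ^ k) : f x = true := by
  induction k generalizing a with
  | zero =>
    obtain rfl : x = a := by omega
    exact h
  | succ k ih =>
    rw [allOnDyadic, Bool.and_eq_true] at h
    rcases lt_or_ge x (a + 2 ^ k) with hlt | hge
    · exact ih h.1 ha hlt
    · exact ih h.2 hge (by rw [pow_succ] at hx; omega)

/-- A sufficient condition for `q < 2 ^ 12` not to be a prime power. -/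
def notPrimePow (q : ℕ) : Bool :=
  decide (q < 2) || [2, 3, 5, 7, 11, 13, 17, 19, 23, 29, 31, 37, 41, 43, 47, 53, 59, 61].any
    fun p => q % p == 0 && p ^ 12 % q != 0

theorem notPrimePow_sound {q : ℕ} (hq : q < 2 ^ 12) (h : notPrimePow q = true) :
    ¬ IsPrimePow q := by
  rw [notPrimePow, Bool.or_eq_true, decide_eq_true_eq, List.any_eq_true] at h
  intro hpp
  have h2 := hpp.two_le
  rcases h with h | ⟨p, hp, h⟩
  · omega
  rw [Bool.and_eq_true, beq_iff_eq, bne_iff_ne] at h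
  have hpprime : p.Prime := by
    clear h
    revert p
    decide
  obtain ⟨r, k, hr, hk, rfl⟩ := hpp
  have hr' := hr.nat_prime
  have : p = r := (Nat.prime_dvd_prime_iff_eq hpprime hr').1
    (hpprime.dvd_of_dvd_pow (Nat.dvd_of_mod_eq_zero h.1))
  subst this
  refine h.2 (Nat.mod_eq_zero_of_dvd (pow_dvd_pow _ ?_))
  by_contra hk12
  have : 2 ^ 12 ≤ p ^ k := (Nat.pow_le_pow_left hr'.two_le 12).trans
    (Nat.pow_le_pow_right hr'.pos (by omega))
  omega

/-- The `q` coprime to `6` for which an explicit primitive element is used. -/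
def explicitSix : List ℕ := [
  5, 7, 11, 13, 17, 19, 23, 25, 29, 31, 37, 41, 43, 47, 49, 53, 59, 61, 67, 71, 73, 79, 83, 89,
  97, 101, 103, 107, 109, 113, 121, 125, 127, 131, 137, 139, 149, 151, 157, 163, 167, 169, 173,
  179, 181, 191, 193, 197, 199, 211, 223, 227, 229, 233, 239, 241, 251, 257, 263, 269, 271, 277,
  283, 289, 307, 311, 349, 359, 373, 389, 439]

/-- The `q` coprime to `5` for which an explicit primitive element is used, and `4`. -/
def explicitFive : List ℕ := [
  2, 3, 4, 7, 8, 9, 11, 13, 16, 17, 19, 23, 27, 29, 31, 32, 37, 41, 43, 47, 49, 53, 59, 61, 64,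
  67, 71, 73, 79, 81, 83, 89, 97, 101, 103, 109, 113, 121, 131, 137, 151, 157, 163, 181, 191, 251,
  256]

theorem sieveCheck_six_or_mem {q : ℕ} (hq : IsPrimePow q) (hc : Nat.gcd q 6 = 1) (hlt : q < 3860) :
    sieveCheckSix 60 q = true ∨ sieveCheckSix 1000 q = true ∨ q ∈ explicitSix := by
  have h : allOnDyadic (fun q => notPrimePow q || (Nat.gcd q 6 != 1) || explicitSix.elem q ||
    sieveCheckSix 60 q || sieveCheckSix 1000 q) 12 0 = true := by decide +kernel
  have h1 := allOnDyadic_sound h (Nat.zero_le q) (by omega)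
  have h2 : notPrimePow q ≠ true := fun h => notPrimePow_sound (by omega) h hq
  clear h
  simp only [Bool.or_eq_true, bne_iff_ne, List.elem_eq_mem, decide_eq_true_eq] at h1
  rcases h1 with (((h1 | h1) | h1) | h1) | h1
  · exact absurd h1 h2
  · exact absurd hc h1
  · exact Or.inr (Or.inr h1)
  · exact Or.inl h1
  · exact Or.inr (Or.inl h1)

theorem sieveCheck_five_or_mem {q : ℕ} (hq : IsPrimePow q) (hc : Nat.gcd q 5 = 1)
    (hlt : q < 4000) : sieveCheckFive 1000 q = true ∨ q ∈ explicitFive := by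
  have h : allOnDyadic (fun q => notPrimePow q || (Nat.gcd q 5 != 1) || explicitFive.elem q ||
    sieveCheckFive 1000 q) 12 0 = true := by decide +kernel
  have h1 := allOnDyadic_sound h (Nat.zero_le q) (by omega)
  have h2 : notPrimePow q ≠ true := fun h => notPrimePow_sound (by omega) h hq
  clear h
  simp only [Bool.or_eq_true, bne_iff_ne, List.elem_eq_mem, decide_eq_true_eq] at h1
  rcases h1 with ((h1 | h1) | h1) | h1
  · exact absurd h1 h2
  · exact absurd hc h1
  · exact Or.inr h1
  · exact Or.inl h1

theorem existsPair_six_or_mem (hn : Module.finrank Fq F = 6)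
    (hc : Nat.gcd (Fintype.card Fq) 6 = 1) :
    ExistsPrimitiveOneNormalPair Fq F 6 ∨ Fintype.card Fq ∈ explicitSix := by
  rcases lt_or_ge (Fintype.card Fq) 3860 with h | h
  · rcases sieveCheck_six_or_mem (FiniteField.isPrimePow_card Fq) hc h with h | h | h
    · exact Or.inl (existsPair_six_of_sieveCheck hn (by norm_num) (by norm_num) h)
    · exact Or.inl (existsPair_six_of_sieveCheck hn (by norm_num) (by norm_num) h)
    · exact Or.inr h
  · exact Or.inl (existsPair_six_of_ge hn h)

theorem existsPair_five_or_mem (hn : Module.finrank Fq F = 5)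
    (hc : Nat.gcd (Fintype.card Fq) 5 = 1) :
    ExistsPrimitiveOneNormalPair Fq F 5 ∨ Fintype.card Fq ∈ explicitFive := by
  rcases lt_or_ge (Fintype.card Fq) 4000 with h | h
  · rcases sieveCheck_five_or_mem (FiniteField.isPrimePow_card Fq) hc h with h | h
    · exact Or.inl (existsPair_five_of_sieveCheck hn (by norm_num) (by norm_num) h)
    · exact Or.inr h
  · exact Or.inl (existsPair_five_of_ge hn h)

end SmallFields

/-- Evaluate `x` before passing it to `f`. -/
def strict {α : Type*} (x : ℕ) (f : ℕ → α) : α :=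
  Nat.rec (motive := fun _ => α) (f 0) (fun m _ => f (Nat.succ m)) x

theorem strict_eq {α : Type*} (x : ℕ) (f : ℕ → α) : strict x f = f x := by
  cases x <;> rfl

section Packed

variable {E : Type*} [Field E] {B p : ℕ} {γ : E}

/-- `Packs B γ N b x e` states that `x` has a base-`B` expansion `∑ i < N, c i * B ^ i` with all
`c i ≤ b` and that `e = ∑ i < N, c i * γ ^ i`. -/
def Packs (B : ℕ) (γ : E) : ℕ → ℕ → ℕ → E → Prop
  | 0, _, x, e => x = 0 ∧ e = 0
  | N + 1, b, x, e => ∃ c y f, c ≤ b ∧ x = c + B * y ∧ e = c + γ * f ∧ Packs B γ N b y f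

namespace Packs

theorem mono {N b b' x : ℕ} {e : E} (h : Packs B γ N b x e) (hb : b ≤ b') :
    Packs B γ N b' x e := by
  induction N generalizing x e with
  | zero => exact h
  | succ N ih =>
    obtain ⟨c, y, f, hc, hx, he, hf⟩ := h
    exact ⟨c, y, f, hc.trans hb, hx, he, ih hf⟩

theorem zero (B : ℕ) (γ : E) (N b : ℕ) : Packs B γ N b 0 0 := by
  induction N with
  | zero => exact ⟨rfl, rfl⟩
  | succ N ih => exact ⟨0, 0, 0, Nat.zero_le _, by simp, by simp, ih⟩

theorem natCast {N b c : ℕ} (hc : c ≤ b) : Packs B γ (N + 1) b c c :=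
  ⟨c, 0, 0, hc, by simp, by simp, zero B γ N b⟩

theorem mul_base {N b x : ℕ} {e : E} (h : Packs B γ N b x e) :
    Packs B γ (N + 1) b (B * x) (γ * e) :=
  ⟨0, x, e, Nat.zero_le _, by simp, by simp, h⟩

theorem add {N b b' x x' : ℕ} {e e' : E} (h : Packs B γ N b x e) (h' : Packs B γ N b' x' e') :
    Packs B γ N (b + b') (x + x') (e + e') := by
  induction N generalizing x x' e e' with
  | zero =>
    obtain ⟨rfl, rfl⟩ := h
    obtain ⟨rfl, rfl⟩ := h'
    exact ⟨rfl, by simp⟩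
  | succ N ih =>
    obtain ⟨c, y, f, hc, rfl, rfl, hf⟩ := h
    obtain ⟨c', y', f', hc', rfl, rfl, hf'⟩ := h'
    exact ⟨c + c', y + y', f + f', by omega, by ring, by push_cast; ring, ih hf hf'⟩

theorem smul {N b x : ℕ} {e : E} (h : Packs B γ N b x e) (k : ℕ) :
    Packs B γ N (k * b) (k * x) (k * e) := by
  induction N generalizing x e with
  | zero =>
    obtain ⟨rfl, rfl⟩ := h
    exact ⟨by simp, by simp⟩
  | succ N ih =>
    obtain ⟨c, y, f, hc, rfl, rfl, hf⟩ := h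
    exact ⟨k * c, k * y, k * f, Nat.mul_le_mul_left _ hc, by ring, by push_cast; ring, ih hf⟩

theorem extend {N b x : ℕ} {e : E} (h : Packs B γ N b x e) (M : ℕ) :
    Packs B γ (M + N) b x e := by
  induction N generalizing x e with
  | zero =>
    obtain ⟨rfl, rfl⟩ := h
    exact zero B γ _ _
  | succ N ih =>
    obtain ⟨c, y, f, hc, hx, he, hf⟩ := h
    exact ⟨c, y, f, hc, hx, he, ih hf⟩

theorem mul {M N b b' x x' : ℕ} {e e' : E} (h : Packs B γ M b x e) (h' : Packs B γ N b' x' e') :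
    Packs B γ (M + N) (M * (b * b')) (x * x') (e * e') := by
  induction M generalizing x e with
  | zero =>
    obtain ⟨rfl, rfl⟩ := h
    simp only [zero_mul]
    exact zero B γ _ _
  | succ M ih =>
    obtain ⟨c, y, f, hc, rfl, rfl, hf⟩ := h
    have h0 : Packs B γ (M + 1 + N) (M * (b * b')) (B * (y * x')) (γ * (f * e')) := by
      rw [Nat.succ_add_eq_add_succ]
      exact (ih hf).mul_base
    have h1 := ((h'.smul c).extend (M + 1)).add h0
    rw [show (c + B * y) * x' = c * x' + B * (y * x') by ring,
      show (c + γ * f) * e' = c * e' + γ * (f * e') by ring]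
    refine h1.mono ?_
    rw [Nat.succ_mul, add_comm]
    exact Nat.add_le_add_left (Nat.mul_le_mul_right _ hc) _

theorem uncons {N b x : ℕ} {e : E} (hb : b < B) (h : Packs B γ (N + 1) b x e) :
    x % B ≤ b ∧ ∃ f, e = (x % B : ℕ) + γ * f ∧ Packs B γ N b (x / B) f := by
  obtain ⟨c, y, f, hc, rfl, rfl, hf⟩ := h
  have h1 : (c + B * y) % B = c := by
    rw [Nat.add_mul_mod_self_left, Nat.mod_eq_of_lt (by omega)]
  have h2 : (c + B * y) / B = y := by
    rw [Nat.add_mul_div_left _ _ (by omega), Nat.div_eq_of_lt (by omega), zero_add]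
  rw [h1, h2]
  exact ⟨hc, f, rfl, hf⟩

theorem unique {N b b' x : ℕ} {e e' : E} (hb : b < B) (hb' : b' < B) (h : Packs B γ N b x e)
    (h' : Packs B γ N b' x e') : e = e' := by
  induction N generalizing x e e' with
  | zero => rw [h.2, h'.2]
  | succ N ih =>
    obtain ⟨-, f, rfl, hf⟩ := h.uncons hb
    obtain ⟨-, f', rfl, hf'⟩ := h'.uncons hb'
    rw [ih hf hf']

theorem split {M N b x : ℕ} {e : E} (hb : b < B) (h : Packs B γ (M + N) b x e) :
    ∃ e₁ e₂, e = e₁ + γ ^ N * e₂ ∧ Packs B γ N b (x % B ^ N) e₁ ∧ Packs B γ M b (x / B ^ N) e₂ := by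
  induction N generalizing x e with
  | zero => exact ⟨0, e, by simp, ⟨by simp [Nat.mod_one], rfl⟩, by simpa using h⟩
  | succ N ih =>
    obtain ⟨hc, f, rfl, hf⟩ := h.uncons hb
    obtain ⟨e₁, e₂, rfl, h₁, h₂⟩ := ih hf
    refine ⟨(x % B : ℕ) + γ * e₁, e₂, by ring, ⟨x % B, x / B % B ^ N, e₁, hc, ?_, rfl, h₁⟩, ?_⟩
    · rw [pow_succ', Nat.mod_mul]
    · rwa [pow_succ', ← Nat.div_div_eq_div_mul]

end Packs

/-- Reduce each of the `N` lowest base-`B` digits modulo `p`. -/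
def redDigits (B p N : ℕ) : ℕ → ℕ :=
  N.rec (fun _ => 0) fun _ ih x => strict x fun x =>
    Nat.add (Nat.mod (Nat.mod x B) p) (Nat.mul B (ih (Nat.div x B)))

theorem redDigits_succ (B p N x : ℕ) :
    redDigits B p (N + 1) x = x % B % p + B * redDigits B p N (x / B) :=
  strict_eq x fun x => x % B % p + B * redDigits B p N (x / B)

/-- Add to `acc` the combination of the entries of `T` whose coefficients are the base-`B` digits
of `hi`, reduced modulo `p`. -/
def foldHigh (B p : ℕ) (T : List ℕ) : ℕ → ℕ → ℕ :=
  T.rec (fun _ acc => acc) fun t _ ih hi acc => strict hi fun hi => strict acc fun acc =>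
    ih (Nat.div hi B) (Nat.add acc (Nat.mul (Nat.mod (Nat.mod hi B) p) t))

theorem foldHigh_cons (B p t : ℕ) (T : List ℕ) (hi acc : ℕ) :
    foldHigh B p (t :: T) hi acc = foldHigh B p T (hi / B) (acc + hi % B % p * t) := by
  change (strict hi fun hi => strict acc fun acc =>
    foldHigh B p T (hi / B) (acc + hi % B % p * t)) = _
  rw [strict_eq, strict_eq]

variable [CharP E p]

theorem Packs.redDigits {N b x : ℕ} {e : E} (hp : 0 < p) (hb : b < B) (h : Packs B γ N b x e) :
    Packs B γ N (p - 1) (redDigits B p N x) e := by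
  induction N generalizing x e with
  | zero => exact ⟨rfl, h.2⟩
  | succ N ih =>
    obtain ⟨-, f, rfl, hf⟩ := h.uncons hb
    rw [redDigits_succ]
    refine ⟨x % B % p, _, f, ?_, rfl, ?_, ih hf⟩
    · have := Nat.mod_lt (x % B) hp
      omega
    · rw [CharP.cast_eq_mod E p (x % B)]

theorem Packs.foldHigh {M N b b' hi acc : ℕ} {T : List ℕ} {e₁ e₂ : E} {k : ℕ} (hp : 0 < p)
    (hb : b < B) (hT : ∀ i (hi : i < T.length), Packs B γ N (p - 1) T[i] (γ ^ (k + i)))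
    (hM : T.length = M) (hhi : Packs B γ M b hi e₂) (hacc : Packs B γ N b' acc e₁) :
    Packs B γ N (b' + M * ((p - 1) * (p - 1))) (foldHigh B p T hi acc) (e₁ + γ ^ k * e₂) := by
  induction T generalizing M b' hi acc e₁ e₂ k with
  | nil =>
    obtain rfl : M = 0 := hM.symm
    obtain ⟨-, rfl⟩ := hhi
    simpa [_root_.foldHigh] using hacc
  | cons t T ih =>
    obtain ⟨M, rfl⟩ : ∃ M', M = M' + 1 := ⟨T.length, by rw [← hM, List.length_cons]⟩
    obtain ⟨-, f, rfl, hf⟩ := hhi.uncons hb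
    have h0 : Packs B γ N (p - 1) t (γ ^ k) := hT 0 (by simp)
    have hlt := Nat.mod_lt (hi % B) hp
    have h1 := hacc.add ((h0.smul (hi % B % p)).mono
      (Nat.mul_le_mul_right (p - 1) (show hi % B % p ≤ p - 1 by omega)))
    have h2 := ih (k := k + 1) (fun i hi => by
      have := hT (i + 1) (by simpa using hi)
      rwa [List.getElem_cons_succ, show k + (i + 1) = k + 1 + i by ring] at this)
      (by simpa using hM) hf h1
    have e1 : e₁ + γ ^ k * ((hi % B : ℕ) + γ * f) =
        e₁ + (hi % B % p : ℕ) * γ ^ k + γ ^ (k + 1) * f := by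
      rw [← CharP.cast_eq_mod E p (hi % B)]
      ring
    rw [e1, foldHigh_cons]
    refine Packs.mono h2 ?_
    rw [Nat.succ_mul]
    omega

end Packed

section Packed

/-- Data for computing in `𝔽_p[γ]` with elements packed in base `B`; `T` holds
`γ ^ N, …, γ ^ (2 * N - 1)` in packed form, and `BN = B ^ N`. -/
structure PackedRing where
  B : ℕ
  p : ℕ
  N : ℕ
  BN : ℕ
  T : List ℕ

namespace PackedRing

variable (R : PackedRing)

/-- Packed multiplication. -/
def mul (a b : ℕ) : ℕ :=
  strict (Nat.mul a b) fun x =>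
    redDigits R.B R.p R.N (foldHigh R.B R.p R.T (Nat.div x R.BN) (Nat.mod x R.BN))

/-- Packed addition. -/
def add (a b : ℕ) : ℕ := redDigits R.B R.p R.N (Nat.add a b)

/-- Packed subtraction. -/
def sub (a b : ℕ) : ℕ := redDigits R.B R.p R.N (Nat.add a (Nat.mul (Nat.pred R.p) b))

/-- Packed powers `a ^ e` for `e < 2 ^ k`. -/
def pow (k : ℕ) : ℕ → ℕ → ℕ :=
  k.rec (fun _ _ => 1) fun _ ih a e =>
    Bool.rec
      (strict a fun a => strict (ih (R.mul a a) (Nat.div e 2)) fun r =>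
        Bool.rec (R.mul a r) r (Nat.beq (Nat.mod e 2) 0))
      1 (Nat.beq e 0)

/-- `R` correctly describes arithmetic in `𝔽_p[γ]`. -/
structure IsModel {E : Type*} [Field E] (γ : E) : Prop where
  charP : CharP E R.p
  two_le_p : 2 ≤ R.p
  two_le_N : 2 ≤ R.N
  bound : 2 * R.N * (R.p * R.p) ≤ R.B
  BN_eq : R.BN = R.B ^ R.N
  length_T : R.T.length = R.N
  packs_T : ∀ i (hi : i < R.T.length), Packs R.B γ R.N (R.p - 1) R.T[i] (γ ^ (R.N + i))

variable {E : Type*} [Field E] {γ : E}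

/-- `x` is the packed form of `e`. -/
def Rep (γ : E) (x : ℕ) (e : E) : Prop := Packs R.B γ R.N (R.p - 1) x e

variable {R}

namespace IsModel

theorem lt_base (hR : R.IsModel γ) {k : ℕ} (hk : k ≤ 2 * R.N * ((R.p - 1) * (R.p - 1))) :
    k < R.B := by
  refine hk.trans_lt (lt_of_lt_of_le ?_ hR.bound)
  have h1 := hR.two_le_p
  have h2 := hR.two_le_N
  refine Nat.mul_lt_mul_of_pos_left ?_ (by omega)
  exact Nat.mul_lt_mul_of_lt_of_lt (by omega) (by omega)

theorem reduce (hR : R.IsModel γ) {x : ℕ} {e : E} {k : ℕ}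
    (hk : k ≤ 2 * R.N * ((R.p - 1) * (R.p - 1))) (h : Packs R.B γ R.N k x e) :
    R.Rep γ (redDigits R.B R.p R.N x) e := by
  have := hR.charP
  have := hR.two_le_p
  exact h.redDigits (by omega) (hR.lt_base hk)

theorem pred_le (hR : R.IsModel γ) : R.p - 1 ≤ (R.p - 1) * (R.p - 1) := by
  have := hR.two_le_p
  exact Nat.le_mul_of_pos_left _ (by omega)

theorem two_mul_sq_le (hR : R.IsModel γ) :
    2 * ((R.p - 1) * (R.p - 1)) ≤ 2 * R.N * ((R.p - 1) * (R.p - 1)) := by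
  have := hR.two_le_N
  exact Nat.mul_le_mul_right _ (by omega)

theorem reduce_shift (hR : R.IsModel γ) {x k : ℕ} {e : E}
    (hk : k ≤ R.N * ((R.p - 1) * (R.p - 1))) (h : Packs R.B γ (R.N + R.N) k x e) :
    R.Rep γ (redDigits R.B R.p R.N (foldHigh R.B R.p R.T (x / R.BN) (x % R.BN))) e := by
  have := hR.charP
  have hp := hR.two_le_p
  have hle : R.N * ((R.p - 1) * (R.p - 1)) ≤ 2 * R.N * ((R.p - 1) * (R.p - 1)) := by
    rw [mul_assoc]
    omega
  have hlt := hR.lt_base (hk.trans hle)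
  obtain ⟨e₁, e₂, rfl, h₁, h₂⟩ := h.split hlt
  rw [← hR.BN_eq] at h₁ h₂
  refine hR.reduce ?_ (Packs.foldHigh (by omega) hlt hR.packs_T hR.length_T h₂ h₁)
  rw [two_mul, add_mul]
  omega

theorem mul (hR : R.IsModel γ) {a b : ℕ} {x y : E} (ha : R.Rep γ a x) (hb : R.Rep γ b y) :
    R.Rep γ (R.mul a b) (x * y) := by
  rw [PackedRing.mul, strict_eq]
  exact hR.reduce_shift le_rfl (Packs.mul ha hb)

theorem add (hR : R.IsModel γ) {a b : ℕ} {x y : E} (ha : R.Rep γ a x) (hb : R.Rep γ b y) :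
    R.Rep γ (R.add a b) (x + y) := by
  refine hR.reduce (le_trans ?_ hR.two_mul_sq_le) (Packs.add ha hb)
  have := hR.pred_le
  omega

theorem sub (hR : R.IsModel γ) {a b : ℕ} {x y : E} (ha : R.Rep γ a x) (hb : R.Rep γ b y) :
    R.Rep γ (R.sub a b) (x - y) := by
  have := hR.charP
  have hp := hR.two_le_p
  have h1 : x - y = x + ((R.p - 1 : ℕ) : E) * y := by
    rw [Nat.cast_sub (by omega), CharP.cast_eq_zero]
    ring
  rw [h1]
  refine hR.reduce (le_trans ?_ hR.two_mul_sq_le) (Packs.add ha (Packs.smul hb (R.p - 1)))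
  have := hR.pred_le
  omega

theorem one (hR : R.IsModel γ) : R.Rep γ 1 1 := by
  have h1 := hR.two_le_p
  obtain ⟨N, hN⟩ : ∃ N, R.N = N + 1 := ⟨R.N - 1, by have := hR.two_le_N; omega⟩
  rw [Rep, hN]
  simpa using Packs.natCast (B := R.B) (γ := γ) (N := N) (b := R.p - 1) (c := 1) (by omega)

theorem base (hR : R.IsModel γ) : R.Rep γ R.B γ := by
  have h1 := hR.two_le_p
  obtain ⟨N, hN⟩ : ∃ N, R.N = N + 1 + 1 := ⟨R.N - 2, by have := hR.two_le_N; omega⟩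
  rw [Rep, hN]
  simpa using (Packs.natCast (B := R.B) (γ := γ) (N := N) (b := R.p - 1) (c := 1)
    (by omega)).mul_base

theorem pow (hR : R.IsModel γ) {k a e : ℕ} {x : E} (ha : R.Rep γ a x) (he : e < 2 ^ k) :
    R.Rep γ (R.pow k a e) (x ^ e) := by
  induction k generalizing a x e with
  | zero =>
    obtain rfl : e = 0 := by simpa using he
    rw [pow_zero]
    exact hR.one
  | succ k ih =>
    have h1 : R.pow (k + 1) a e = Bool.rec
      (strict a fun a => strict (R.pow k (R.mul a a) (e / 2)) fun r =>
        Bool.rec (R.mul a r) r (Nat.beq (e % 2) 0)) 1 (Nat.beq e 0) := rfl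
    rw [h1]
    simp only [strict_eq]
    cases h0 : Nat.beq e 0 with
    | true =>
      rw [Nat.eq_of_beq_eq_true h0, pow_zero]
      exact hR.one
    | false =>
      have h2 := ih (e := e / 2) (hR.mul ha ha) (by rw [pow_succ] at he; omega)
      cases h3 : Nat.beq (e % 2) 0 with
      | true =>
        have h4 : e = e / 2 + e / 2 := by
          have := Nat.eq_of_beq_eq_true h3
          omega
        rw [mul_pow, ← pow_add, ← h4] at h2
        exact h2
      | false =>
        have h4 : e = e / 2 + e / 2 + 1 := by
          have := Nat.ne_of_beq_eq_false h3
          omega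
        rw [mul_pow, ← pow_add] at h2
        have h5 := hR.mul ha h2
        rw [← pow_succ', ← h4] at h5
        exact h5

theorem eq_of_rep (hR : R.IsModel γ) {a : ℕ} {x y : E} (hx : R.Rep γ a x) (hy : R.Rep γ a y) :
    x = y := by
  have h : R.p - 1 < R.B := hR.lt_base
    ((hR.pred_le.trans (by omega)).trans hR.two_mul_sq_le)
  exact Packs.unique h h hx hy

theorem zero (_ : R.IsModel γ) : R.Rep γ 0 0 := Packs.zero _ _ _ _

end IsModel

/-- The packed form of the coefficient list `G`. -/
def pack (B : ℕ) (G : List ℕ) : ℕ := G.rec 0 fun c _ ih => Nat.add c (Nat.mul B ih)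

/-- The packed `γ ^ i * t` for `i < k`, where `t₀` packs `γ ^ N`. -/
def table (B p N BN t₀ k : ℕ) : ℕ → List ℕ :=
  k.rec (fun _ => []) fun _ ih t => List.cons t
    (strict (redDigits B p N (foldHigh B p [t₀] (Nat.div (Nat.mul B t) BN)
      (Nat.mod (Nat.mul B t) BN))) ih)

/-- The packed ring `𝔽_p[γ]` where `γ ^ N = ∑ i < N, G i * γ ^ i`. -/
def ofCoeffs (B p : ℕ) (G : List ℕ) : PackedRing :=
  strict G.length fun N => strict (B ^ N) fun BN => strict (pack B G) fun t₀ =>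
    ⟨B, p, N, BN, table B p N BN t₀ N t₀⟩

theorem pack_packs {B b : ℕ} {G : List ℕ} (hG : ∀ c ∈ G, c ≤ b) :
    Packs B γ G.length b (pack B G) (∑ i : Fin G.length, (G[i] : E) * γ ^ (i : ℕ)) := by
  induction G with
  | nil => exact ⟨rfl, by simp⟩
  | cons c G ih =>
    rw [List.forall_mem_cons] at hG
    refine ⟨c, pack B G, _, hG.1, rfl, ?_, ih hG.2⟩
    simp only [List.length_cons, Fin.sum_univ_succ, Finset.mul_sum]
    simp only [Fin.getElem_fin, Fin.val_zero, List.getElem_cons_zero, pow_zero, mul_one,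
      Fin.val_succ, List.getElem_cons_succ]
    congr 1
    exact Finset.sum_congr rfl fun i _ => by ring

theorem isModel_ofCoeffs {B p : ℕ} {G : List ℕ} [hE : CharP E p] (hp : 2 ≤ p) (hN : 2 ≤ G.length)
    (hB : 2 * G.length * (p * p) ≤ B) (hG : ∀ c ∈ G, c < p)
    (hγ : γ ^ G.length = ∑ i : Fin G.length, (G[i] : E) * γ ^ (i : ℕ)) :
    (ofCoeffs B p G).IsModel γ := by
  simp only [ofCoeffs, strict_eq]
  set N := G.length with hNdef
  set t₀ := pack B G with ht₀
  have h0 : Packs B γ N (p - 1) t₀ (γ ^ N) := by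
    rw [hγ]
    exact pack_packs fun c hc => by
      have := hG c hc
      omega
  have hpp : p - 1 + 1 * ((p - 1) * (p - 1)) < B := by
    refine lt_of_lt_of_le ?_ hB
    obtain ⟨r, rfl⟩ : ∃ r, p = r + 1 := ⟨p - 1, by omega⟩
    simp only [Nat.add_sub_cancel]
    nlinarith
  have hstep : ∀ t (x : E), Packs B γ N (p - 1) t x → Packs B γ N (p - 1)
      (redDigits B p N (foldHigh B p [t₀] (B * t / B ^ N) (B * t % B ^ N))) (γ * x) := by
    intro t x h
    have h1 : Packs B γ (1 + N) (p - 1) (B * t) (γ * x) := by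
      rw [add_comm]
      exact h.mul_base
    obtain ⟨e₁, e₂, he, h₁, h₂⟩ := h1.split (by omega)
    rw [he]
    refine Packs.redDigits (by omega) hpp
      (Packs.foldHigh (by omega) (by omega) (fun i hi => ?_) rfl h₂ h₁)
    obtain rfl : i = 0 := by simpa using hi
    exact h0
  have htab : ∀ k j t, Packs B γ N (p - 1) t (γ ^ j) →
      (table B p N (B ^ N) t₀ k t).length = k ∧
      ∀ i (hi : i < (table B p N (B ^ N) t₀ k t).length),
        Packs B γ N (p - 1) (table B p N (B ^ N) t₀ k t)[i] (γ ^ (j + i)) := by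
    intro k
    induction k with
    | zero => exact fun j t _ => ⟨rfl, fun i hi => absurd hi (Nat.not_lt_zero i)⟩
    | succ k ih =>
      intro j t ht
      have h1 : table B p N (B ^ N) t₀ (k + 1) t = t :: table B p N (B ^ N) t₀ k
          (redDigits B p N (foldHigh B p [t₀] (B * t / B ^ N) (B * t % B ^ N))) :=
        congrArg (List.cons t) (strict_eq _ _)
      obtain ⟨hl, h2⟩ := ih (j + 1) _ (pow_succ' γ j ▸ hstep t _ ht)
      simp only [h1]
      refine ⟨by rw [List.length_cons, hl], fun i hi => ?_⟩
      cases i with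
      | zero => exact ht
      | succ i =>
        rw [List.getElem_cons_succ, show j + (i + 1) = j + 1 + i by ring]
        exact h2 i (by simpa using hi)
  obtain ⟨hl, hT⟩ := htab N N t₀ h0
  exact ⟨hE, hp, hN, hB, rfl, hl, hT⟩

end PackedRing

end Packed

section Criterion

variable {Fq F E : Type*} [Field Fq] [Field F] [Field E] [Algebra Fq F] [Algebra F E]

theorem exists_algebraMap_eq_of_pow_card_eq [Fintype F] {γ : E} (h : γ ^ Fintype.card F = γ) :
    ∃ a : F, algebraMap F E a = γ := by
  classical
  have hP : (X ^ Fintype.card F - X : E[X]) ≠ 0 :=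
    FiniteField.X_pow_card_sub_X_ne_zero E Fintype.one_lt_card
  have hroot : ∀ x : E, x ^ Fintype.card F = x →
      x ∈ (X ^ Fintype.card F - X : E[X]).roots.toFinset := fun x hx => by
    rw [Multiset.mem_toFinset, mem_roots hP, IsRoot.def, eval_sub, eval_pow, eval_X, hx, sub_self]
  have hsub : Finset.univ.image (algebraMap F E) ⊆
      (X ^ Fintype.card F - X : E[X]).roots.toFinset := by
    intro x hx
    obtain ⟨a, -, rfl⟩ := Finset.mem_image.1 hx
    exact hroot _ (by rw [← map_pow, FiniteField.pow_card])
  have heq := Finset.eq_of_subset_of_card_le hsub (by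
    rw [Finset.card_image_of_injective _ (algebraMap F E).injective, Finset.card_univ]
    refine (Multiset.toFinset_card_le _).trans ((card_roots' _).trans ?_)
    rw [FiniteField.X_pow_card_sub_X_natDegree_eq E Fintype.one_lt_card])
  have := hroot γ h
  rw [← heq, Finset.mem_image] at this
  obtain ⟨a, -, ha⟩ := this
  exact ⟨a, ha⟩

variable [Fintype Fq] [Algebra Fq E] [IsScalarTower Fq F E]

/-- The `E`-linear functional on `E[x]` sending `x ^ i` to `σ ^ (q ^ i)`. -/
def frobEval (q : ℕ) (σ : E) : E[X] →ₗ[E] E :=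
  Polynomial.lsum fun i => LinearMap.toSpanSingleton E E (σ ^ q ^ i)

theorem frobEval_monomial (q : ℕ) (σ : E) (i : ℕ) (c : E) :
    frobEval q σ (monomial i c) = c * σ ^ q ^ i := by
  rw [frobEval, lsum_apply, sum_monomial_index _ _ (by simp)]
  simp

theorem frobEval_map (h : Fq[X]) (α : F) :
    frobEval (Fintype.card Fq) (algebraMap F E α) (h.map (algebraMap Fq E)) =
      algebraMap F E (frobAct Fq F h α) := by
  induction h using Polynomial.induction_on' with
  | add g h hg hh => rw [Polynomial.map_add, map_add, hg, hh, map_add, LinearMap.add_apply, map_add]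
  | monomial i c =>
    rw [map_monomial, frobEval_monomial, ← C_mul_X_pow_eq_monomial, ← smul_eq_C_mul, map_smul,
      LinearMap.smul_apply, frobAct_X_pow, Algebra.smul_def, map_mul, map_pow,
      ← IsScalarTower.algebraMap_apply]

theorem frobEval_map_mul_eq_zero {g : Fq[X]} {α : F} (hg : frobAct Fq F g α = 0) (P : E[X]) :
    frobEval (Fintype.card Fq) (algebraMap F E α) (g.map (algebraMap Fq E) * P) = 0 := by
  induction P using Polynomial.induction_on' with
  | add P Q hP hQ => rw [mul_add, map_add, hP, hQ, add_zero]
  | monomial i c =>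
    have h1 : g.map (algebraMap Fq E) * monomial i c =
        c • (g * X ^ i).map (algebraMap Fq E) := by
      rw [← C_mul_X_pow_eq_monomial, smul_eq_C_mul, Polynomial.map_mul, Polynomial.map_pow, map_X]
      ring
    rw [h1, map_smul, frobEval_map, frobAct_eq_zero_of_dvd (dvd_mul_right g _) hg, map_zero,
      smul_zero]

theorem isTraceZeroNormal_of_forall [IsAlgClosed E] {n : ℕ} {α : F}
    (h0 : ∑ i ∈ Finset.range n, algebraMap F E α ^ Fintype.card Fq ^ i = 0)
    (h : ∀ ζ : E, ∑ i ∈ Finset.range n, ζ ^ i = 0 →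
      ∑ i ∈ Finset.range n, ζ ^ (n - 1 - i) * algebraMap F E α ^ Fintype.card Fq ^ i ≠ 0) :
    IsTraceZeroNormal Fq n α := by
  refine ⟨?_, fun p g hp hpg hg => ?_⟩
  · rw [map_sum, LinearMap.sum_apply]
    apply (algebraMap F E).injective
    simp only [frobAct_X_pow]
    rw [map_sum, map_zero, ← h0]
    exact Finset.sum_congr rfl fun i _ => map_pow _ _ _
  · obtain ⟨ζ, hζ⟩ := IsAlgClosed.exists_root (p.map (algebraMap Fq E)) (by
      rw [degree_map]
      exact hp.degree_pos.ne')
    obtain ⟨p₁, hp₁⟩ := dvd_iff_isRoot.2 hζ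
    have hmap : p.map (algebraMap Fq E) * g.map (algebraMap Fq E) =
        ∑ i ∈ Finset.range n, X ^ i := by
      rw [← Polynomial.map_mul, hpg, Polynomial.map_sum]
      simp
    have hsum : ∑ i ∈ Finset.range n, ζ ^ i = 0 := by
      have := congrArg (eval ζ) hmap
      rw [eval_mul, IsRoot.def.1 hζ, zero_mul, eval_finsetSum] at this
      simpa using this.symm
    have hζn : ζ ^ n = 1 := by
      have := geom_sum_mul ζ n
      rw [hsum, zero_mul] at this
      exact (sub_eq_zero.1 this.symm)
    have hkey : g.map (algebraMap Fq E) * (p₁ * (X - 1)) =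
        ∑ i ∈ Finset.range n, X ^ i * C ζ ^ (n - 1 - i) := by
      apply mul_right_cancel₀ (X_sub_C_ne_zero ζ)
      rw [geom_sum₂_mul, ← C_pow, hζn, C_1, ← geom_sum_mul, ← hmap, hp₁]
      ring
    refine h ζ hsum ?_
    have h1 := frobEval_map_mul_eq_zero (E := E) hg (p₁ * (X - 1))
    rw [hkey, map_sum] at h1
    rw [← h1]
    refine Finset.sum_congr rfl fun i _ => ?_
    rw [← C_pow, mul_comm (X ^ i), C_mul_X_pow_eq_monomial, frobEval_monomial]

end Criterion

section NormForms

variable {E : Type*} [Field E]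

/-- The norm form detecting normality in degree `5`. -/
def normFormFive (s₀ s₁ s₂ s₃ s₄ : E) : E :=
  let c := s₀ * s₂ + s₁ * s₃ + s₂ * s₄ + s₃ * s₀ + s₄ * s₁
  let a := s₀ * s₀ + s₁ * s₁ + s₂ * s₂ + s₃ * s₃ + s₄ * s₄ - c
  let b := s₀ * s₁ + s₁ * s₂ + s₂ * s₃ + s₃ * s₄ + s₄ * s₀ - c
  a * (a - b) - b * b

/-- The product of the norm forms detecting normality in degree `6`. -/
def normFormSix (s₀ s₁ s₂ s₃ s₄ s₅ : E) : E :=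
  let u := s₀ + s₃ - (s₂ + s₅)
  let v := s₁ + s₄ - (s₂ + s₅)
  let a := s₀ - s₃ - (s₂ - s₅)
  let b := s₁ - s₄ + (s₂ - s₅)
  (s₀ + s₂ + s₄ - (s₁ + s₃ + s₅)) * ((u * (u - v) + v * v) * (a * (a + b) + b * b))

theorem normFormFive_eq_zero {s₀ s₁ s₂ s₃ s₄ ζ : E} (hζ : ∑ i ∈ Finset.range 5, ζ ^ i = 0)
    (h : ζ ^ 4 * s₀ + ζ ^ 3 * s₁ + ζ ^ 2 * s₂ + ζ * s₃ + s₄ = 0) :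
    normFormFive s₀ s₁ s₂ s₃ s₄ = 0 := by
  simp only [Finset.sum_range_succ, Finset.sum_range_zero, zero_add, pow_zero, pow_one] at hζ
  have h5 : ζ ^ 5 = 1 := by linear_combination (ζ - 1) * hζ
  set c := s₀ * s₂ + s₁ * s₃ + s₂ * s₄ + s₃ * s₀ + s₄ * s₁ with hc
  set a := s₀ * s₀ + s₁ * s₁ + s₂ * s₂ + s₃ * s₃ + s₄ * s₄ - c with ha
  set b := s₀ * s₁ + s₁ * s₂ + s₂ * s₃ + s₃ * s₄ + s₄ * s₀ - c with hb
  have h1 : a + b * (ζ + ζ ^ 4) = 0 := by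
    have h2 : (ζ ^ 4 * s₀ + ζ ^ 3 * s₁ + ζ ^ 2 * s₂ + ζ * s₃ + s₄) *
        (ζ * s₀ + ζ ^ 2 * s₁ + ζ ^ 3 * s₂ + ζ ^ 4 * s₃ + s₄) = a + b * (ζ + ζ ^ 4) := by
      rw [ha, hb, hc]
      linear_combination ((s₀ * s₀ + s₁ * s₁ + s₂ * s₂ + s₃ * s₃) +
        (s₀ * s₁ + s₁ * s₂ + s₂ * s₃) * ζ +
        (s₀ * s₂ + s₁ * s₃) * ζ ^ 2 +
        (s₀ * s₃) * ζ ^ 3) * h5 +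
        (s₀ * s₂ + s₁ * s₃ + s₂ * s₄ + s₃ * s₀ + s₄ * s₁) * hζ
    rw [← h2, h, zero_mul]
  change a * (a - b) - b * b = 0
  have h3 : (ζ + ζ ^ 4) * (ζ + ζ ^ 4) + (ζ + ζ ^ 4) = 1 := by
    linear_combination (ζ ^ 3 + 2) * h5 + hζ
  generalize ζ + ζ ^ 4 = η at h1 h3
  linear_combination (a - b - b * η) * h1 + b ^ 2 * h3

theorem normFormSix_eq_zero {s₀ s₁ s₂ s₃ s₄ s₅ ζ : E} (hζ : ∑ i ∈ Finset.range 6, ζ ^ i = 0)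
    (h : ζ ^ 5 * s₀ + ζ ^ 4 * s₁ + ζ ^ 3 * s₂ + ζ ^ 2 * s₃ + ζ * s₄ + s₅ = 0) :
    normFormSix s₀ s₁ s₂ s₃ s₄ s₅ = 0 := by
  simp only [Finset.sum_range_succ, Finset.sum_range_zero, zero_add, pow_zero, pow_one] at hζ
  have h1 : (ζ + 1) * ((ζ ^ 2 + ζ + 1) * (ζ ^ 2 - ζ + 1)) = 0 := by linear_combination hζ
  simp only [normFormSix]
  rcases mul_eq_zero.1 h1 with h1 | h1
  · refine mul_eq_zero_of_left ?_ _
    obtain rfl : ζ = -1 := by linear_combination h1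
    linear_combination -h
  · refine mul_eq_zero_of_right _ ?_
    rcases mul_eq_zero.1 h1 with h1 | h1
    · refine mul_eq_zero_of_left ?_ _
      have h3 : ζ ^ 2 * (s₀ + s₃) + ζ * (s₁ + s₄) + (s₂ + s₅) = 0 := by
        linear_combination h - (ζ - 1) * (ζ ^ 2 * s₀ + ζ * s₁ + s₂) * h1
      generalize s₀ + s₃ = x at *
      generalize s₁ + s₄ = y at *
      generalize s₂ + s₅ = z at *
      grind
    · refine mul_eq_zero_of_right _ ?_
      have h3 : ζ ^ 2 * (s₀ - s₃) + ζ * (s₁ - s₄) + (s₂ - s₅) = 0 := by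
        linear_combination -h + (ζ + 1) * (ζ ^ 2 * s₀ + ζ * s₁ + s₂) * h1
      generalize s₀ - s₃ = x at *
      generalize s₁ - s₄ = y at *
      generalize s₂ - s₅ = z at *
      grind

end NormForms

section Explicit

/-- Trial division by all `d` with `d ^ 2 ≤ l`. -/
def primeCheck (l : ℕ) : Bool :=
  decide (2 ≤ l) && allOnDyadic (fun d => Nat.blt d 2 || !Nat.beq (l % d) 0) (l.log2 / 2 + 1) 0

theorem prime_of_primeCheck {l : ℕ} (h : primeCheck l = true) : l.Prime := by
  rw [primeCheck, Bool.and_eq_true, decide_eq_true_eq] at h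
  by_contra hl
  have h1 := Nat.minFac_sq_le_self (by omega) hl
  have h2 : l < 2 ^ (l.log2 + 1) := Nat.lt_log2_self
  have h3 : l.minFac < 2 ^ (l.log2 / 2 + 1) := by
    refine lt_of_pow_lt_pow_left₀ 2 (by positivity) (h1.trans_lt (h2.trans_le ?_))
    rw [← pow_mul]
    exact Nat.pow_le_pow_right two_pos (by omega)
  have h4 := allOnDyadic_sound h.2 (Nat.zero_le _) (by simpa using h3)
  have h5 := (Nat.minFac_prime (n := l) (by omega)).two_le
  rw [Bool.or_eq_true, Nat.blt_eq, Bool.not_eq_true', Bool.eq_false_iff, ne_eq, Nat.beq_eq] at h4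
  rcases h4 with h4 | h4
  · omega
  · exact h4 (Nat.mod_eq_zero_of_dvd (Nat.minFac_dvd l))

/-- Evaluate the entries of `l` before passing it to `f`. -/
def strictList {α : Type*} (l : List ℕ) : (List ℕ → α) → α :=
  l.rec (fun f => f []) fun x _ ih f => strict x fun x => ih fun l => f (x :: l)

theorem strictList_eq {α : Type*} (l : List ℕ) (f : List ℕ → α) : strictList l f = f l := by
  induction l generalizing f with
  | nil => rfl
  | cons x l ih =>
    change strict x (fun x => strictList l fun l => f (x :: l)) = _
    rw [strict_eq, ih]

namespace PackedRing

variable (R : PackedRing)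

/-- Evaluate the fields of `R` before passing it to `f`. -/
def force {α : Type*} (f : PackedRing → α) : α :=
  strict R.B fun B => strict R.p fun p => strict R.N fun N => strict R.BN fun BN =>
    strictList R.T fun T => f ⟨B, p, N, BN, T⟩

theorem force_eq {α : Type*} (f : PackedRing → α) : R.force f = f R := by
  simp only [force, strict_eq, strictList_eq]

/-- Packed `∑ i < n, a ^ q ^ i`. -/
def trace (q n : ℕ) : ℕ → ℕ :=
  n.rec (fun _ => 0) fun _ ih a => strict a fun a => R.add a (ih (R.pow 64 a q))

/-- Packed `normFormFive` of the conjugates of `a`. -/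
def normFive (q a : ℕ) : ℕ :=
  strict a fun s₀ => strict (R.pow 64 s₀ q) fun s₁ => strict (R.pow 64 s₁ q) fun s₂ =>
  strict (R.pow 64 s₂ q) fun s₃ => strict (R.pow 64 s₃ q) fun s₄ =>
  strict (R.add (R.add (R.add (R.add (R.mul s₀ s₂) (R.mul s₁ s₃)) (R.mul s₂ s₄)) (R.mul s₃ s₀))
    (R.mul s₄ s₁)) fun c =>
  strict (R.sub (R.add (R.add (R.add (R.add (R.mul s₀ s₀) (R.mul s₁ s₁)) (R.mul s₂ s₂))
    (R.mul s₃ s₃)) (R.mul s₄ s₄)) c) fun u =>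
  strict (R.sub (R.add (R.add (R.add (R.add (R.mul s₀ s₁) (R.mul s₁ s₂)) (R.mul s₂ s₃))
    (R.mul s₃ s₄)) (R.mul s₄ s₀)) c) fun v =>
  R.sub (R.mul u (R.sub u v)) (R.mul v v)

/-- Packed `normFormSix` of the conjugates of `a`. -/
def normSix (q a : ℕ) : ℕ :=
  strict a fun s₀ => strict (R.pow 64 s₀ q) fun s₁ => strict (R.pow 64 s₁ q) fun s₂ =>
  strict (R.pow 64 s₂ q) fun s₃ => strict (R.pow 64 s₃ q) fun s₄ =>
  strict (R.pow 64 s₄ q) fun s₅ =>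
  strict (R.sub (R.add s₀ s₃) (R.add s₂ s₅)) fun u =>
  strict (R.sub (R.add s₁ s₄) (R.add s₂ s₅)) fun v =>
  strict (R.sub (R.sub s₀ s₃) (R.sub s₂ s₅)) fun x =>
  strict (R.add (R.sub s₁ s₄) (R.sub s₂ s₅)) fun y =>
  R.mul (R.sub (R.add (R.add s₀ s₂) s₄) (R.add (R.add s₁ s₃) s₅))
    (R.mul (R.add (R.mul u (R.sub u v)) (R.mul v v)) (R.add (R.mul x (R.add x y)) (R.mul y y)))

/-- Packed `∏ l ∈ ls, (g ^ (M / l) - 1)`. -/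
def orderProd (g M : ℕ) (ls : List ℕ) : ℕ :=
  ls.rec 1 fun l _ ih => R.mul (R.sub (R.pow 64 g (M / l)) 1) ih

variable {R} {E : Type*} [Field E] {γ : E}

namespace IsModel

theorem trace (hR : R.IsModel γ) {q : ℕ} (hq : q < 2 ^ 64) (n : ℕ) {a : ℕ} {x : E} (ha : R.Rep γ a x) :
    R.Rep γ (R.trace q n a) (∑ i ∈ Finset.range n, x ^ q ^ i) := by
  induction n generalizing a x with
  | zero => exact hR.zero
  | succ n ih =>
    have h1 : R.trace q (n + 1) a = strict a fun a => R.add a (R.trace q n (R.pow 64 a q)) := rfl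
    rw [h1, strict_eq, Finset.sum_range_succ', add_comm, pow_zero, pow_one]
    have h2 := ih (hR.pow ha hq)
    simp only [← pow_mul, ← pow_succ'] at h2
    exact hR.add ha h2

theorem pow_pow (hR : R.IsModel γ) {q : ℕ} (hq : q < 2 ^ 64) {a i : ℕ} {x : E} (ha : R.Rep γ a (x ^ q ^ i)) :
    R.Rep γ (R.pow 64 a q) (x ^ q ^ (i + 1)) := by
  rw [pow_succ, pow_mul]
  exact hR.pow ha hq

theorem normFive (hR : R.IsModel γ) {q : ℕ} (hq : q < 2 ^ 64) {a : ℕ} {x : E} (ha : R.Rep γ a x) :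
    R.Rep γ (R.normFive q a)
      (normFormFive (x ^ q ^ 0) (x ^ q ^ 1) (x ^ q ^ 2) (x ^ q ^ 3) (x ^ q ^ 4)) := by
  simp only [PackedRing.normFive, strict_eq]
  have h₀ : R.Rep γ a (x ^ q ^ 0) := by simpa using ha
  have h₁ := hR.pow_pow hq h₀
  have h₂ := hR.pow_pow hq h₁
  have h₃ := hR.pow_pow hq h₂
  have h₄ := hR.pow_pow hq h₃
  have hc := hR.add (hR.add (hR.add (hR.add (hR.mul h₀ h₂) (hR.mul h₁ h₃)) (hR.mul h₂ h₄))
    (hR.mul h₃ h₀)) (hR.mul h₄ h₁)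
  have hu := hR.sub (hR.add (hR.add (hR.add (hR.add (hR.mul h₀ h₀) (hR.mul h₁ h₁))
    (hR.mul h₂ h₂)) (hR.mul h₃ h₃)) (hR.mul h₄ h₄)) hc
  have hv := hR.sub (hR.add (hR.add (hR.add (hR.add (hR.mul h₀ h₁) (hR.mul h₁ h₂))
    (hR.mul h₂ h₃)) (hR.mul h₃ h₄)) (hR.mul h₄ h₀)) hc
  exact hR.sub (hR.mul hu (hR.sub hu hv)) (hR.mul hv hv)

theorem normSix (hR : R.IsModel γ) {q : ℕ} (hq : q < 2 ^ 64) {a : ℕ} {x : E} (ha : R.Rep γ a x) :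
    R.Rep γ (R.normSix q a) (normFormSix (x ^ q ^ 0) (x ^ q ^ 1) (x ^ q ^ 2) (x ^ q ^ 3)
      (x ^ q ^ 4) (x ^ q ^ 5)) := by
  simp only [PackedRing.normSix, strict_eq]
  have h₀ : R.Rep γ a (x ^ q ^ 0) := by simpa using ha
  have h₁ := hR.pow_pow hq h₀
  have h₂ := hR.pow_pow hq h₁
  have h₃ := hR.pow_pow hq h₂
  have h₄ := hR.pow_pow hq h₃
  have h₅ := hR.pow_pow hq h₄
  have hu := hR.sub (hR.add h₀ h₃) (hR.add h₂ h₅)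
  have hv := hR.sub (hR.add h₁ h₄) (hR.add h₂ h₅)
  have hx := hR.sub (hR.sub h₀ h₃) (hR.sub h₂ h₅)
  have hy := hR.add (hR.sub h₁ h₄) (hR.sub h₂ h₅)
  exact hR.mul (hR.sub (hR.add (hR.add h₀ h₂) h₄) (hR.add (hR.add h₁ h₃) h₅))
    (hR.mul (hR.add (hR.mul hu (hR.sub hu hv)) (hR.mul hv hv))
      (hR.add (hR.mul hx (hR.add hx hy)) (hR.mul hy hy)))

theorem orderProd (hR : R.IsModel γ) {M : ℕ} (hM : M < 2 ^ 64) {g : ℕ} {x : E}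
    (hg : R.Rep γ g x) (ls : List ℕ) :
    R.Rep γ (R.orderProd g M ls) (ls.map fun l => x ^ (M / l) - 1).prod := by
  induction ls with
  | nil => exact hR.one
  | cons l ls ih =>
    rw [List.map_cons, List.prod_cons]
    exact hR.mul (hR.sub (hR.pow hg ((Nat.div_le_self _ _).trans_lt hM)) hR.one) ih

end IsModel

end PackedRing

/-- `norm` computes a quantity in `E` whose nonvanishing excludes annihilation by proper divisors
of `(x ^ n - 1) / (x - 1)`. -/
def DetectsNormal (E : Type*) [Field E] (norm : PackedRing → ℕ → ℕ → ℕ) (n : ℕ) : Prop :=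
  ∀ (R : PackedRing) (γ : E) (q a : ℕ) (x : E), R.IsModel γ → q < 2 ^ 64 → R.Rep γ a x →
    ∃ y : E, R.Rep γ (norm R q a) y ∧ (y ≠ 0 → ∀ ζ : E, ∑ i ∈ Finset.range n, ζ ^ i = 0 →
      ∑ i ∈ Finset.range n, ζ ^ (n - 1 - i) * x ^ q ^ i ≠ 0)

theorem detectsNormal_normFive (E : Type*) [Field E] :
    DetectsNormal E PackedRing.normFive 5 := fun R γ q a x hR hq ha =>
  ⟨_, hR.normFive hq ha, fun hy ζ hζ h => hy (normFormFive_eq_zero hζ (by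
    simpa [Finset.sum_range_succ] using h))⟩

theorem detectsNormal_normSix (E : Type*) [Field E] :
    DetectsNormal E PackedRing.normSix 6 := fun R γ q a x hR hq ha =>
  ⟨_, hR.normSix hq ha, fun hy ζ hζ h => hy (normFormSix_eq_zero hζ (by
    simpa [Finset.sum_range_succ] using h))⟩

/-- The generator of `R` has order `Q - 1`, and it and its inverse are `1`-normal. -/
def generatorCheck (norm : PackedRing → ℕ → ℕ → ℕ) (n q Q : ℕ) (ls : List ℕ) (R : PackedRing) :
    Bool :=
  strict (R.pow 64 R.B (Q - 2)) fun g' =>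
    Nat.beq (R.pow 64 R.B (Q - 1)) 1 && Nat.beq (R.trace q n R.B) 0 &&
    Nat.beq (R.trace q n g') 0 &&
    Nat.beq (R.pow 64 (R.mul (R.orderProd R.B (Q - 1) ls)
      (R.mul (norm R q R.B) (norm R q g'))) (Q - 1)) 1

/-- A certificate that a root of `x ^ N - ∑ i < N, G i * x ^ i` is a primitive element of the
field of `q ^ n` elements that is `1`-normal together with its inverse. -/
def pairCheck (norm : PackedRing → ℕ → ℕ → ℕ) (n p q : ℕ) (ls G : List ℕ) : Bool :=
  primeCheck p && ls.all primeCheck && decide (2 ≤ G.length) &&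
    decide (2 * G.length * (p * p) ≤ 16777216) && G.all (fun c => Nat.blt c p) &&
    strict (q ^ n) fun Q => decide (Q < 2 ^ 64) && Nat.beq (ls.prod ^ 64 % (Q - 1)) 0 &&
      (PackedRing.ofCoeffs 16777216 p G).force (generatorCheck norm n q Q ls)

theorem exists_root_of_coeffs (E : Type*) [Field E] [IsAlgClosed E] {G : List ℕ}
    (hG : 0 < G.length) :
    ∃ γ : E, γ ^ G.length = ∑ i : Fin G.length, (G[i] : E) * γ ^ (i : ℕ) := by
  have hdeg : (∑ i : Fin G.length, C (G[i] : E) * X ^ (i : ℕ)).degree <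
      (G.length : WithBot ℕ) :=
    degree_sum_fin_lt fun i : Fin G.length => (G[i] : E)
  obtain ⟨γ, hγ⟩ := IsAlgClosed.exists_root
    (X ^ G.length - ∑ i : Fin G.length, C (G[i] : E) * X ^ (i : ℕ)) (by
      rw [degree_sub_eq_left_of_degree_lt (by rwa [degree_X_pow]), degree_X_pow]
      exact_mod_cast hG.ne')
  refine ⟨γ, ?_⟩
  rw [IsRoot.def, eval_sub, eval_finsetSum, sub_eq_zero] at hγ
  simpa using hγ

variable {Fq F : Type*} [Field Fq] [Field F] [Fintype Fq] [Fintype F] [Algebra Fq F]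

theorem existsPair_of_generatorCheck {norm : PackedRing → ℕ → ℕ → ℕ} {n : ℕ}
    (hn : Module.finrank Fq F = n) (hdet : DetectsNormal (AlgebraicClosure F) norm n)
    {ls : List ℕ} (hls : ∀ l ∈ ls, l.Prime) (hQ : Fintype.card Fq ^ n < 2 ^ 64)
    (hprod : Fintype.card Fq ^ n - 1 ∣ ls.prod ^ 64) {R : PackedRing} {γ : AlgebraicClosure F}
    (hR : R.IsModel γ)
    (h : generatorCheck norm n (Fintype.card Fq) (Fintype.card Fq ^ n) ls R = true) :
    ExistsPrimitiveOneNormalPair Fq F n := by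
  have hn0 : 0 < n := by
    have : FiniteDimensional Fq F := Module.Finite.of_finite
    rw [← hn]
    exact Module.finrank_pos
  have hcard : Fintype.card F = Fintype.card Fq ^ n := by
    rw [← hn, ← Nat.card_eq_fintype_card, ← Nat.card_eq_fintype_card]
    exact Module.natCard_eq_pow_finrank
  have hQ2 : 2 ≤ Fintype.card Fq ^ n := by
    rw [← hcard]
    exact Fintype.one_lt_card
  have hq : Fintype.card Fq < 2 ^ 64 := by
    exact (Nat.le_self_pow hn0.ne' _).trans_lt hQ
  simp only [generatorCheck, strict_eq, Bool.and_eq_true, Nat.beq_eq] at h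
  set Q := Fintype.card Fq ^ n with hQdef
  obtain ⟨⟨⟨h1, h2⟩, h3⟩, h4⟩ := h
  have hg := hR.base
  have hg' := hR.pow (k := 64) hg (show Q - 2 < 2 ^ 64 by omega)
  have e1 : γ ^ (Q - 1) = 1 := by
    have := hR.pow (k := 64) hg (show Q - 1 < 2 ^ 64 by omega)
    rw [h1] at this
    exact hR.eq_of_rep this hR.one
  have hγ0 : γ ≠ 0 := by
    rintro rfl
    rw [zero_pow (by omega)] at e1
    exact zero_ne_one e1
  have e2 : ∑ i ∈ Finset.range n, γ ^ Fintype.card Fq ^ i = 0 := by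
    have := hR.trace hq n hg
    rw [h2] at this
    exact hR.eq_of_rep this hR.zero
  have e3 : ∑ i ∈ Finset.range n, (γ ^ (Q - 2)) ^ Fintype.card Fq ^ i = 0 := by
    have := hR.trace hq n hg'
    rw [h3] at this
    exact hR.eq_of_rep this hR.zero
  obtain ⟨y, hy, hy'⟩ := hdet R γ _ _ _ hR hq hg
  obtain ⟨z, hz, hz'⟩ := hdet R γ _ _ _ hR hq hg'
  have e4 : (ls.map fun l => γ ^ ((Q - 1) / l) - 1).prod * (y * z) ≠ 0 := by
    have := hR.pow (k := 64) (hR.mul (hR.orderProd (show Q - 1 < 2 ^ 64 by omega) hg ls)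
      (hR.mul hy hz)) (show Q - 1 < 2 ^ 64 by omega)
    rw [h4] at this
    intro h0
    rw [h0, zero_pow (by omega)] at this
    exact zero_ne_one (hR.eq_of_rep this hR.one)
  have hinv : γ ^ (Q - 2) = γ⁻¹ := by
    refine eq_inv_of_mul_eq_one_left ?_
    rw [← pow_succ, ← e1]
    congr 1
    omega
  rw [hinv] at e3 hz'
  obtain ⟨a, rfl⟩ := exists_algebraMap_eq_of_pow_card_eq (F := F) (γ := γ) (by
    rw [hcard, ← Nat.sub_add_cancel (show 1 ≤ Q by omega), pow_succ, e1, one_mul])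
  have hinj := (algebraMap F (AlgebraicClosure F)).injective
  rw [← map_inv₀] at e3 hz'
  have hyz := right_ne_zero_of_mul e4
  refine IsTraceZeroNormal.existsPair hn0 (fun h => hγ0 (by rw [h, map_zero])) ?_
    (isTraceZeroNormal_of_forall e2 (hy' (left_ne_zero_of_mul hyz)))
    (isTraceZeroNormal_of_forall e3 (hz' (right_ne_zero_of_mul hyz)))
  refine orderOf_eq_of_pow_and_pow_div_prime (by omega) (hinj (by rw [map_pow, e1, map_one])) ?_
  intro l hl hlQ h
  have hmem : l ∈ ls := by
    refine mem_of_prime_dvd_list_prod hls hl (hl.dvd_of_dvd_pow (hlQ.trans hprod))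
  refine left_ne_zero_of_mul e4 (List.prod_eq_zero (List.mem_map.2 ⟨l, hmem, ?_⟩))
  rw [← map_pow, h, map_one, sub_self]

theorem existsPair_of_pairCheck {norm : PackedRing → ℕ → ℕ → ℕ} {n p m : ℕ} {ls G : List ℕ}
    (hn : Module.finrank Fq F = n) (hdet : DetectsNormal (AlgebraicClosure F) norm n)
    (hq : Fintype.card Fq = p ^ m) (h : pairCheck norm n p (p ^ m) ls G = true) :
    ExistsPrimitiveOneNormalPair Fq F n := by
  rw [← hq] at h
  simp only [pairCheck, strict_eq, PackedRing.force_eq, Bool.and_eq_true, decide_eq_true_eq,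
    List.all_eq_true, Nat.beq_eq, Nat.blt_eq] at h
  obtain ⟨⟨⟨⟨⟨hp, hls⟩, hN⟩, hB⟩, hG⟩, ⟨hQ, hprod⟩, h⟩ := h
  have hp := prime_of_primeCheck hp
  have : Fact p.Prime := ⟨hp⟩
  have : CharP Fq p := charP_of_card_eq_prime_pow (f := m) hq
  have : CharP F p := charP_of_injective_algebraMap (algebraMap Fq F).injective p
  have : CharP (AlgebraicClosure F) p :=
    charP_of_injective_algebraMap (algebraMap F (AlgebraicClosure F)).injective p
  obtain ⟨γ, hγ⟩ := exists_root_of_coeffs (AlgebraicClosure F) (G := G) (by omega)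
  exact existsPair_of_generatorCheck hn hdet (fun l hl => prime_of_primeCheck (hls l hl)) hQ
    (Nat.dvd_of_mod_eq_zero hprod) (PackedRing.isModel_ofCoeffs hp.two_le hN hB hG hγ) h

end Explicit

section Certificates

/-- Certificates `(p, m, ls, G)` for the fields of `p ^ m` elements in degree `5`: the primes
dividing `p ^ (5 * m) - 1`, and the relation `γ ^ N = ∑ i < N, G i * γ ^ i` of a suitable `γ`. -/
def certificatesFive : List (ℕ × ℕ × List ℕ × List ℕ) := [
  (2, 1, [31], [1, 0, 0, 1, 0]),
  (3, 1, [2, 11], [2, 0, 1, 2, 0]),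
  (7, 1, [2, 3, 2801], [5, 0, 0, 1, 0]),
  (2, 3, [7, 31, 151], [1, 0, 1, 1, 0, 0, 1, 1, 1, 1, 0, 1, 1, 1, 0]),
  (3, 2, [2, 11, 61], [1, 0, 1, 2, 2, 1, 2, 0, 2, 0]),
  (11, 1, [2, 5, 3221], [2, 0, 2, 7, 0]),
  (13, 1, [2, 3, 30941], [6, 0, 3, 9, 0]),
  (2, 4, [3, 5, 11, 31, 41], [1, 0, 1, 0, 0, 1, 1, 0, 1, 1, 1, 0, 0, 1, 0, 1, 0, 1, 0, 0]),
  (17, 1, [2, 88741], [10, 0, 11, 9, 0]),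
  (19, 1, [2, 3, 151, 911], [2, 0, 5, 9, 0]),
  (23, 1, [2, 11, 292561], [21, 0, 19, 13, 0]),
  (3, 3, [2, 11, 13, 4561], [2, 0, 1, 1, 2, 0, 0, 1, 1, 1, 0, 2, 1, 2, 0]),
  (29, 1, [2, 7, 732541], [26, 0, 4, 23, 0]),
  (31, 1, [2, 3, 5, 11, 17351], [24, 0, 27, 14, 0]),
  (2, 5, [31, 601, 1801], [1, 0, 0, 1, 1, 1, 1, 1, 0, 0, 1, 0, 1, 1, 1, 0, 0, 1, 0, 1, 0, 0, 0,
    0, 0]),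
  (37, 1, [2, 3, 11, 41, 4271], [20, 0, 27, 19, 0]),
  (41, 1, [2, 5, 579281], [11, 0, 9, 2, 0]),
  (43, 1, [2, 3, 7, 3500201], [26, 0, 35, 25, 0]),
  (47, 1, [2, 11, 23, 31, 14621], [41, 0, 18, 38, 0]),
  (7, 2, [2, 3, 11, 191, 2801], [4, 0, 3, 4, 2, 0, 3, 4, 1, 0]),
  (53, 1, [2, 11, 13, 131, 5581], [20, 0, 33, 46, 0]),
  (59, 1, [2, 11, 29, 41, 151, 181], [50, 0, 27, 15, 0]),
  (61, 1, [2, 3, 5, 131, 21491], [7, 0, 45, 12, 0]),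
  (2, 6, [3, 7, 11, 31, 151, 331], [1, 0, 0, 0, 1, 1, 1, 0, 1, 0, 1, 0, 1, 1, 1, 0, 1, 1, 0, 0,
    0, 0, 0, 0, 1, 0, 0, 1, 1, 0]),
  (67, 1, [2, 3, 11, 761, 26881], [28, 0, 61, 31, 0]),
  (71, 1, [2, 5, 7, 11, 211, 2221], [68, 0, 49, 54, 0]),
  (73, 1, [2, 3, 28792661], [15, 0, 26, 21, 0]),
  (79, 1, [2, 3, 13, 39449441], [28, 0, 76, 24, 0]),
  (3, 4, [2, 5, 11, 61, 1181], [1, 0, 2, 0, 1, 0, 1, 1, 0, 1, 0, 2, 0, 1, 1, 0, 0, 2, 1, 0]),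
  (83, 1, [2, 41, 48037081], [66, 0, 38, 6, 0]),
  (89, 1, [2, 11, 131, 691, 701], [13, 0, 33, 46, 0]),
  (97, 1, [2, 3, 11, 31, 262321], [23, 0, 5, 67, 0]),
  (101, 1, [2, 5, 31, 491, 1381], [99, 0, 97, 48, 0]),
  (103, 1, [2, 3, 11, 17, 10332211], [84, 0, 33, 47, 0]),
  (109, 1, [2, 3, 31, 191, 24061], [70, 0, 103, 97, 0]),
  (113, 1, [2, 7, 11, 251, 59581], [5, 0, 69, 84, 0]),
  (11, 2, [2, 3, 5, 3221, 13421], [3, 0, 5, 4, 4, 4, 6, 6, 9, 0]),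
  (131, 1, [2, 5, 13, 61, 973001], [115, 0, 77, 77, 0]),
  (137, 1, [2, 11, 17, 101, 319411], [66, 0, 24, 136, 0]),
  (151, 1, [2, 3, 5, 104670301], [56, 0, 58, 68, 0]),
  (157, 1, [2, 3, 11, 13, 31, 1793161], [91, 0, 110, 25, 0]),
  (163, 1, [2, 3, 11, 31, 1301, 1601], [120, 0, 50, 26, 0]),
  (181, 1, [2, 3, 5, 11, 19622651], [2, 0, 107, 68, 0]),
  (191, 1, [2, 5, 11, 19, 1871, 13001], [110, 0, 148, 137, 0]),
  (251, 1, [2, 5, 11, 6586781], [29, 0, 133, 51, 0]),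
  (2, 8, [3, 5, 11, 17, 31, 41, 61681], [1, 0, 0, 0, 0, 1, 0, 0, 1, 1, 0, 0, 1, 1, 1, 0, 1, 0,
    1, 0, 1, 0, 0, 0, 1, 1, 0, 0, 0, 1, 1, 0, 1, 0, 0, 0, 1, 0, 0, 0])]

theorem pairCheck_certificatesFive : certificatesFive.all (fun d =>
    pairCheck PackedRing.normFive 5 d.1 (d.1 ^ d.2.1) d.2.2.1 d.2.2.2) = true := by
  decide +kernel

/-- Certificates `(p, m, ls, G)` for the fields of `p ^ m` elements in degree `6`: the primes
dividing `p ^ (6 * m) - 1`, and the relation `γ ^ N = ∑ i < N, G i * γ ^ i` of a suitable `γ`. -/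
def certificatesSix : List (ℕ × ℕ × List ℕ × List ℕ) := [
  (5, 1, [2, 3, 7, 31], [2, 0, 3, 3, 0, 0]),
  (7, 1, [2, 3, 19, 43], [4, 0, 5, 6, 1, 0]),
  (11, 1, [2, 3, 5, 7, 19, 37], [3, 0, 7, 10, 0, 0]),
  (13, 1, [2, 3, 7, 61, 157], [2, 0, 10, 3, 4, 0]),
  (17, 1, [2, 3, 7, 13, 307], [14, 0, 6, 16, 10, 0]),
  (19, 1, [2, 3, 5, 7, 127], [16, 0, 12, 18, 4, 0]),
  (23, 1, [2, 3, 7, 11, 13, 79], [18, 0, 11, 16, 20, 0]),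
  (5, 2, [2, 3, 7, 13, 31, 601], [3, 0, 4, 1, 1, 3, 3, 1, 4, 1, 3, 0]),
  (29, 1, [2, 3, 5, 7, 13, 67, 271], [18, 0, 10, 13, 4, 0]),
  (31, 1, [2, 3, 5, 7, 19, 331], [20, 0, 10, 3, 27, 0]),
  (37, 1, [2, 3, 7, 19, 31, 43, 67], [32, 0, 14, 7, 28, 0]),
  (41, 1, [2, 3, 5, 7, 547, 1723], [24, 0, 16, 20, 8, 0]),
  (43, 1, [2, 3, 7, 11, 13, 139, 631], [24, 0, 4, 31, 38, 0]),
  (47, 1, [2, 3, 7, 23, 37, 61, 103], [14, 0, 1, 18, 19, 0]),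
  (7, 2, [2, 3, 5, 13, 19, 43, 181], [4, 0, 1, 0, 5, 3, 3, 0, 4, 2, 5, 0]),
  (53, 1, [2, 3, 7, 13, 409, 919], [14, 0, 26, 35, 36, 0]),
  (59, 1, [2, 3, 5, 7, 29, 163, 3541], [20, 0, 52, 38, 41, 0]),
  (61, 1, [2, 3, 5, 7, 13, 31, 97, 523], [26, 0, 20, 38, 36, 0]),
  (67, 1, [2, 3, 7, 11, 17, 31, 4423], [16, 0, 33, 6, 26, 0]),
  (71, 1, [2, 3, 5, 7, 1657, 5113], [6, 0, 40, 53, 32, 0]),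
  (73, 1, [2, 3, 7, 37, 751, 1801], [14, 0, 32, 7, 66, 0]),
  (79, 1, [2, 3, 5, 7, 13, 43, 6163], [76, 0, 2, 58, 21, 0]),
  (83, 1, [2, 3, 7, 19, 41, 367, 2269], [21, 0, 6, 8, 67, 0]),
  (89, 1, [2, 3, 5, 7, 11, 373, 8011], [61, 0, 38, 68, 32, 0]),
  (97, 1, [2, 3, 7, 67, 139, 3169], [74, 0, 17, 34, 43, 0]),
  (101, 1, [2, 3, 5, 7, 13, 17, 37, 10303], [7, 0, 48, 28, 86, 0]),
  (103, 1, [2, 3, 7, 13, 17, 19, 79, 3571], [82, 0, 83, 2, 30, 0]),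
  (107, 1, [2, 3, 7, 13, 19, 53, 127, 199], [33, 0, 9, 51, 74, 0]),
  (109, 1, [2, 3, 5, 7, 11, 61, 193, 571], [24, 0, 13, 23, 89, 0]),
  (113, 1, [2, 3, 7, 13, 19, 991, 4219], [80, 0, 96, 1, 105, 0]),
  (11, 2, [2, 3, 5, 7, 13, 19, 37, 61, 1117], [3, 0, 8, 8, 0, 4, 8, 7, 0, 6, 2, 0]),
  (5, 3, [2, 3, 7, 19, 31, 829, 5167], [2, 0, 2, 3, 2, 3, 2, 1, 3, 3, 0, 0, 2, 3, 3, 1, 3, 0]),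
  (127, 1, [2, 3, 7, 13, 1231, 5419], [113, 0, 51, 43, 95, 0]),
  (131, 1, [2, 3, 5, 7, 11, 13, 811, 17293], [16, 0, 117, 13, 88, 0]),
  (137, 1, [2, 3, 7, 17, 23, 37, 73, 6211], [42, 0, 15, 63, 14, 0]),
  (139, 1, [2, 3, 5, 7, 13, 23, 499, 19183], [41, 0, 133, 92, 38, 0]),
  (149, 1, [2, 3, 5, 7, 31, 37, 103, 7351], [97, 0, 66, 26, 4, 0]),
  (151, 1, [2, 3, 5, 7, 19, 1093, 22651], [47, 0, 71, 145, 58, 0]),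
  (157, 1, [2, 3, 7, 13, 79, 3499, 8269], [74, 0, 24, 13, 82, 0]),
  (163, 1, [2, 3, 7, 19, 41, 67, 26407], [60, 0, 18, 60, 34, 0]),
  (167, 1, [2, 3, 7, 83, 9241, 28057], [133, 0, 48, 58, 46, 0]),
  (13, 2, [2, 3, 5, 7, 17, 61, 157, 28393], [11, 0, 0, 2, 8, 5, 2, 7, 4, 8, 8, 0]),
  (173, 1, [2, 3, 7, 13, 29, 43, 109, 30103], [134, 0, 104, 127, 89, 0]),
  (179, 1, [2, 3, 5, 7, 13, 19, 43, 89, 4603], [42, 0, 145, 112, 160, 0]),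
  (181, 1, [2, 3, 5, 7, 13, 31, 79, 139, 1051], [179, 0, 175, 18, 165, 0]),
  (191, 1, [2, 3, 5, 7, 13, 19, 31, 12097], [108, 0, 11, 53, 184, 0]),
  (193, 1, [2, 3, 7, 97, 1783, 37057], [102, 0, 4, 49, 71, 0]),
  (197, 1, [2, 3, 7, 11, 19, 61, 211, 2053], [192, 0, 146, 149, 6, 0]),
  (199, 1, [2, 3, 5, 7, 11, 13, 433, 13267], [32, 0, 48, 143, 112, 0]),
  (211, 1, [2, 3, 5, 7, 13, 31, 37, 53, 73, 607], [46, 0, 92, 24, 69, 0]),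
  (223, 1, [2, 3, 7, 31, 37, 1597, 16651], [65, 0, 137, 185, 140, 0]),
  (227, 1, [2, 3, 7, 19, 73, 113, 349, 709], [185, 0, 215, 209, 119, 0]),
  (229, 1, [2, 3, 5, 7, 19, 23, 97, 181, 7459], [6, 0, 101, 181, 5, 0]),
  (233, 1, [2, 3, 7, 13, 29, 37, 487, 7789], [48, 0, 166, 178, 69, 0]),
  (239, 1, [2, 3, 5, 7, 17, 19, 67, 283, 3019], [180, 0, 58, 181, 6, 0]),
  (241, 1, [2, 3, 5, 7, 11, 8263, 19441], [71, 0, 12, 102, 91, 0]),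
  (251, 1, [2, 3, 5, 7, 13, 43, 1471, 1609], [221, 0, 79, 199, 6, 0]),
  (257, 1, [2, 3, 7, 13, 43, 61, 241, 1087], [24, 0, 168, 238, 241, 0]),
  (263, 1, [2, 3, 7, 11, 13, 103, 109, 131, 223], [27, 0, 79, 244, 27, 0]),
  (269, 1, [2, 3, 5, 7, 13, 37, 67, 151, 3433], [247, 0, 233, 89, 132, 0]),
  (271, 1, [2, 3, 5, 7, 17, 10453, 24571], [61, 0, 132, 124, 199, 0]),
  (277, 1, [2, 3, 7, 13, 19, 23, 139, 193, 5881], [166, 0, 244, 169, 165, 0]),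
  (283, 1, [2, 3, 7, 13, 47, 71, 73, 367, 877], [227, 0, 161, 95, 95, 0]),
  (17, 2, [2, 3, 5, 7, 13, 29, 307, 83233], [7, 0, 15, 11, 6, 13, 4, 3, 6, 12, 16, 0]),
  (307, 1, [2, 3, 7, 11, 17, 37, 43, 733, 2539], [118, 0, 181, 100, 263, 0]),
  (311, 1, [2, 3, 5, 7, 13, 19, 31, 4591, 5107], [162, 0, 128, 306, 46, 0]),
  (349, 1, [2, 3, 5, 7, 19, 29, 2143, 121453], [97, 0, 315, 288, 191, 0]),
  (359, 1, [2, 3, 5, 7, 37, 179, 499, 42841], [254, 0, 44, 46, 177, 0]),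
  (373, 1, [2, 3, 7, 11, 13, 17, 19, 31, 67, 73, 109], [371, 0, 283, 164, 11, 0]),
  (389, 1, [2, 3, 5, 7, 13, 97, 21673, 50311], [291, 0, 32, 313, 329, 0]),
  (439, 1, [2, 3, 5, 7, 11, 13, 31, 67, 73, 2113], [176, 0, 55, 154, 42, 0])]

theorem pairCheck_certificatesSix : certificatesSix.all (fun d =>
    pairCheck PackedRing.normSix 6 d.1 (d.1 ^ d.2.1) d.2.2.1 d.2.2.2) = true := by
  decide +kernel

variable {Fq F : Type*} [Field Fq] [Field F] [Fintype Fq] [Fintype F] [Algebra Fq F]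

theorem existsPair_six (hn : Module.finrank Fq F = 6) (hc : Nat.gcd (Fintype.card Fq) 6 = 1) :
    ExistsPrimitiveOneNormalPair Fq F 6 := by
  rcases existsPair_six_or_mem hn hc with h | h
  · exact h
  · have hall : ∀ q ∈ explicitSix, ∃ d ∈ certificatesSix, q = d.1 ^ d.2.1 := by decide +kernel
    obtain ⟨d, hd, hq⟩ := hall _ h
    exact existsPair_of_pairCheck hn (detectsNormal_normSix _) hq
      (List.all_eq_true.1 pairCheck_certificatesSix d hd)

theorem existsPair_five (hn : Module.finrank Fq F = 5) (hc : Nat.gcd (Fintype.card Fq) 5 = 1)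
    (h4 : Fintype.card Fq ≠ 4) : ExistsPrimitiveOneNormalPair Fq F 5 := by
  rcases existsPair_five_or_mem hn hc with h | h
  · exact h
  · have hall : ∀ q ∈ explicitFive, q ≠ 4 → ∃ d ∈ certificatesFive, q = d.1 ^ d.2.1 := by
      decide +kernel
    obtain ⟨d, hd, hq⟩ := hall _ h h4
    exact existsPair_of_pairCheck hn (detectsNormal_normFive _) hq
      (List.all_eq_true.1 pairCheck_certificatesFive d hd)

end Certificates

section Exception

variable {Fq F : Type*} [Field Fq] [Field F] [Fintype Fq] [Algebra Fq F]

theorem isKNormal_five_trace_eq_zero (h4 : Fintype.card Fq = 4) {α : F}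
    (h : IsKNormal Fq 4 5 1 α) : ∑ i ∈ Finset.range 5, α ^ 4 ^ i = 0 := by
  obtain ⟨h, ⟨hm, ⟨k, hk⟩, h0, -⟩, hdeg⟩ := h
  have hmon : (X ^ 5 - 1 : Fq[X]).Monic := monic_X_pow_sub_C 1 (by norm_num)
  have hkm : k.Monic := hm.of_mul_monic_left (by rwa [← hk])
  have hkdeg : k.natDegree = 1 := by
    have h1 := hm.natDegree_mul hkm
    have h2 : (X ^ 5 - 1 : Fq[X]).natDegree = 5 := natDegree_X_pow_sub_C
    rw [← hk, h2] at h1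
    omega
  obtain ⟨d, rfl⟩ : ∃ d, k = X - C d :=
    ⟨-k.coeff 0, by rw [map_neg, sub_neg_eq_add]; exact hkm.eq_X_add_C hkdeg⟩
  have hd5 : d ^ 5 = 1 := by
    have := congrArg (eval d) hk
    simpa [sub_eq_zero] using this
  have hd4 : d ^ 4 = d := by
    have := FiniteField.pow_card d
    rwa [h4] at this
  obtain rfl : d = 1 := by
    have h2 : d ^ 2 = 1 := by linear_combination hd5 - d * hd4
    linear_combination -hd4 + (d ^ 2 + 1) * h2
  have hh : h = ∑ i ∈ Finset.range 5, X ^ i := by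
    apply mul_right_cancel₀ (X_sub_C_ne_zero (1 : Fq))
    rw [← hk, C_1, geom_sum_mul]
  rw [← h4, polyAct_eq_frobAct, hh, map_sum, LinearMap.sum_apply] at h0
  simpa only [frobAct_X_pow, h4] using h0

theorem isKNormal_five_form_ne_zero (h4 : Fintype.card Fq = 4) {α : F}
    (h : IsKNormal Fq 4 5 1 α) :
    (α ^ 16 + α) * (α ^ 16 + α) + (α ^ 16 + α) * α ^ 4 + α ^ 4 * α ^ 4 ≠ 0 := by
  obtain ⟨h, ⟨-, -, -, hmin⟩, hdeg⟩ := h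
  have : Fact (Nat.Prime 2) := ⟨Nat.prime_two⟩
  have hchar : CharP Fq 2 := charP_of_card_eq_prime_pow (f := 2) h4
  have h2 : (2 : Fq) = 0 := CharP.cast_eq_zero Fq 2
  obtain ⟨ω, hω⟩ : ∃ ω : Fq, ω ^ 2 + ω + 1 = 0 := by
    classical
    obtain ⟨ω, -, hω⟩ := Finset.exists_mem_notMem_of_card_lt_card
      (s := ({0, 1} : Finset Fq)) (t := Finset.univ) (by
        rw [Finset.card_univ, h4]
        exact Finset.card_le_two.trans_lt (by norm_num))
    have hpow := FiniteField.pow_card ω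
    rw [h4] at hpow
    simp only [Finset.mem_insert, Finset.mem_singleton, not_or] at hω
    refine ⟨ω, ?_⟩
    have h1 : (ω * (ω - 1)) * (ω ^ 2 + ω + 1) = 0 := by linear_combination hpow
    exact (mul_eq_zero.1 h1).resolve_left (mul_ne_zero hω.1 (sub_ne_zero.2 hω.2))
  have hdiv : ∀ c d : Fq, c + d = 1 → c * d = 1 →
      algebraMap Fq F c * α ^ 4 + (α ^ 16 + α) ≠ 0 := by
    intro c d hs hp h0
    have hfac : (X ^ 5 - 1 : Fq[X]) = (X ^ 2 + C c * X + 1) * ((X ^ 2 + C d * X + 1) * (X - 1)) := by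
      have hs' : C c + C d = (1 : Fq[X]) := by rw [← C_add, hs, C_1]
      have hp' : C c * C d = (1 : Fq[X]) := by rw [← C_mul, hp, C_1]
      have h2' : (2 : Fq[X]) = 0 := by
        rw [← C_ofNat, h2, C_0]
      linear_combination (-(X ^ 3 + X) * (X - 1)) * hs' - X ^ 2 * (X - 1) * hp' -
        X ^ 2 * (X - 1) * h2'
    have hq : (X ^ 2 + C c * X + 1 : Fq[X]).natDegree = 2 := by compute_degree!
    have hqm : (X ^ 2 + C c * X + 1 : Fq[X]).Monic := by monicity!
    have h3 := hmin _ hqm ⟨_, hfac⟩ (by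
      rw [← h4, polyAct_eq_frobAct]
      have e : (X ^ 2 + C c * X + 1 : Fq[X]) = X ^ 2 + c • X ^ 1 + X ^ 0 := by
        rw [smul_eq_C_mul, pow_one, pow_zero]
      rw [e, map_add, map_add, map_smul, LinearMap.add_apply, LinearMap.add_apply,
        LinearMap.smul_apply, frobAct_X_pow, frobAct_X_pow, frobAct_X_pow, h4, Algebra.smul_def,
        ← h0]
      ring)
    omega
  have h2F : (2 : F) = 0 := by
    rw [← map_ofNat (algebraMap Fq F) 2, h2, map_zero]
  have hωF : algebraMap Fq F ω ^ 2 + algebraMap Fq F ω + 1 = 0 := by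
    rw [← map_pow, ← map_add, ← map_one (algebraMap Fq F), ← map_add, hω, map_zero]
  have hsum : ω + (ω + 1) = 1 := by linear_combination ω * h2
  have hprod : ω * (ω + 1) = 1 := by linear_combination hω - h2
  have key := mul_ne_zero (hdiv ω (ω + 1) hsum hprod)
    (hdiv (ω + 1) ω (by rw [add_comm, hsum]) (by rw [mul_comm, hprod]))
  rw [map_add, map_one] at key
  generalize α ^ 16 + α = y at *
  generalize α ^ 4 = z at *
  generalize algebraMap Fq F ω = w at *
  intro h0
  refine key ?_
  linear_combination h0 + z ^ 2 * hωF + (w * y * z - z ^ 2) * h2F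

/-- Necessary conditions for `x` and `x⁻¹` to be `1`-normal over a field of four elements. -/
def PassesNormalTests {K : Type*} [Field K] (x : K) : Prop :=
  ∑ i ∈ Finset.range 5, x ^ 4 ^ i = 0 ∧ ∑ i ∈ Finset.range 5, x⁻¹ ^ 4 ^ i = 0 ∧
    (x ^ 16 + x) * (x ^ 16 + x) + (x ^ 16 + x) * x ^ 4 + x ^ 4 * x ^ 4 ≠ 0 ∧
    (x⁻¹ ^ 16 + x⁻¹) * (x⁻¹ ^ 16 + x⁻¹) + (x⁻¹ ^ 16 + x⁻¹) * x⁻¹ ^ 4 + x⁻¹ ^ 4 * x⁻¹ ^ 4 ≠ 0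

theorem PassesNormalTests.map {K L : Type*} [Field K] [Field L] (φ : K →+* L) {x : K}
    (h : PassesNormalTests x) : PassesNormalTests (φ x) := by
  obtain ⟨h1, h2, h3, h4⟩ := h
  simp only [PassesNormalTests, ← map_inv₀, ← map_pow, ← map_sum, ← map_add, ← map_mul, h1, h2,
    map_zero, ne_eq, map_eq_zero, true_and]
  exact ⟨h3, h4⟩

namespace PackedRing

variable (R : PackedRing)

/-- Packed `y * y + y * z + z * z` for `y = a ^ 16 + a` and `z = a ^ 4`. -/
def quadForm (a : ℕ) : ℕ :=
  strict a fun a => strict (R.pow 64 a 4) fun z =>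
  strict (R.add (R.pow 64 a 16) a) fun y =>
  R.add (R.add (R.mul y y) (R.mul y z)) (R.mul z z)

/-- Neither `a` nor `b` is excluded by the necessary conditions for being `1`-normal. -/
def mayBeNormal (a b : ℕ) : Bool :=
  !Nat.beq (R.pow 64 (R.trace 4 5 a) 3) 1 && !Nat.beq (R.pow 64 (R.trace 4 5 b) 3) 1 &&
    !Nat.beq (R.quadForm a) 0 && !Nat.beq (R.quadForm b) 0

variable {R} {E : Type*} [Field E] {γ : E}

theorem IsModel.quadForm (hR : R.IsModel γ) {a : ℕ} {x : E} (ha : R.Rep γ a x) :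
    R.Rep γ (R.quadForm a)
      ((x ^ 16 + x) * (x ^ 16 + x) + (x ^ 16 + x) * x ^ 4 + x ^ 4 * x ^ 4) := by
  simp only [PackedRing.quadForm, strict_eq]
  have hz := hR.pow (k := 64) ha (show 4 < 2 ^ 64 by norm_num)
  have hy := hR.add (hR.pow (k := 64) ha (show 16 < 2 ^ 64 by norm_num)) ha
  exact hR.add (hR.add (hR.mul hy hy) (hR.mul hy hz)) (hR.mul hz hz)

theorem IsModel.trace_cube_ne_one (hR : R.IsModel γ) {a : ℕ} {x : E} (ha : R.Rep γ a x)
    (hx : ∑ i ∈ Finset.range 5, x ^ 4 ^ i = 0) : R.pow 64 (R.trace 4 5 a) 3 ≠ 1 := by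
  intro h
  have h1 := hR.pow (k := 64) (hR.trace (q := 4) (by norm_num) 5 ha) (show 3 < 2 ^ 64 by norm_num)
  rw [h, hx, zero_pow (by norm_num)] at h1
  exact zero_ne_one (hR.eq_of_rep h1 hR.one)

theorem IsModel.quadForm_ne_zero (hR : R.IsModel γ) {a : ℕ} {x : E} (ha : R.Rep γ a x)
    (hx : (x ^ 16 + x) * (x ^ 16 + x) + (x ^ 16 + x) * x ^ 4 + x ^ 4 * x ^ 4 ≠ 0) :
    R.quadForm a ≠ 0 := by
  intro h
  have h1 := hR.quadForm ha
  rw [h] at h1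
  exact hx (hR.eq_of_rep h1 hR.zero)

end PackedRing

/-- The coefficients in `γ ^ 10 = γ ^ 3 + 1`. -/
def coeffsTen : List ℕ := [1, 0, 0, 1, 0, 0, 0, 0, 0, 0]

theorem order_coeffsTen : ((PackedRing.ofCoeffs 16777216 2 coeffsTen).force fun R =>
    Nat.beq (R.pow 64 R.B 1023) 1 &&
      Nat.beq (R.pow 64 (R.orderProd R.B 1023 [3, 11, 31]) 1023) 1) = true := by
  decide +kernel

theorem not_mayBeNormal_coeffsTen :
    ((PackedRing.ofCoeffs 16777216 2 coeffsTen).force fun R =>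
      allOnDyadic (fun i => !Nat.beq (Nat.gcd i 1023) 1 ||
        (List.range 10).any (fun k => Nat.blt (2 ^ k * i % 1023) i) ||
        !R.mayBeNormal (R.pow 64 R.B i) (R.pow 64 R.B (1023 - i))) 10 0) = true := by
  decide +kernel

theorem not_passesNormalTests_pow {E : Type*} [Field E] [CharP E 2] {R : PackedRing} {γ : E}
    (hR : R.IsModel γ) (hγ : γ ^ 1023 = 1)
    (h : allOnDyadic (fun i => !Nat.beq (Nat.gcd i 1023) 1 ||
        (List.range 10).any (fun k => Nat.blt (2 ^ k * i % 1023) i) ||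
        !R.mayBeNormal (R.pow 64 R.B i) (R.pow 64 R.B (1023 - i))) 10 0 = true)
    {i : ℕ} (hi : i < 1023) (hcop : i.Coprime 1023) : ¬ PassesNormalTests (γ ^ i) := by
  induction i using Nat.strong_induction_on with
  | _ i ih =>
    intro hp
    have h3 := allOnDyadic_sound h (Nat.zero_le i) (by omega)
    rw [Bool.or_eq_true, Bool.or_eq_true, Bool.not_eq_true', Bool.eq_false_iff, ne_eq, Nat.beq_eq,
      List.any_eq_true] at h3
    rcases h3 with (h3 | ⟨k, -, hk⟩) | h3
    · exact h3 hcop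
    · rw [Nat.blt_eq] at hk
      refine ih _ hk (hk.trans hi) ?_ ?_
      · rw [Nat.Coprime, ← Nat.gcd_rec, Nat.gcd_comm]
        exact Nat.Coprime.mul_left (Nat.Coprime.pow_left k (by decide)) hcop
      · have := hp.map (iterateFrobenius E 2 k)
        rwa [iterateFrobenius_def, ← pow_mul, mul_comm, ← Nat.div_add_mod (2 ^ k * i) 1023, pow_add,
          pow_mul, hγ, one_pow, one_mul] at this
    · have ha := hR.pow (k := 64) hR.base (show i < 2 ^ 64 by omega)
      have hb := hR.pow (k := 64) hR.base (show 1023 - i < 2 ^ 64 by omega)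
      have hinv : γ ^ (1023 - i) = (γ ^ i)⁻¹ := by
        refine eq_inv_of_mul_eq_one_left ?_
        rw [← pow_add, Nat.sub_add_cancel hi.le, hγ]
      rw [hinv] at hb
      obtain ⟨t1, t2, f1, f2⟩ := hp
      have c1 := hR.trace_cube_ne_one ha t1
      have c2 := hR.trace_cube_ne_one hb t2
      have c3 := hR.quadForm_ne_zero ha f1
      have c4 := hR.quadForm_ne_zero hb f2
      rw [ne_eq, ← Nat.beq_eq, ← ne_eq, ← Bool.eq_false_iff] at c1 c2 c3 c4
      rw [PackedRing.mayBeNormal, c1, c2, c3, c4] at h3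
      exact Bool.false_ne_true h3

theorem not_existsPair_of_card_four (h4 : Fintype.card Fq = 4) {α : F}
    (ho : orderOf α = 1023) (h : IsKNormal Fq 4 5 1 α) (h' : IsKNormal Fq 4 5 1 α⁻¹) : False := by
  have : Fact (Nat.Prime 2) := ⟨Nat.prime_two⟩
  have : CharP Fq 2 := charP_of_card_eq_prime_pow (f := 2) h4
  have : CharP F 2 := charP_of_injective_algebraMap (algebraMap Fq F).injective 2
  have : CharP (AlgebraicClosure F) 2 :=
    charP_of_injective_algebraMap (algebraMap F (AlgebraicClosure F)).injective 2
  obtain ⟨γ, hγ⟩ := exists_root_of_coeffs (AlgebraicClosure F) (G := coeffsTen) (by decide)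
  have hR := PackedRing.isModel_ofCoeffs (B := 16777216) (p := 2) le_rfl (by decide) (by decide)
    (by decide) hγ
  have h1 := order_coeffsTen
  have h2 := not_mayBeNormal_coeffsTen
  rw [PackedRing.force_eq] at h1 h2
  generalize PackedRing.ofCoeffs 16777216 2 coeffsTen = R at hR h1 h2
  have hg := hR.base
  rw [Bool.and_eq_true, Nat.beq_eq, Nat.beq_eq] at h1
  have e1 : γ ^ 1023 = 1 := by
    have := hR.pow (k := 64) hg (show 1023 < 2 ^ 64 by norm_num)
    rw [h1.1] at this
    exact hR.eq_of_rep this hR.one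
  have e2 : ([3, 11, 31].map fun l => γ ^ (1023 / l) - 1).prod ≠ 0 := by
    have := hR.pow (k := 64) (hR.orderProd (M := 1023) (by norm_num) hg [3, 11, 31])
      (show 1023 < 2 ^ 64 by norm_num)
    rw [h1.2] at this
    intro h0
    rw [h0, zero_pow (by norm_num)] at this
    exact zero_ne_one (hR.eq_of_rep this hR.one)
  have hγo : orderOf γ = 1023 := by
    refine orderOf_eq_of_pow_and_pow_div_prime (by norm_num) e1 fun l hl hl' hone => ?_
    have hmem : l ∈ [3, 11, 31] :=
      mem_of_prime_dvd_list_prod (by norm_num) hl (by simpa using hl')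
    exact e2 (List.prod_eq_zero (List.mem_map.2 ⟨l, hmem, by rw [hone, sub_self]⟩))
  have hprim : IsPrimitiveRoot γ 1023 := hγo ▸ IsPrimitiveRoot.orderOf γ
  have hα : IsPrimitiveRoot (algebraMap F (AlgebraicClosure F) α) 1023 :=
    (ho ▸ IsPrimitiveRoot.orderOf α).map_of_injective (algebraMap F (AlgebraicClosure F)).injective
  obtain ⟨i, hi, hcop, hαi⟩ := hprim.isPrimitiveRoot_iff.1 hα
  refine not_passesNormalTests_pow hR e1 h2 hi hcop ?_
  rw [hαi]
  exact PassesNormalTests.map _ ⟨isKNormal_five_trace_eq_zero h4 h,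
    isKNormal_five_trace_eq_zero h4 h', isKNormal_five_form_ne_zero h4 h,
    isKNormal_five_form_ne_zero h4 h'⟩

end Exception

/-- For `n ∈ {5, 6}` and any prime power `q` with `gcd(q, n) = 1`, there is
`α ∈ F_{q^n}^*` such that both `α` and `α⁻¹` are simultaneously primitive and
`1`-normal over `F_q`, with the sole genuine exception `(q, n) = (4, 5)`,
for which no such `α` exists. -/
theorem exists_primitive_one_normal_pair_of_n_five_or_six
    (q n : ℕ) (hq : IsPrimePow q) (hn : n = 5 ∨ n = 6) (hgcd : Nat.gcd q n = 1)
    (Fq F : Type*) [Field Fq] [Field F] [Fintype Fq] [Fintype F] [Algebra Fq F]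
    (hcard : Fintype.card Fq = q) (hdim : Module.finrank Fq F = n) :
    (¬(q = 4 ∧ n = 5) →
      ∃ α : F, α ≠ 0 ∧ orderOf α = q ^ n - 1 ∧ orderOf α⁻¹ = q ^ n - 1 ∧
        IsKNormal Fq q n 1 α ∧ IsKNormal Fq q n 1 α⁻¹) ∧
    ((q = 4 ∧ n = 5) →
      ¬ ∃ α : F, α ≠ 0 ∧ orderOf α = q ^ n - 1 ∧ orderOf α⁻¹ = q ^ n - 1 ∧
        IsKNormal Fq q n 1 α ∧ IsKNormal Fq q n 1 α⁻¹) := by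
  subst hcard
  rcases hn with rfl | rfl
  · refine ⟨fun h => existsPair_five hdim hgcd fun h4 => h ⟨h4, rfl⟩, ?_⟩
    rintro ⟨h4, -⟩ ⟨α, -, ho, -, h, h'⟩
    rw [h4] at ho h h'
    exact not_existsPair_of_card_four h4 ho h h'
  · exact ⟨fun _ => existsPair_six hdim hgcd, fun h => absurd h.2 (by norm_num)⟩

end
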